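/- arXiv:2210.03064 — 2 statements merged into one kernel-verified Lean document; each statement's English description precedes it below -/
import Mathlib

section
/- For all integers 1 ≤ ℓ < k and every ε > 0 there exists a constant C = C(ℓ,k,ε) > 0 with the following property. For every γ > 0 there exists n₀ such that for every n ≥ n₀ divisible by k and every n-vertex k-uniform hypergraph 𝓗 with δ_ℓ(𝓗) ≥ (δ⁺_{ℓ,k} + ε)·binom(n, k−ℓ), the random subhypergraph 𝓗(C·log n / n^{k−1}) contains a perfect matching with probability at least 1 − γ. -/
open Finset

/-- A matching `M` of the `k`-uniform hypergraph `H` (on vertex set `Fin n`) which is perfect: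
`M` consists of hyperedges of `H`, they are pairwise disjoint, and they cover every vertex. -/
def HyperPM {n : ℕ} (H M : Finset (Finset (Fin n))) : Prop :=
  M ⊆ H ∧ (M : Set (Finset (Fin n))).PairwiseDisjoint id ∧ M.biUnion id = Finset.univ

/-- The degree of a vertex set `S` in the hypergraph `H`: the number of hyperedges containing `S`. -/
def hDeg {n : ℕ} (H : Finset (Finset (Fin n))) (S : Finset (Fin n)) : ℕ :=
  (H.filter (fun h => S ⊆ h)).card

/-- `t(n,k,ℓ)`: the smallest `d` such that every `n`-vertex `k`-uniform hypergraph with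
minimum `ℓ`-degree at least `d` contains a perfect matching. -/
noncomputable def diracT (n k l : ℕ) : ℕ :=
  sInf {d : ℕ | ∀ H : Finset (Finset (Fin n)), (∀ e ∈ H, e.card = k) →
    (∀ S : Finset (Fin n), S.card = l → d ≤ hDeg H S) → ∃ M, HyperPM H M}

/-- The `ℓ`-degree Dirac threshold `δ⁺_{ℓ,k} = lim_{n → ∞, k ∣ n} t(n,k,ℓ)/C(n,k-ℓ)`
(the limit is known to exist, so it equals the limsup along that filter). -/
noncomputable def diracThreshold (k l : ℕ) : ℝ :=
  Filter.limsup (fun n : ℕ => (diracT n k l : ℝ) / (n.choose (k - l)))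
    (Filter.atTop ⊓ Filter.principal {n | k ∣ n})

open Classical in
/-- The probability that the binomial random subset of `E` with retention probability `p`
satisfies the property `P`. -/
noncomputable def edgeProb {β : Type*} [DecidableEq β] (E : Finset β) (p : ℝ)
    (P : Finset β → Prop) : ℝ :=
  ∑ F ∈ E.powerset, if P F then p ^ F.card * (1 - p) ^ (E.card - F.card) else 0

/-- Expectation of `F` over the binomial random subset of `E` with retention probability `p`. -/
noncomputable def binomExp {β : Type*} [DecidableEq β] (E : Finset β) (p : ℝ)
    (F : Finset β → ℝ) : ℝ :=
  ∑ W ∈ E.powerset, p ^ W.card * (1 - p) ^ (E.card - W.card) * F W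

section BinomExp

variable {β : Type*} [DecidableEq β]

open Classical in
lemma edgeProb_eq_binomExp (E : Finset β) (p : ℝ) (P : Finset β → Prop) :
    edgeProb E p P = binomExp E p (fun W => if P W then 1 else 0) := by
  unfold edgeProb binomExp
  refine Finset.sum_congr rfl fun W _ => ?_
  by_cases hP : P W <;> simp [hP]

lemma binomExp_empty (p : ℝ) (F : Finset β → ℝ) : binomExp ∅ p F = F ∅ := by
  simp [binomExp]

lemma binomExp_insert {a : β} {E : Finset β} (ha : a ∉ E) (p : ℝ) (F : Finset β → ℝ) :
    binomExp (insert a E) p F =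
      (1 - p) * binomExp E p F + p * binomExp E p (fun W => F (insert a W)) := by
  unfold binomExp
  rw [Finset.sum_powerset_insert ha, Finset.mul_sum, Finset.mul_sum]
  congr 1
  · refine Finset.sum_congr rfl fun W hW => ?_
    have hc := Finset.card_le_card (Finset.mem_powerset.mp hW)
    rw [Finset.card_insert_of_notMem ha, Nat.succ_sub hc, pow_succ]
    ring
  · refine Finset.sum_congr rfl fun W hW => ?_
    have haW : a ∉ W := fun h => ha (Finset.mem_powerset.mp hW h)
    rw [Finset.card_insert_of_notMem ha, Finset.card_insert_of_notMem haW,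
      Nat.add_sub_add_right, pow_succ]
    ring

lemma binomExp_const (E : Finset β) (p c : ℝ) : binomExp E p (fun _ => c) = c := by
  induction E using Finset.induction_on with
  | empty => exact binomExp_empty p _
  | insert a E ha ih => rw [binomExp_insert ha, ih]; ring

lemma binomExp_add (E : Finset β) (p : ℝ) (F G : Finset β → ℝ) :
    binomExp E p (fun W => F W + G W) = binomExp E p F + binomExp E p G := by
  simp only [binomExp, ← Finset.sum_add_distrib, mul_add]

lemma binomExp_sub (E : Finset β) (p : ℝ) (F G : Finset β → ℝ) :
    binomExp E p (fun W => F W - G W) = binomExp E p F - binomExp E p G := by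
  simp only [binomExp, ← Finset.sum_sub_distrib, mul_sub]

lemma binomExp_mul_left (E : Finset β) (p c : ℝ) (F : Finset β → ℝ) :
    binomExp E p (fun W => c * F W) = c * binomExp E p F := by
  simp only [binomExp, Finset.mul_sum]
  exact Finset.sum_congr rfl fun W _ => by ring

lemma binomExp_le {E : Finset β} {p : ℝ} (h0 : 0 ≤ p) (h1 : p ≤ 1) {F G : Finset β → ℝ}
    (h : ∀ W ⊆ E, F W ≤ G W) : binomExp E p F ≤ binomExp E p G := by
  refine Finset.sum_le_sum fun W hW => ?_
  have : 0 ≤ 1 - p := by linarith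
  exact mul_le_mul_of_nonneg_left (h W (Finset.mem_powerset.mp hW)) (by positivity)

lemma binomExp_binomExp (E : Finset β) (p₁ p₂ : ℝ) (F : Finset β → ℝ) :
    binomExp E p₁ (fun W₁ => binomExp E p₂ (fun W₂ => F (W₁ ∪ W₂))) =
      binomExp E (p₁ + p₂ - p₁ * p₂) F := by
  induction E using Finset.induction_on generalizing F with
  | empty => simp [binomExp_empty]
  | insert a E ha ih =>
    simp only [binomExp_insert ha, Finset.union_insert, Finset.insert_union,
      Finset.insert_idem, binomExp_add, binomExp_mul_left, ih F,
      ih (fun W => F (insert a W))]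
    ring

lemma binomExp_mono_prob {E : Finset β} {p p' : ℝ} (h0 : 0 ≤ p') (hp : p' ≤ p) (h1 : p ≤ 1)
    {F : Finset β → ℝ} (hF : Monotone F) : binomExp E p' F ≤ binomExp E p F := by
  induction E using Finset.induction_on generalizing F with
  | empty => simp [binomExp_empty]
  | insert a E ha ih =>
    have hG : Monotone (fun W : Finset β => F (insert a W)) :=
      fun A B hAB => hF (Finset.insert_subset_insert a hAB)
    have h2 := ih hF
    have h3 := ih hG
    have h4 : binomExp E p F ≤ binomExp E p (fun W => F (insert a W)) :=
      binomExp_le (h0.trans hp) h1 fun W _ => hF (Finset.subset_insert a W)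
    rw [binomExp_insert ha, binomExp_insert ha]
    nlinarith [mul_nonneg (sub_nonneg.2 (hp.trans h1)) (sub_nonneg.2 h2),
      mul_nonneg h0 (sub_nonneg.2 h3), mul_nonneg (sub_nonneg.2 hp) (sub_nonneg.2 h4)]

end BinomExp

section Fragments

variable {β ι : Type*} [DecidableEq β]

/-- A finite weighted family of sets, indexed by `I`, is `q`-spread if the total weight of the
members containing any given set `S` is at most `q ^ #S`. -/
def IsSpread (I : Finset ι) (w : ι → ℝ) (A : ι → Finset β) (q : ℝ) : Prop :=
  ∀ S : Finset β, ∑ i ∈ I with S ⊆ A i, w i ≤ q ^ S.card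

/-- `T W i` is a minimum fragment of `A i` with respect to `W`: a set of minimum size among the
sets `A j \ W` with `A j ⊆ A i ∪ W`. -/
def IsMinFragment (I : Finset ι) (A : ι → Finset β) (T : Finset β → ι → Finset β) : Prop :=
  ∀ W, ∀ i ∈ I, (∃ j ∈ I, T W i = A j \ W ∧ A j ⊆ A i ∪ W) ∧
    ∀ j ∈ I, A j ⊆ A i ∪ W → (T W i).card ≤ (A j \ W).card

lemma exists_isMinFragment (I : Finset ι) (A : ι → Finset β) :
    ∃ T : Finset β → ι → Finset β, IsMinFragment I A T := by
  have key : ∀ (W : Finset β) (i : ι), ∃ t : Finset β, i ∈ I →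
      (∃ j ∈ I, t = A j \ W ∧ A j ⊆ A i ∪ W) ∧
      ∀ j ∈ I, A j ⊆ A i ∪ W → t.card ≤ (A j \ W).card := by
    intro W i
    by_cases hi : i ∈ I
    · obtain ⟨j, hj, hmin⟩ := Finset.exists_min_image (I.filter fun j => A j ⊆ A i ∪ W)
        (fun j => (A j \ W).card) ⟨i, by simp [hi]⟩
      rw [Finset.mem_filter] at hj
      exact ⟨A j \ W, fun _ => ⟨⟨j, hj.1, rfl, hj.2⟩, fun j' hj' h' =>
        hmin j' (Finset.mem_filter.2 ⟨hj', h'⟩)⟩⟩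
    · exact ⟨∅, fun h => absurd h hi⟩
  choose T hT using key
  exact ⟨T, fun W i hi => hT W i hi⟩

variable {I : Finset ι} {w : ι → ℝ} {A : ι → Finset β} {T : Finset β → ι → Finset β}
  {E : Finset β} {q p : ℝ} {s : ℕ}

lemma IsMinFragment.subset (hT : IsMinFragment I A T) (W : Finset β) {i : ι} (hi : i ∈ I) :
    T W i ⊆ A i := by
  obtain ⟨⟨j, -, h, hj⟩, -⟩ := hT W i hi
  rw [h]
  intro x hx
  rw [Finset.mem_sdiff] at hx
  exact (Finset.mem_union.1 (hj hx.1)).resolve_right hx.2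

lemma IsMinFragment.disjoint (hT : IsMinFragment I A T) (W : Finset β) {i : ι} (hi : i ∈ I) :
    Disjoint W (T W i) := by
  obtain ⟨⟨j, -, h, -⟩, -⟩ := hT W i hi
  rw [h]
  exact Finset.disjoint_sdiff

lemma IsMinFragment.subset_of_subset_union (hT : IsMinFragment I A T) (W : Finset β) {i j : ι}
    (hi : i ∈ I) (hj : j ∈ I) (h : A j ⊆ W ∪ T W i) : T W i ⊆ A j := by
  have h1 : A j \ W ⊆ T W i := by
    intro x hx
    rw [Finset.mem_sdiff] at hx
    exact (Finset.mem_union.1 (h hx.1)).resolve_left hx.2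
  have h2 : A j ⊆ A i ∪ W := fun x hx => by
    rcases Finset.mem_union.1 (h hx) with h' | h'
    · exact Finset.mem_union_right _ h'
    · exact Finset.mem_union_left _ (hT.subset W hi h')
  rw [← Finset.eq_of_subset_of_card_le h1 ((hT W i hi).2 j hj h2)]
  exact Finset.sdiff_subset

lemma IsMinFragment.exists_subset_union (hT : IsMinFragment I A T) (W : Finset β) {i : ι}
    (hi : i ∈ I) : ∃ j ∈ I, A j ⊆ W ∪ T W i := by
  obtain ⟨⟨j, hj, h, -⟩, -⟩ := hT W i hi
  refine ⟨j, hj, ?_⟩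
  rw [h, Finset.union_sdiff_self_eq_union]
  exact Finset.subset_union_right

lemma exists_small_selector (I : Finset ι) (hs : ∀ i ∈ I, (A i).card ≤ s) :
    ∃ c : Finset β → Finset β, (∀ Z, (c Z).card ≤ s) ∧
      ∀ Z, (∃ j ∈ I, A j ⊆ Z) → ∃ j ∈ I, A j = c Z ∧ A j ⊆ Z := by
  have : ∀ Z : Finset β, ∃ c : Finset β, c.card ≤ s ∧
      ((∃ j ∈ I, A j ⊆ Z) → ∃ j ∈ I, A j = c ∧ A j ⊆ Z) := by
    intro Z
    by_cases h : ∃ j ∈ I, A j ⊆ Z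
    · obtain ⟨j, hj, hjZ⟩ := h
      exact ⟨A j, hs j hj, fun _ => ⟨j, hj, rfl, hjZ⟩⟩
    · exact ⟨∅, by simp, fun h' => absurd h' h⟩
  choose c hc using this
  exact ⟨c, fun Z => (hc Z).1, fun Z => (hc Z).2⟩

lemma IsMinFragment.binomExp_card_eq_le (hT : IsMinFragment I A T) (hw : ∀ i ∈ I, 0 ≤ w i)
    (hE : ∀ i ∈ I, A i ⊆ E) (hs : ∀ i ∈ I, (A i).card ≤ s) (hq : 0 ≤ q)
    (hspread : IsSpread I w A q) (hp : 0 < p) (hp1 : p ≤ 1) (t : ℕ) :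
    binomExp E p (fun W => ∑ i ∈ I with (T W i).card = t, w i) ≤
      (s.choose t : ℝ) * (q / p) ^ t := by
  obtain ⟨c, hc, hcs⟩ := exists_small_selector (A := A) I hs
  have hp' : 0 ≤ 1 - p := by linarith
  set wt : Finset β → ℝ := fun W => p ^ W.card * (1 - p) ^ (E.card - W.card) with hwt
  have hwt0 : ∀ W, 0 ≤ wt W := fun W => by positivity
  have hwt_le : ∀ W ⊆ E, ∀ i ∈ I, (T W i).card = t → p ^ t * wt W ≤ wt (W ∪ T W i) := by
    intro W _ i hi ht
    have hcard : (W ∪ T W i).card = W.card + t := by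
      rw [Finset.card_union_of_disjoint (hT.disjoint W hi), ht]
    simp only [hwt, hcard]
    have : (1 - p) ^ (E.card - W.card) ≤ (1 - p) ^ (E.card - (W.card + t)) :=
      pow_le_pow_of_le_one hp' (by linarith) (by omega)
    calc p ^ t * (p ^ W.card * (1 - p) ^ (E.card - W.card))
        = p ^ (W.card + t) * (1 - p) ^ (E.card - W.card) := by rw [pow_add]; ring
      _ ≤ _ := mul_le_mul_of_nonneg_left this (by positivity)
  have hstep : ∀ i ∈ I, ∑ W ∈ E.powerset with (T W i).card = t, wt (W ∪ T W i) ≤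
      ∑ Z ∈ E.powerset, ∑ R ∈ (c Z).powersetCard t with R ⊆ A i, wt Z := by
    intro i hi
    rw [Finset.sum_sigma']
    have hinj : Set.InjOn (fun W => (⟨W ∪ T W i, T W i⟩ : (_ : Finset β) × Finset β))
        ((E.powerset.filter fun W => (T W i).card = t : Finset (Finset β)) : Set (Finset β)) := by
      intro W _ W' _ h
      simp only [Sigma.mk.injEq, heq_eq_eq] at h
      have h1 : (W ∪ T W i) \ T W i = W :=
        Finset.union_sdiff_cancel_right (hT.disjoint W hi)
      have h2 : (W' ∪ T W' i) \ T W' i = W' :=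
        Finset.union_sdiff_cancel_right (hT.disjoint W' hi)
      rw [← h1, h.1, h.2, h2]
    rw [← Finset.sum_image (f := fun x : (_ : Finset β) × Finset β => wt x.1) hinj]
    refine Finset.sum_le_sum_of_subset_of_nonneg ?_ fun x _ _ => hwt0 _
    intro x hx
    obtain ⟨W, hW, rfl⟩ := Finset.mem_image.1 hx
    rw [Finset.mem_filter, Finset.mem_powerset] at hW
    obtain ⟨j, hj, hjc, hjZ⟩ := hcs (W ∪ T W i) (hT.exists_subset_union W hi)
    simp only [Finset.mem_sigma, Finset.mem_powerset, Finset.mem_filter,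
      Finset.mem_powersetCard]
    refine ⟨Finset.union_subset hW.1 ((hT.subset W hi).trans (hE i hi)), ⟨?_, hW.2⟩,
      hT.subset W hi⟩
    rw [← hjc]
    exact hT.subset_of_subset_union W hi hj hjZ
  have hmain : p ^ t * binomExp E p (fun W => ∑ i ∈ I with (T W i).card = t, w i) ≤
      (s.choose t : ℝ) * q ^ t := by
    calc p ^ t * binomExp E p (fun W => ∑ i ∈ I with (T W i).card = t, w i)
        = ∑ i ∈ I, w i * ∑ W ∈ E.powerset with (T W i).card = t, p ^ t * wt W := by
          simp only [binomExp, Finset.sum_filter, Finset.mul_sum]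
          rw [Finset.sum_comm]
          refine Finset.sum_congr rfl fun i _ => Finset.sum_congr rfl fun W _ => ?_
          split_ifs <;> simp [hwt]; ring
      _ ≤ ∑ i ∈ I, w i * ∑ Z ∈ E.powerset, ∑ R ∈ (c Z).powersetCard t with R ⊆ A i, wt Z := by
          refine Finset.sum_le_sum fun i hi => mul_le_mul_of_nonneg_left ?_ (hw i hi)
          refine le_trans (Finset.sum_le_sum fun W hW => ?_) (hstep i hi)
          rw [Finset.mem_filter, Finset.mem_powerset] at hW
          exact hwt_le W hW.1 i hi hW.2
      _ = ∑ Z ∈ E.powerset, wt Z * ∑ R ∈ (c Z).powersetCard t, ∑ i ∈ I with R ⊆ A i, w i := by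
          simp only [Finset.sum_filter, Finset.mul_sum]
          rw [Finset.sum_comm]
          refine Finset.sum_congr rfl fun Z _ => ?_
          rw [Finset.sum_comm]
          refine Finset.sum_congr rfl fun R _ => Finset.sum_congr rfl fun i _ => ?_
          split_ifs <;> ring
      _ ≤ ∑ Z ∈ E.powerset, wt Z * ((s.choose t : ℝ) * q ^ t) := by
          refine Finset.sum_le_sum fun Z _ => mul_le_mul_of_nonneg_left ?_ (hwt0 Z)
          calc ∑ R ∈ (c Z).powersetCard t, ∑ i ∈ I with R ⊆ A i, w i
              ≤ ∑ R ∈ (c Z).powersetCard t, q ^ t := by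
                refine Finset.sum_le_sum fun R hR => ?_
                have := hspread R
                rwa [(Finset.mem_powersetCard.1 hR).2] at this
            _ = ((c Z).card.choose t : ℝ) * q ^ t := by
                rw [Finset.sum_const, Finset.card_powersetCard, nsmul_eq_mul]
            _ ≤ _ := by
                have := Nat.choose_le_choose t (hc Z)
                gcongr
      _ = (s.choose t : ℝ) * q ^ t := binomExp_const E p _
  rw [div_pow, ← mul_div_assoc, le_div_iff₀ (by positivity), mul_comm]
  exact hmain

lemma IsMinFragment.binomExp_lt_card_le (hT : IsMinFragment I A T) (hw : ∀ i ∈ I, 0 ≤ w i)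
    (hE : ∀ i ∈ I, A i ⊆ E) (hs : ∀ i ∈ I, (A i).card ≤ s) (hq : 0 ≤ q)
    (hspread : IsSpread I w A q) (hp : 0 < p) (hp1 : p ≤ 1) (u : ℕ) :
    binomExp E p (fun W => ∑ i ∈ I with u < (T W i).card, w i) ≤
      ∑ t ∈ Finset.Ioc u s, (s.choose t : ℝ) * (q / p) ^ t := by
  refine le_trans ?_ (Finset.sum_le_sum fun t _ =>
    hT.binomExp_card_eq_le hw hE hs hq hspread hp hp1 t)
  have hsum : ∑ t ∈ Finset.Ioc u s,
      binomExp E p (fun W => ∑ i ∈ I with (T W i).card = t, w i) =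
      binomExp E p (fun W => ∑ t ∈ Finset.Ioc u s, ∑ i ∈ I with (T W i).card = t, w i) := by
    simp only [binomExp, Finset.mul_sum]
    rw [Finset.sum_comm]
  rw [hsum]
  refine binomExp_le hp.le hp1 fun W _ => ?_
  rw [← Finset.sum_fiberwise_of_maps_to (s := I.filter fun i => u < (T W i).card)
    (t := Finset.Ioc u s) (g := fun i => (T W i).card) (f := w)]
  · refine Finset.sum_le_sum fun t _ => Finset.sum_le_sum_of_subset_of_nonneg ?_ ?_
    · intro i hi
      simp only [Finset.mem_filter] at hi ⊢
      exact ⟨hi.1.1, hi.2⟩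
    · intro i hi _
      exact hw i (Finset.mem_filter.1 hi).1
  · intro i hi
    simp only [Finset.mem_filter, Finset.mem_Ioc] at hi ⊢
    exact ⟨hi.2, (Finset.card_le_card (hT.subset W hi.1)).trans (hs i hi.1)⟩

end Fragments

/-- The retention probability of a union of `m + 1` independent binomial random subsets, one with
probability `a` and `m` with probability `b`. -/
noncomputable def unionProb (a b : ℝ) : ℕ → ℝ
  | 0 => a
  | m + 1 => b + unionProb a b m - b * unionProb a b m

lemma unionProb_nonneg_le_one {a b : ℝ} (ha : 0 ≤ a) (ha1 : a ≤ 1) (hb : 0 ≤ b) (hb1 : b ≤ 1)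
    (m : ℕ) : 0 ≤ unionProb a b m ∧ unionProb a b m ≤ 1 := by
  induction m with
  | zero => exact ⟨ha, ha1⟩
  | succ m ih =>
    obtain ⟨h0, h1⟩ := ih
    simp only [unionProb]
    constructor <;> nlinarith

lemma unionProb_le {a b : ℝ} (ha : 0 ≤ a) (ha1 : a ≤ 1) (hb : 0 ≤ b) (hb1 : b ≤ 1)
    (m : ℕ) : unionProb a b m ≤ a + m * b := by
  induction m with
  | zero => simp [unionProb]
  | succ m ih =>
    have := (unionProb_nonneg_le_one ha ha1 hb hb1 m).1
    simp only [unionProb]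
    push_cast
    nlinarith

section SpreadThreshold

variable {β ι : Type*} [DecidableEq β]

lemma IsSpread.sum_le_one {I : Finset ι} {w : ι → ℝ} {A : ι → Finset β} {q : ℝ}
    (h : IsSpread I w A q) : ∑ i ∈ I, w i ≤ 1 := by
  simpa using h ∅

lemma sum_Ioc_choose_mul_pow_le (u : ℕ) :
    ∑ t ∈ Finset.Ioc u (u * 2), ((u * 2).choose t : ℝ) * (1 / 16 : ℝ) ^ t ≤ (1 / 4 : ℝ) ^ u := by
  calc ∑ t ∈ Finset.Ioc u (u * 2), ((u * 2).choose t : ℝ) * (1 / 16 : ℝ) ^ t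
      ≤ ∑ t ∈ Finset.Ioc u (u * 2), ((u * 2).choose t : ℝ) * (1 / 16 : ℝ) ^ u := by
        refine Finset.sum_le_sum fun t ht => mul_le_mul_of_nonneg_left ?_ (by positivity)
        exact pow_le_pow_of_le_one (by norm_num) (by norm_num) (Finset.mem_Ioc.1 ht).1.le
    _ ≤ ∑ t ∈ Finset.range (u * 2 + 1), ((u * 2).choose t : ℝ) * (1 / 16 : ℝ) ^ u := by
        refine Finset.sum_le_sum_of_subset_of_nonneg (fun t ht => ?_) fun _ _ _ => by positivity
        rw [Finset.mem_Ioc] at ht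
        rw [Finset.mem_range]
        omega
    _ = (1 / 4 : ℝ) ^ u := by
        rw [← Finset.sum_mul]
        have := Nat.sum_range_choose (u * 2)
        have h2 : (∑ t ∈ Finset.range (u * 2 + 1), ((u * 2).choose t : ℝ)) = 2 ^ (u * 2) := by
          exact_mod_cast this
        rw [h2, mul_comm u 2, pow_mul, ← mul_pow]
        norm_num

lemma sum_Ioc_zero_choose_mul_pow (s : ℕ) (x : ℝ) :
    ∑ t ∈ Finset.Ioc 0 s, (s.choose t : ℝ) * x ^ t = (1 + x) ^ s - 1 := by
  have h := add_pow x 1 s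
  rw [Finset.range_eq_Ico, Finset.sum_eq_sum_Ico_succ_bot (Nat.succ_pos s)] at h
  rw [add_comm 1 x, h]
  have : Finset.Ioc 0 s = Finset.Ico (0 + 1) (s + 1) := by ext; simp; omega
  simp only [this, one_pow, mul_one, pow_zero, Nat.choose_zero_right, Nat.cast_one,
    add_sub_cancel_left]
  exact Finset.sum_congr rfl fun t _ => mul_comm _ _

open Classical in
/-- Iterated minimum fragments: a spread family is covered by a random set with probability at
least its total weight minus the losses of all the rounds. -/
lemma IsSpread.le_binomExp {E : Finset β} {q a : ℝ} (hq : 0 < q) (hq1 : 16 * q ≤ 1)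
    (ha : 0 < a) (ha1 : a ≤ 1) (s₀ m : ℕ) :
    ∀ (I : Finset ι) (w : ι → ℝ) (A : ι → Finset β), (∀ i ∈ I, 0 ≤ w i) → (∀ i ∈ I, A i ⊆ E) →
      (∀ i ∈ I, (A i).card ≤ s₀ * 2 ^ m) → IsSpread I w A q →
      ∑ i ∈ I, w i - ((1 + q / a) ^ s₀ - 1) - ∑ j ∈ Finset.range m, (1 / 4 : ℝ) ^ (s₀ * 2 ^ j) ≤
        binomExp E (unionProb a (16 * q) m) (fun W => if ∃ i ∈ I, A i ⊆ W then 1 else 0) := by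
  induction m with
  | zero =>
    intro I w A hw hE hs hspread
    obtain ⟨T, hT⟩ := exists_isMinFragment I A
    simp only [pow_zero, mul_one] at hs
    have hloss := hT.binomExp_lt_card_le hw hE hs hq.le hspread ha ha1 0
    rw [sum_Ioc_zero_choose_mul_pow] at hloss
    simp only [Finset.range_zero, Finset.sum_empty, sub_zero, unionProb]
    refine le_trans (sub_le_sub_left hloss _) ?_
    rw [← binomExp_const E a (∑ i ∈ I, w i), ← binomExp_sub]
    refine binomExp_le ha.le ha1 fun W _ => ?_
    have hnn : 0 ≤ ∑ i ∈ I with 0 < (T W i).card, w i :=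
      Finset.sum_nonneg fun i hi => hw i (Finset.mem_filter.1 hi).1
    by_cases h : ∃ i ∈ I, (T W i).card = 0
    · obtain ⟨i, hi, h0⟩ := h
      obtain ⟨⟨j, hj, hTj, -⟩, -⟩ := hT W i hi
      have hcov : ∃ i ∈ I, A i ⊆ W :=
        ⟨j, hj, Finset.sdiff_eq_empty_iff_subset.1 (hTj ▸ Finset.card_eq_zero.1 h0)⟩
      rw [if_pos hcov]
      linarith [hspread.sum_le_one]
    · push Not at h
      rw [Finset.filter_true_of_mem fun i hi => Nat.pos_of_ne_zero (h i hi), sub_self]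
      split_ifs <;> norm_num
  | succ m ih =>
    intro I w A hw hE hs hspread
    obtain ⟨T, hT⟩ := exists_isMinFragment I A
    have hs' : ∀ i ∈ I, (A i).card ≤ s₀ * 2 ^ m * 2 := fun i hi => by
      have := hs i hi
      rwa [pow_succ, ← mul_assoc] at this
    have hloss := hT.binomExp_lt_card_le hw hE hs' hq.le hspread (p := 16 * q)
      (by positivity) hq1 (s₀ * 2 ^ m)
    have hdiv : q / (16 * q) = 1 / 16 := by field_simp
    rw [hdiv] at hloss
    replace hloss := hloss.trans (sum_Ioc_choose_mul_pow_le (s₀ * 2 ^ m))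
    set R := (1 + q / a) ^ s₀ - 1 + ∑ j ∈ Finset.range m, (1 / 4 : ℝ) ^ (s₀ * 2 ^ j) with hR
    have hround : ∀ W ⊆ E, (∑ i ∈ I, w i - R) - ∑ i ∈ I with s₀ * 2 ^ m < (T W i).card, w i ≤
        binomExp E (unionProb a (16 * q) m)
          (fun W₂ => if ∃ i ∈ I, A i ⊆ W ∪ W₂ then 1 else 0) := by
      intro W _
      have h := ih (I.filter fun i => ¬ s₀ * 2 ^ m < (T W i).card) w (T W)
        (fun i hi => hw i (Finset.mem_filter.1 hi).1)
        (fun i hi => (hT.subset W (Finset.mem_filter.1 hi).1).trans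
          (hE i (Finset.mem_filter.1 hi).1))
        (fun i hi => not_lt.1 (Finset.mem_filter.1 hi).2)
        (fun S => le_trans (Finset.sum_le_sum_of_subset_of_nonneg
          (fun i hi => by
            simp only [Finset.mem_filter] at hi ⊢
            exact ⟨hi.1.1, hi.2.trans (hT.subset W hi.1.1)⟩)
          (fun i hi _ => hw i (Finset.mem_filter.1 hi).1)) (hspread S))
      have hsplit := Finset.sum_filter_add_sum_filter_not I
        (fun i => s₀ * 2 ^ m < (T W i).card) w
      have hP := unionProb_nonneg_le_one ha.le ha1 (by positivity : 0 ≤ 16 * q) hq1 m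
      refine le_trans ?_ (h.trans (binomExp_le hP.1 hP.2 fun W₂ _ => ?_))
      · rw [hR]; linarith
      · by_cases hc : ∃ i ∈ I.filter (fun i => ¬ s₀ * 2 ^ m < (T W i).card), T W i ⊆ W₂
        · obtain ⟨i, hi, hiW⟩ := hc
          obtain ⟨j, hj, hjW⟩ := hT.exists_subset_union W (Finset.mem_filter.1 hi).1
          have hc' : ∃ i ∈ I, A i ⊆ W ∪ W₂ :=
            ⟨j, hj, hjW.trans (Finset.union_subset_union_right hiW)⟩
          rw [if_pos hc']
          split_ifs <;> norm_num
        · rw [if_neg hc]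
          split_ifs <;> norm_num
    have hfin := binomExp_le (by positivity : 0 ≤ 16 * q) hq1 hround
    rw [binomExp_sub, binomExp_const,
      binomExp_binomExp E _ _ (fun W => if ∃ i ∈ I, A i ⊆ W then (1 : ℝ) else 0)] at hfin
    rw [Finset.sum_range_succ]
    simp only [unionProb]
    linarith

lemma sum_range_pow_mul_two_pow_le {s₀ : ℕ} (h : 1 ≤ s₀) (m : ℕ) :
    ∑ j ∈ Finset.range m, (1 / 4 : ℝ) ^ (s₀ * 2 ^ j) ≤ 2 * (1 / 4 : ℝ) ^ s₀ := by
  calc ∑ j ∈ Finset.range m, (1 / 4 : ℝ) ^ (s₀ * 2 ^ j)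
      ≤ ∑ j ∈ Finset.range m, (1 / 4 : ℝ) ^ s₀ * (1 / 2 : ℝ) ^ j := by
        refine Finset.sum_le_sum fun j _ => ?_
        have h1 : s₀ + j ≤ s₀ * 2 ^ j := by
          have := Nat.lt_two_pow_self (n := j)
          nlinarith
        calc (1 / 4 : ℝ) ^ (s₀ * 2 ^ j) ≤ (1 / 4 : ℝ) ^ (s₀ + j) :=
              pow_le_pow_of_le_one (by norm_num) (by norm_num) h1
          _ = (1 / 4 : ℝ) ^ s₀ * (1 / 4 : ℝ) ^ j := pow_add _ _ _
          _ ≤ _ := by gcongr; norm_num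
    _ = (1 / 4 : ℝ) ^ s₀ * ∑ j ∈ Finset.range m, (1 / 2 : ℝ) ^ j := by rw [Finset.mul_sum]
    _ ≤ (1 / 4 : ℝ) ^ s₀ * 2 := by
        have := sum_geometric_two_le m
        gcongr
    _ = _ := mul_comm _ _

open Classical in
/-- The spread lemma with explicit error terms. -/
theorem IsSpread.le_edgeProb {E : Finset β} {q a p : ℝ} (hq : 0 < q) (hq1 : 16 * q ≤ 1)
    (ha : 0 < a) (ha1 : a ≤ 1) {s₀ m : ℕ} (hs₀ : 1 ≤ s₀) {I : Finset ι} {w : ι → ℝ}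
    {A : ι → Finset β} (hw : ∀ i ∈ I, 0 ≤ w i) (hw1 : ∑ i ∈ I, w i = 1)
    (hE : ∀ i ∈ I, A i ⊆ E) (hs : ∀ i ∈ I, (A i).card ≤ s₀ * 2 ^ m) (hspread : IsSpread I w A q)
    (hp : a + m * (16 * q) ≤ p) (hp1 : p ≤ 1) :
    1 - ((1 + q / a) ^ s₀ - 1) - 2 * (1 / 4 : ℝ) ^ s₀ ≤
      edgeProb E p (fun W => ∃ i ∈ I, A i ⊆ W) := by
  have h := IsSpread.le_binomExp hq hq1 ha ha1 s₀ m I w A hw hE hs hspread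
  rw [hw1] at h
  have hP := unionProb_nonneg_le_one ha.le ha1 (by positivity : 0 ≤ 16 * q) hq1 m
  have hmono := binomExp_mono_prob (E := E) hP.1
    ((unionProb_le ha.le ha1 (by positivity : 0 ≤ 16 * q) hq1 m).trans hp) hp1
    (F := fun W => if ∃ i ∈ I, A i ⊆ W then (1 : ℝ) else 0) (by
      intro W W' hW
      by_cases hc : ∃ i ∈ I, A i ⊆ W
      · obtain ⟨i, hi, hiW⟩ := hc
        have hc' : ∃ i ∈ I, A i ⊆ W' := ⟨i, hi, hiW.trans hW⟩
        simp only [if_pos hc']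
        split_ifs <;> norm_num
      · simp only [if_neg hc]
        split_ifs <;> norm_num)
  rw [edgeProb_eq_binomExp]
  refine le_trans ?_ (h.trans (hmono.trans (le_of_eq ?_)))
  · linarith [sum_range_pow_mul_two_pow_le hs₀ m]
  · congr!

end SpreadThreshold

lemma edgeProb_mono {β : Type*} [DecidableEq β] {E : Finset β} {p : ℝ} (h0 : 0 ≤ p) (h1 : p ≤ 1)
    {P R : Finset β → Prop} (h : ∀ W, P W → R W) : edgeProb E p P ≤ edgeProb E p R := by
  classical
  rw [edgeProb_eq_binomExp, edgeProb_eq_binomExp]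
  refine binomExp_le h0 h1 fun W _ => ?_
  by_cases hP : P W
  · rw [if_pos hP, if_pos (h W hP)]
  · rw [if_neg hP]
    split_ifs <;> norm_num

section LocalLemma

variable {V J : Type*} [Fintype V] [DecidableEq V] [Fintype J] [DecidableEq J]

/-- The assignments of `V` to blocks such that block `j` receives exactly `s j` vertices, which
agree with `b` on `Y`, and such that for no `(j, B)` in `𝓑` all of `B` is assigned to `j`. -/
def avoidingColorings (s : J → ℕ) (b : V → J) (Y : Finset V) (𝓑 : Finset (J × Finset V)) :
    Finset (V → J) :=
  Finset.univ.filter fun f => (∀ j, (Finset.univ.filter fun v => f v = j).card = s j) ∧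
    (∀ y ∈ Y, f y = b y) ∧ ∀ p ∈ 𝓑, ∃ x ∈ p.2, f x ≠ p.1

lemma mem_avoidingColorings {s : J → ℕ} {b : V → J} {Y : Finset V} {𝓑 : Finset (J × Finset V)}
    {f : V → J} : f ∈ avoidingColorings s b Y 𝓑 ↔
      (∀ j, (Finset.univ.filter fun v => f v = j).card = s j) ∧
        (∀ y ∈ Y, f y = b y) ∧ ∀ p ∈ 𝓑, ∃ x ∈ p.2, f x ≠ p.1 := by
  simp [avoidingColorings]

/-- Exchanging the vertex `y` with another vertex: negative correlation of the event that `y` is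
in block `b y` with the avoidance of a family of events not involving `y` or `b y`. -/
lemma card_avoidingColorings_insert_mul_le (s : J → ℕ) (b : V → J) {Y : Finset V} {y : V}
    (hy : y ∉ Y) {𝓑 : Finset (J × Finset V)} (h𝓑 : ∀ p ∈ 𝓑, y ∉ p.2 ∧ p.1 ≠ b y) :
    (avoidingColorings s b (insert y Y) 𝓑).card * (Fintype.card V - Y.card) ≤
      (s (b y) - (Y.filter fun v => b v = b y).card) * (avoidingColorings s b Y 𝓑).card := by
  have hYc : Fintype.card V - Y.card = (Yᶜ).card := (Finset.card_compl Y).symm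
  rw [hYc, ← Finset.card_product]
  refine Finset.card_le_mul_card_image_of_maps_to
    (f := fun p : (V → J) × V => p.1 ∘ Equiv.swap y p.2) ?_ _ ?_
  · rintro ⟨f, z⟩ hfz
    rw [Finset.mem_product, mem_avoidingColorings, Finset.mem_compl] at hfz
    obtain ⟨⟨hs, hYf, havoid⟩, hz⟩ := hfz
    simp only at hz
    have hfy : f y = b y := hYf y (Finset.mem_insert_self _ _)
    rw [mem_avoidingColorings]
    refine ⟨fun j => ?_, fun v hv => ?_, fun p hp => ?_⟩
    · rw [← hs j]
      refine Finset.card_bij (fun v _ => Equiv.swap y z v) ?_ ?_ ?_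
      · intro v hv
        simpa using hv
      · intro v _ v' _ h
        exact (Equiv.swap y z).injective h
      · intro v hv
        exact ⟨Equiv.swap y z v, by simpa using hv, by simp⟩
    · have h1 : v ≠ y := fun h => hy (h ▸ hv)
      have h2 : v ≠ z := fun h => hz (h ▸ hv)
      simp only [Function.comp_apply, Equiv.swap_apply_of_ne_of_ne h1 h2]
      exact hYf v (Finset.mem_insert_of_mem hv)
    · obtain ⟨x, hx, hfx⟩ := havoid p hp
      obtain ⟨hyp, hj⟩ := h𝓑 p hp
      refine ⟨x, hx, ?_⟩
      have h1 : x ≠ y := fun h => hyp (h ▸ hx)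
      by_cases h2 : x = z
      · simp only [Function.comp_apply, h2, Equiv.swap_apply_right, hfy]
        exact hj.symm
      · simpa [Function.comp_apply, Equiv.swap_apply_of_ne_of_ne h1 h2] using hfx
  · intro g hg
    rw [mem_avoidingColorings] at hg
    obtain ⟨hs, hYg, -⟩ := hg
    have hcount : ((Finset.univ.filter fun v => g v = b y) \
        (Y.filter fun v => b v = b y)).card = s (b y) - (Y.filter fun v => b v = b y).card := by
      rw [Finset.card_sdiff_of_subset, hs]
      intro v hv
      rw [Finset.mem_filter] at hv
      simp [hYg v hv.1, hv.2]
    rw [← hcount]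
    refine Finset.card_le_card_of_injOn Prod.snd ?_ ?_
    · rintro ⟨f, z⟩ hfz
      simp only [Finset.coe_filter, Set.mem_ofPred_eq, Finset.mem_product, mem_avoidingColorings,
        Finset.mem_compl] at hfz
      obtain ⟨⟨⟨-, hYf, -⟩, hz⟩, hgf⟩ := hfz
      simp only [Finset.coe_sdiff, Finset.coe_filter, Set.mem_sdiff, Set.mem_ofPred_eq,
        Finset.mem_univ, true_and]
      refine ⟨?_, fun h => hz h.1⟩
      rw [← hgf]
      simpa using hYf y (Finset.mem_insert_self _ _)
    · rintro ⟨f, z⟩ hfz ⟨f', z'⟩ hfz' h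
      simp only [Finset.coe_filter, Set.mem_ofPred_eq] at hfz hfz' h
      subst h
      have h3 : f ∘ Equiv.swap y z = f' ∘ Equiv.swap y z := hfz.2.trans hfz'.2.symm
      have h4 : f = f' := by
        funext v
        have := congrFun h3 (Equiv.swap y z v)
        simpa using this
      rw [h4]

lemma card_avoidingColorings_mul_descFactorial_le {s : J → ℕ} {Q : ℕ} (hQ : ∀ j, s j ≤ Q)
    (b : V → J) (Y : Finset V) {𝓑 : Finset (J × Finset V)}
    (h𝓑 : ∀ y ∈ Y, ∀ p ∈ 𝓑, y ∉ p.2 ∧ p.1 ≠ b y) :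
    (avoidingColorings s b Y 𝓑).card * (Fintype.card V).descFactorial Y.card ≤
      Q ^ Y.card * (avoidingColorings s b ∅ 𝓑).card := by
  induction Y using Finset.induction_on with
  | empty => simp
  | insert y Y hy ih =>
    have h1 := card_avoidingColorings_insert_mul_le s b hy (h𝓑 y (Finset.mem_insert_self _ _))
    have h2 := ih fun y' hy' => h𝓑 y' (Finset.mem_insert_of_mem hy')
    have h3 : s (b y) - (Y.filter fun v => b v = b y).card ≤ Q := (Nat.sub_le _ _).trans (hQ _)
    rw [Finset.card_insert_of_notMem hy, Nat.descFactorial_succ, ← mul_assoc, pow_succ]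
    calc _ ≤ (Q * (avoidingColorings s b Y 𝓑).card) * (Fintype.card V).descFactorial Y.card :=
          Nat.mul_le_mul_right _ (h1.trans (Nat.mul_le_mul_right _ h3))
      _ = Q * ((avoidingColorings s b Y 𝓑).card * (Fintype.card V).descFactorial Y.card) := by
          ring
      _ ≤ Q * (Q ^ Y.card * (avoidingColorings s b ∅ 𝓑).card) := Nat.mul_le_mul_left _ h2
      _ = _ := by ring

lemma card_avoidingColorings_const_mul_descFactorial_le (s : J → ℕ) (j : J) (Y : Finset V)
    {𝓑 : Finset (J × Finset V)} (h𝓑 : ∀ y ∈ Y, ∀ p ∈ 𝓑, y ∉ p.2 ∧ p.1 ≠ j) :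
    (avoidingColorings s (fun _ => j) Y 𝓑).card * (Fintype.card V).descFactorial Y.card ≤
      (s j).descFactorial Y.card * (avoidingColorings s (fun _ => j) ∅ 𝓑).card := by
  induction Y using Finset.induction_on with
  | empty => simp
  | insert y Y hy ih =>
    have h1 := card_avoidingColorings_insert_mul_le s (fun _ => j) hy
      (h𝓑 y (Finset.mem_insert_self _ _))
    have h2 := ih fun y' hy' => h𝓑 y' (Finset.mem_insert_of_mem hy')
    simp only [Finset.filter_true] at h1
    rw [Finset.card_insert_of_notMem hy, Nat.descFactorial_succ, Nat.descFactorial_succ,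
      ← mul_assoc]
    calc _ ≤ ((s j - Y.card) * (avoidingColorings s (fun _ => j) Y 𝓑).card) *
            (Fintype.card V).descFactorial Y.card := Nat.mul_le_mul_right _ h1
      _ = (s j - Y.card) * ((avoidingColorings s (fun _ => j) Y 𝓑).card *
            (Fintype.card V).descFactorial Y.card) := by ring
      _ ≤ (s j - Y.card) * ((s j).descFactorial Y.card *
            (avoidingColorings s (fun _ => j) ∅ 𝓑).card) := Nat.mul_le_mul_left _ h2
      _ = _ := by ring

lemma avoidingColorings_empty_eq (s : J → ℕ) (b b' : V → J) (𝓑 : Finset (J × Finset V)) :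
    avoidingColorings s b ∅ 𝓑 = avoidingColorings s b' ∅ 𝓑 := by
  simp [avoidingColorings]

lemma avoidingColorings_subset (s : J → ℕ) (b : V → J) {Y Y' : Finset V} (hY : Y' ⊆ Y)
    {𝓑 𝓑' : Finset (J × Finset V)} (h : 𝓑' ⊆ 𝓑) :
    avoidingColorings s b Y 𝓑 ⊆ avoidingColorings s b Y' 𝓑' := by
  intro f hf
  rw [mem_avoidingColorings] at hf ⊢
  exact ⟨hf.1, fun y hy => hf.2.1 y (hY hy), fun p hp => hf.2.2 p (h hp)⟩

/-- Splitting off a subfamily `𝓑₁` of events with the union bound. -/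
lemma card_avoidingColorings_le_add_sum (s : J → ℕ) (b : V → J) {𝓑 𝓑₁ 𝓑₂ : Finset (J × Finset V)}
    (h : 𝓑 ⊆ 𝓑₁ ∪ 𝓑₂) :
    (avoidingColorings s b ∅ 𝓑₂).card ≤ (avoidingColorings s b ∅ 𝓑).card +
      ∑ p ∈ 𝓑₁, (avoidingColorings s (fun _ => p.1) p.2 𝓑₂).card := by
  have hsub : avoidingColorings s b ∅ 𝓑₂ ⊆ avoidingColorings s b ∅ 𝓑 ∪
      𝓑₁.biUnion fun p => avoidingColorings s (fun _ => p.1) p.2 𝓑₂ := by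
    intro f hf
    rw [mem_avoidingColorings] at hf
    rw [Finset.mem_union, Finset.mem_biUnion]
    by_cases hc : ∃ p ∈ 𝓑₁, ∀ x ∈ p.2, f x = p.1
    · obtain ⟨p, hp, hx⟩ := hc
      exact Or.inr ⟨p, hp, mem_avoidingColorings.2 ⟨hf.1, hx, hf.2.2⟩⟩
    · push Not at hc
      refine Or.inl (mem_avoidingColorings.2 ⟨hf.1, by simp, fun p hp => ?_⟩)
      rcases Finset.mem_union.1 (h hp) with h1 | h2
      · exact hc p h1
      · exact hf.2.2 p h2
  exact (Finset.card_le_card hsub).trans ((Finset.card_union_le _ _).trans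
    (Nat.add_le_add_left Finset.card_biUnion_le _))

/-- The lopsided local lemma for random partitions into blocks of given sizes. -/
lemma card_avoidingColorings_block_le {s : J → ℕ} {𝓐 : Finset (J × Finset V)}
    (hcard : ∀ p ∈ 𝓐, p.2.card = s p.1)
    (hsum : ∀ p ∈ 𝓐, ∑ p' ∈ 𝓐 with p'.1 = p.1 ∨ ¬ Disjoint p.2 p'.2,
      ((Fintype.card V).choose (s p'.1) : ℝ)⁻¹ ≤ 1 / 4) (b : V → J)
    (𝓑 : Finset (J × Finset V)) (h𝓑 : 𝓑 ⊆ 𝓐) {p : J × Finset V} (hp : p ∈ 𝓐) :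
    ((avoidingColorings s (fun _ => p.1) p.2 𝓑).card : ℝ) ≤
      2 * ((Fintype.card V).choose (s p.1) : ℝ)⁻¹ * (avoidingColorings s b ∅ 𝓑).card := by
  induction 𝓑 using Finset.strongInduction generalizing p with
  | H 𝓑 ih =>
    set c : J → ℝ := fun j => ((Fintype.card V).choose (s j) : ℝ)⁻¹ with hc
    have hc0 : ∀ j, 0 ≤ c j := fun j => by positivity
    set 𝓑₁ := 𝓑.filter fun p' => p'.1 = p.1 ∨ ¬ Disjoint p.2 p'.2 with h𝓑₁
    set 𝓑₂ := 𝓑.filter fun p' => ¬ (p'.1 = p.1 ∨ ¬ Disjoint p.2 p'.2) with h𝓑₂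
    have hunion : 𝓑 ⊆ 𝓑₁ ∪ 𝓑₂ := by
      rw [h𝓑₁, h𝓑₂, Finset.filter_union_filter_not_eq]
    have h2sub : 𝓑₂ ⊆ 𝓑 := Finset.filter_subset _ _
    have h1 : ((avoidingColorings s (fun _ => p.1) p.2 𝓑₂).card : ℝ) ≤
        c p.1 * (avoidingColorings s b ∅ 𝓑₂).card := by
      have h := card_avoidingColorings_const_mul_descFactorial_le s p.1 p.2 (𝓑 := 𝓑₂) (by
        intro y hy p' hp'
        rw [h𝓑₂, Finset.mem_filter, not_or, not_not] at hp'
        exact ⟨Finset.disjoint_left.1 hp'.2.2 hy, hp'.2.1⟩)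
      rw [hcard p hp, Nat.descFactorial_self, Nat.descFactorial_eq_factorial_mul_choose,
        avoidingColorings_empty_eq s (fun _ => p.1) b] at h
      have h' : (avoidingColorings s (fun _ => p.1) p.2 𝓑₂).card *
          (Fintype.card V).choose (s p.1) ≤ (avoidingColorings s b ∅ 𝓑₂).card := by
        refine Nat.le_of_mul_le_mul_left ?_ (Nat.factorial_pos (s p.1))
        calc _ = _ := by ring
          _ ≤ _ := h
      have hpos : 0 < (Fintype.card V).choose (s p.1) := by
        apply Nat.choose_pos
        rw [← hcard p hp]
        exact Finset.card_le_univ _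
      simp only [hc]
      rw [inv_mul_eq_div, le_div_iff₀ (by exact_mod_cast hpos)]
      exact_mod_cast h'
    have h3 : ((avoidingColorings s b ∅ 𝓑₂).card : ℝ) ≤
        2 * (avoidingColorings s b ∅ 𝓑).card := by
      by_cases he : 𝓑₂ = 𝓑
      · rw [he]
        have : (0 : ℝ) ≤ (avoidingColorings s b ∅ 𝓑).card := by positivity
        linarith
      · have hss : 𝓑₂ ⊂ 𝓑 := h2sub.ssubset_of_ne he
        have hb : ((avoidingColorings s b ∅ 𝓑₂).card : ℝ) ≤
            (avoidingColorings s b ∅ 𝓑).card +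
            ∑ p' ∈ 𝓑₁, ((avoidingColorings s (fun _ => p'.1) p'.2 𝓑₂).card : ℝ) := by
          exact_mod_cast card_avoidingColorings_le_add_sum s b hunion
        have hs1 : ∑ p' ∈ 𝓑₁, ((avoidingColorings s (fun _ => p'.1) p'.2 𝓑₂).card : ℝ) ≤
            ∑ p' ∈ 𝓑₁, 2 * c p'.1 * (avoidingColorings s b ∅ 𝓑₂).card :=
          Finset.sum_le_sum fun p' hp' => ih 𝓑₂ hss (h2sub.trans h𝓑)
            (h𝓑 (Finset.mem_filter.1 hp').1)
        have hs2 : ∑ p' ∈ 𝓑₁, c p'.1 ≤ 1 / 4 :=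
          (Finset.sum_le_sum_of_subset_of_nonneg (Finset.filter_subset_filter _ h𝓑)
            fun _ _ _ => hc0 _).trans (hsum p hp)
        rw [← Finset.sum_mul, ← Finset.mul_sum] at hs1
        have : (0 : ℝ) ≤ (avoidingColorings s b ∅ 𝓑₂).card := by positivity
        nlinarith
    have h4 : ((avoidingColorings s (fun _ => p.1) p.2 𝓑).card : ℝ) ≤
        (avoidingColorings s (fun _ => p.1) p.2 𝓑₂).card := by
      exact_mod_cast Finset.card_le_card (avoidingColorings_subset s _ subset_rfl h2sub)
    have := mul_le_mul_of_nonneg_left h3 (hc0 p.1)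
    linarith

end LocalLemma

lemma pow_le_three_pow_mul_descFactorial (n t : ℕ) (h : t ≤ n) :
    (n : ℝ) ^ t ≤ 3 ^ t * (n.descFactorial t : ℝ) := by
  induction n generalizing t with
  | zero => simp [Nat.le_zero.1 h]
  | succ m ih =>
    rcases t with _ | t
    · simp
    have ht : t ≤ m := by omega
    rw [Nat.succ_descFactorial_succ]
    have h1 : ((m + 1 : ℕ) : ℝ) ^ t ≤ 3 * (m : ℝ) ^ t := by
      rcases Nat.eq_zero_or_pos m with rfl | hm
      · simp [Nat.le_zero.1 ht]
      have hm' : (0 : ℝ) < m := by exact_mod_cast hm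
      have h2 : ((m + 1 : ℕ) : ℝ) = (1 / m + 1) * m := by
        push_cast
        field_simp
        ring
      rw [h2, mul_pow]
      refine mul_le_mul_of_nonneg_right ?_ (by positivity)
      calc (1 / (m : ℝ) + 1) ^ t ≤ (Real.exp (1 / m)) ^ t := by
            gcongr
            exact Real.add_one_le_exp _
        _ = Real.exp (t * (1 / m)) := (Real.exp_nat_mul _ _).symm
        _ ≤ Real.exp 1 := by
            apply Real.exp_le_exp.2
            rw [mul_one_div, div_le_one hm']
            exact_mod_cast ht
        _ ≤ 3 := by linarith [Real.exp_one_lt_d9]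
    rw [pow_succ]
    push_cast at h1 ⊢
    have h3 := ih t ht
    calc ((m : ℝ) + 1) ^ t * (m + 1) ≤ (3 * (m : ℝ) ^ t) * (m + 1) := by gcongr
      _ ≤ (3 * (3 ^ t * (m.descFactorial t : ℝ))) * (m + 1) := by gcongr
      _ = _ := by ring

lemma sum_biUnion_le_sum_sum {α γ : Type*} [DecidableEq α] [DecidableEq γ] (S : Finset γ)
    (t : γ → Finset α) {c : α → ℝ} (hc : ∀ a, 0 ≤ c a) :
    ∑ a ∈ S.biUnion t, c a ≤ ∑ x ∈ S, ∑ a ∈ t x, c a := by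
  induction S using Finset.induction_on with
  | empty => simp
  | insert x S hx ih =>
    rw [Finset.biUnion_insert, Finset.sum_insert hx]
    have h := Finset.sum_union_inter (s₁ := t x) (s₂ := S.biUnion t) (f := c)
    have h' : 0 ≤ ∑ a ∈ t x ∩ S.biUnion t, c a := Finset.sum_nonneg fun a _ => hc a
    linarith

section SpreadColorings

variable {V J : Type*} [Fintype V] [DecidableEq V] [Fintype J] [DecidableEq J]

lemma avoidingColorings_empty_nonempty {s : J → ℕ} (hs : ∑ j, s j = Fintype.card V) (b : V → J) :
    (avoidingColorings s b ∅ ∅).Nonempty := by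
  have e : V ≃ Σ j, Fin (s j) := Fintype.equivOfCardEq (by simp [hs])
  refine ⟨fun v => (e v).1, mem_avoidingColorings.2 ⟨fun j => ?_, by simp, by simp⟩⟩
  rw [← Fintype.card_fin (s j), ← Finset.card_univ]
  symm
  refine Finset.card_bij (fun i _ => e.symm ⟨j, i⟩) (by simp) ?_ ?_
  · intro i _ i' _ h
    simpa using h
  · intro v hv
    rw [Finset.mem_filter] at hv
    obtain ⟨-, rfl⟩ := hv
    exact ⟨(e v).2, by simp, by simp⟩

variable {s : J → ℕ} {Q : ℕ} {𝓐 : Finset (J × Finset V)}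

omit [Fintype J] in
lemma sum_conflict_le (hQ : 1 ≤ Q)
    (h₁ : ∀ j, ∑ p ∈ 𝓐 with p.1 = j, ((Fintype.card V).choose (s p.1) : ℝ)⁻¹ ≤ 1 / 8)
    (h₂ : ∀ x, ∑ p ∈ 𝓐 with x ∈ p.2, ((Fintype.card V).choose (s p.1) : ℝ)⁻¹ ≤ 1 / (8 * Q))
    {j : J} {B : Finset V} (hB : B.card ≤ Q) :
    ∑ p ∈ 𝓐 with p.1 = j ∨ ¬ Disjoint B p.2,
      ((Fintype.card V).choose (s p.1) : ℝ)⁻¹ ≤ 1 / 4 := by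
  set c : J × Finset V → ℝ := fun p => ((Fintype.card V).choose (s p.1) : ℝ)⁻¹ with hc
  have hc0 : ∀ p, 0 ≤ c p := fun p => by positivity
  have hQ' : (0 : ℝ) < Q := by exact_mod_cast hQ
  have hsub : (𝓐.filter fun p => p.1 = j ∨ ¬ Disjoint B p.2) ⊆
      (𝓐.filter fun p => p.1 = j) ∪ B.biUnion fun x => 𝓐.filter fun p => x ∈ p.2 := by
    intro p hp
    rw [Finset.mem_filter] at hp
    rw [Finset.mem_union, Finset.mem_biUnion]
    rcases hp.2 with h | h
    · exact Or.inl (Finset.mem_filter.2 ⟨hp.1, h⟩)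
    · rw [Finset.not_disjoint_iff] at h
      obtain ⟨x, hx, hxp⟩ := h
      exact Or.inr ⟨x, hx, Finset.mem_filter.2 ⟨hp.1, hxp⟩⟩
  calc ∑ p ∈ 𝓐 with p.1 = j ∨ ¬ Disjoint B p.2, c p
      ≤ ∑ p ∈ (𝓐.filter fun p => p.1 = j) ∪ B.biUnion fun x => 𝓐.filter fun p => x ∈ p.2, c p :=
        Finset.sum_le_sum_of_subset_of_nonneg hsub fun p _ _ => hc0 p
    _ ≤ ∑ p ∈ 𝓐 with p.1 = j, c p +
          ∑ p ∈ B.biUnion fun x => 𝓐.filter fun p => x ∈ p.2, c p := by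
        rw [← Finset.sum_union_inter]
        have : 0 ≤ ∑ p ∈ (𝓐.filter fun p => p.1 = j) ∩
            B.biUnion fun x => 𝓐.filter fun p => x ∈ p.2, c p :=
          Finset.sum_nonneg fun p _ => hc0 p
        linarith
    _ ≤ 1 / 8 + ∑ x ∈ B, ∑ p ∈ 𝓐 with x ∈ p.2, c p :=
        add_le_add (h₁ j) (sum_biUnion_le_sum_sum B _ hc0)
    _ ≤ 1 / 8 + ∑ x ∈ B, 1 / (8 * (Q : ℝ)) := by
        gcongr with x _
        exact h₂ x
    _ ≤ 1 / 8 + Q * (1 / (8 * (Q : ℝ))) := by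
        rw [Finset.sum_const, nsmul_eq_mul]
        gcongr
    _ = 1 / 4 := by field_simp; norm_num

/-- If bad blocks are rare, then the uniformly random partition without bad blocks is
vertex-spread. -/
theorem avoidingColorings_spread (hQ : 1 ≤ Q) (hs1 : ∀ j, 1 ≤ s j) (hsQ : ∀ j, s j ≤ Q)
    (hs : ∑ j, s j = Fintype.card V) (hcard : ∀ p ∈ 𝓐, p.2.card = s p.1)
    (h₁ : ∀ j, ∑ p ∈ 𝓐 with p.1 = j, ((Fintype.card V).choose (s p.1) : ℝ)⁻¹ ≤ 1 / 8)
    (h₂ : ∀ x, ∑ p ∈ 𝓐 with x ∈ p.2, ((Fintype.card V).choose (s p.1) : ℝ)⁻¹ ≤ 1 / (8 * Q))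
    (b : V → J) :
    (avoidingColorings s b ∅ 𝓐).Nonempty ∧ ∀ Y : Finset V,
      ((avoidingColorings s b Y 𝓐).card : ℝ) ≤
        (6 * Q / (Fintype.card V : ℝ)) ^ Y.card * (avoidingColorings s b ∅ 𝓐).card := by
  have hlocal : ∀ 𝓑 ⊆ 𝓐, ∀ p ∈ 𝓐, ((avoidingColorings s (fun _ => p.1) p.2 𝓑).card : ℝ) ≤
      2 * ((Fintype.card V).choose (s p.1) : ℝ)⁻¹ * (avoidingColorings s b ∅ 𝓑).card :=
    fun 𝓑 h𝓑 p hp => card_avoidingColorings_block_le hcard (fun p hp =>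
      sum_conflict_le hQ h₁ h₂ ((hcard p hp).le.trans (hsQ _))) b 𝓑 h𝓑 hp
  have hbatch : ∀ Y : Finset V, ((avoidingColorings s b ∅
      (𝓐.filter fun p => ∀ y ∈ Y, y ∉ p.2 ∧ p.1 ≠ b y)).card : ℝ) ≤
      2 ^ Y.card * (avoidingColorings s b ∅ 𝓐).card := by
    intro Y
    induction Y using Finset.induction_on with
    | empty => simp
    | insert y Y hy ih =>
      set 𝓑 := 𝓐.filter fun p => ∀ y ∈ Y, y ∉ p.2 ∧ p.1 ≠ b y with h𝓑
      set 𝓑₂ := 𝓐.filter fun p => ∀ z ∈ insert y Y, z ∉ p.2 ∧ p.1 ≠ b z with h𝓑₂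
      set 𝓑₁ := 𝓐.filter fun p => p.1 = b y ∨ ¬ Disjoint {y} p.2 with h𝓑₁
      have hunion : 𝓑 ⊆ 𝓑₁ ∪ 𝓑₂ := by
        intro p hp
        rw [h𝓑, Finset.mem_filter] at hp
        rw [Finset.mem_union, h𝓑₁, h𝓑₂, Finset.mem_filter, Finset.mem_filter,
          Finset.disjoint_singleton_left, not_not]
        by_cases h3 : p.1 = b y
        · exact Or.inl ⟨hp.1, Or.inl h3⟩
        by_cases h4 : y ∈ p.2
        · exact Or.inl ⟨hp.1, Or.inr h4⟩
        exact Or.inr ⟨hp.1, (Finset.forall_mem_insert _ _ _).2 ⟨⟨h4, h3⟩, hp.2⟩⟩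
      have hb : ((avoidingColorings s b ∅ 𝓑₂).card : ℝ) ≤
          (avoidingColorings s b ∅ 𝓑).card +
          ∑ p' ∈ 𝓑₁, ((avoidingColorings s (fun _ => p'.1) p'.2 𝓑₂).card : ℝ) := by
        exact_mod_cast card_avoidingColorings_le_add_sum s b hunion
      have hs1 : ∑ p' ∈ 𝓑₁, ((avoidingColorings s (fun _ => p'.1) p'.2 𝓑₂).card : ℝ) ≤
          ∑ p' ∈ 𝓑₁, 2 * ((Fintype.card V).choose (s p'.1) : ℝ)⁻¹ *
            (avoidingColorings s b ∅ 𝓑₂).card :=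
        Finset.sum_le_sum fun p' hp' => hlocal 𝓑₂ (Finset.filter_subset _ _) p'
          (Finset.mem_filter.1 hp').1
      have hs2 := sum_conflict_le hQ h₁ h₂ (j := b y) (B := {y}) (by simpa using hQ)
      rw [← Finset.sum_mul, ← Finset.mul_sum] at hs1
      have h0 : (0 : ℝ) ≤ (avoidingColorings s b ∅ 𝓑₂).card := by positivity
      have hs3 := mul_le_mul_of_nonneg_right hs2 h0
      rw [Finset.card_insert_of_notMem hy, pow_succ]
      linarith
  refine ⟨?_, fun Y => ?_⟩
  · have h := hbatch Finset.univ
    have hempty : (𝓐.filter fun p => ∀ y ∈ (Finset.univ : Finset V), y ∉ p.2 ∧ p.1 ≠ b y) = ∅ := by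
      refine Finset.filter_eq_empty_iff.2 fun p hp hall => ?_
      obtain ⟨y, hy⟩ := Finset.card_pos.1 ((hs1 p.1).trans_eq (hcard p hp).symm)
      exact (hall y (Finset.mem_univ y)).1 hy
    rw [hempty] at h
    have hpos : (0 : ℝ) < (avoidingColorings s b ∅ ∅).card := by
      exact_mod_cast Finset.card_pos.2 (avoidingColorings_empty_nonempty hs b)
    rw [← Finset.card_pos]
    by_contra h0
    rw [Nat.eq_zero_of_not_pos h0] at h
    simp only [Nat.cast_zero, mul_zero] at h
    linarith
  · set 𝓑 := 𝓐.filter fun p => ∀ y ∈ Y, y ∉ p.2 ∧ p.1 ≠ b y with h𝓑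
    have hsp := card_avoidingColorings_mul_descFactorial_le hsQ b Y (𝓑 := 𝓑) (by
      intro y hy p hp
      exact (Finset.mem_filter.1 hp).2 y hy)
    have hsp' : ((avoidingColorings s b Y 𝓑).card : ℝ) *
        ((Fintype.card V).descFactorial Y.card : ℝ) ≤
        (Q : ℝ) ^ Y.card * (avoidingColorings s b ∅ 𝓑).card := by exact_mod_cast hsp
    have h3 := pow_le_three_pow_mul_descFactorial (Fintype.card V) Y.card (Finset.card_le_univ Y)
    have h4 : ((avoidingColorings s b Y 𝓐).card : ℝ) ≤ (avoidingColorings s b Y 𝓑).card := by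
      exact_mod_cast Finset.card_le_card
        (avoidingColorings_subset s b subset_rfl (Finset.filter_subset _ _))
    have h5 := hbatch Y
    rcases Y.eq_empty_or_nonempty with rfl | ⟨y, hy⟩
    · simp
    have hV : (0 : ℝ) < Fintype.card V := by exact_mod_cast Fintype.card_pos_iff.2 ⟨y⟩
    rw [div_pow, div_mul_eq_mul_div, le_div_iff₀ (by positivity)]
    calc ((avoidingColorings s b Y 𝓐).card : ℝ) * (Fintype.card V : ℝ) ^ Y.card
        ≤ (avoidingColorings s b Y 𝓑).card *
            (3 ^ Y.card * ((Fintype.card V).descFactorial Y.card : ℝ)) := by gcongr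
      _ = 3 ^ Y.card * ((avoidingColorings s b Y 𝓑).card *
            ((Fintype.card V).descFactorial Y.card : ℝ)) := by ring
      _ ≤ 3 ^ Y.card * ((Q : ℝ) ^ Y.card * (2 ^ Y.card * (avoidingColorings s b ∅ 𝓐).card)) := by
          refine mul_le_mul_of_nonneg_left (hsp'.trans ?_) (by positivity)
          exact mul_le_mul_of_nonneg_left h5 (by positivity)
      _ = _ := by
          rw [show (6 : ℝ) * Q = 3 * Q * 2 by ring, mul_pow, mul_pow]
          ring

end SpreadColorings

section BoundedDifferences

variable {V : Type*} [Fintype V]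

lemma sum_exp_le_of_sum_eq_zero {h : V → ℝ} {d : ℝ} (hd1 : d ≤ 1) (hh : ∀ v, |h v| ≤ d)
    (hsum : ∑ v, h v = 0) : ∑ v, Real.exp (h v) ≤ Fintype.card V * Real.exp (d ^ 2) := by
  calc ∑ v, Real.exp (h v) ≤ ∑ v, (1 + h v + d ^ 2) := by
        refine Finset.sum_le_sum fun v _ => ?_
        have h1 := (abs_le.1 (Real.abs_exp_sub_one_sub_id_le ((hh v).trans hd1))).2
        have h2 : h v ^ 2 ≤ d ^ 2 := sq_le_sq' (by linarith [neg_abs_le (h v), hh v])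
          ((le_abs_self _).trans (hh v))
        linarith
    _ = Fintype.card V * (1 + d ^ 2) := by
        rw [Finset.sum_add_distrib, Finset.sum_add_distrib, hsum]
        simp
        ring
    _ ≤ _ := by
        have := Real.add_one_le_exp (d ^ 2)
        gcongr
        linarith

/-- The bounded differences inequality, as a bound on the moment generating function of a function
of `q` independent uniform elements of `V`. -/
lemma sum_exp_le_of_bounded_differences [Nonempty V] {c lam : ℝ} (hlam : 0 ≤ lam)
    (hc1 : lam * c ≤ 1) (q : ℕ) (g : (Fin q → V) → ℝ)
    (hg : ∀ x i v, |g (Function.update x i v) - g x| ≤ c) :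
    ∑ x, Real.exp (lam * ((∑ y, g y) / (Fintype.card V : ℝ) ^ q - g x)) ≤
      (Fintype.card V : ℝ) ^ q * Real.exp (q * (lam * c) ^ 2) := by
  have hn : (0 : ℝ) < Fintype.card V := by exact_mod_cast Fintype.card_pos
  induction q with
  | zero => simp
  | succ q ih =>
    set n : ℝ := (Fintype.card V : ℝ) with hn'
    have hsumcons : ∀ F : (Fin (q + 1) → V) → ℝ,
        ∑ x, F x = ∑ v, ∑ x : Fin q → V, F (Fin.cons v x) := by
      intro F
      rw [← Fintype.sum_prod_type']
      exact (Fintype.sum_equiv (Fin.consEquiv fun _ => V) _ _ fun _ => rfl).symm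
    set h : V → ℝ := fun v => (∑ x : Fin q → V, g (Fin.cons v x)) / n ^ q with hh
    set μ : ℝ := (∑ y, g y) / n ^ (q + 1) with hμ
    have hμh : μ = (∑ v, h v) / n := by
      rw [hμ, hsumcons, hh, ← Finset.sum_div, div_div, pow_succ]
    have hdiff : ∀ v v', |h v - h v'| ≤ c := by
      intro v v'
      simp only [hh]
      rw [← sub_div, ← Finset.sum_sub_distrib, abs_div, abs_of_pos (pow_pos hn q),
        div_le_iff₀ (pow_pos hn q)]
      refine (Finset.abs_sum_le_sum_abs _ _).trans ?_
      calc ∑ x : Fin q → V, |g (Fin.cons v x) - g (Fin.cons v' x)|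
          ≤ ∑ _x : Fin q → V, c := by
            refine Finset.sum_le_sum fun x _ => ?_
            have := hg (Fin.cons v' x) 0 v
            rwa [Fin.update_cons_zero] at this
        _ = c * n ^ q := by simp [hn', mul_comm]
    have hdev : ∀ v, |lam * (μ - h v)| ≤ lam * c := by
      intro v
      rw [abs_mul, abs_of_nonneg hlam]
      refine mul_le_mul_of_nonneg_left ?_ hlam
      have : μ - h v = (∑ v', (h v' - h v)) / n := by
        rw [hμh, Finset.sum_sub_distrib]
        simp only [Finset.sum_const, Finset.card_univ, nsmul_eq_mul]
        rw [sub_div, mul_div_cancel_left₀ _ hn.ne']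
      rw [this, abs_div, abs_of_pos hn, div_le_iff₀ hn]
      refine (Finset.abs_sum_le_sum_abs _ _).trans ?_
      calc ∑ v', |h v' - h v| ≤ ∑ _v' : V, c := Finset.sum_le_sum fun v' _ => hdiff v' v
        _ = c * n := by simp [hn', mul_comm]
    have hzero : ∑ v, lam * (μ - h v) = 0 := by
      rw [← Finset.mul_sum, Finset.sum_sub_distrib, hμh]
      simp only [Finset.sum_const, Finset.card_univ, nsmul_eq_mul]
      rw [mul_div_cancel₀ _ hn.ne']
      ring
    have houter := sum_exp_le_of_sum_eq_zero hc1 hdev hzero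
    rw [hsumcons]
    calc ∑ v, ∑ x : Fin q → V, Real.exp (lam * (μ - g (Fin.cons v x)))
        = ∑ v, Real.exp (lam * (μ - h v)) *
            ∑ x : Fin q → V, Real.exp (lam * (h v - g (Fin.cons v x))) := by
          refine Finset.sum_congr rfl fun v _ => ?_
          rw [Finset.mul_sum]
          refine Finset.sum_congr rfl fun x _ => ?_
          rw [← Real.exp_add]
          ring_nf
      _ ≤ ∑ v, Real.exp (lam * (μ - h v)) * (n ^ q * Real.exp (q * (lam * c) ^ 2)) := by
          refine Finset.sum_le_sum fun v _ => mul_le_mul_of_nonneg_left ?_ (Real.exp_pos _).le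
          refine ih (fun x => g (Fin.cons v x)) fun x i u => ?_
          rw [Fin.cons_update]
          exact hg _ _ _
      _ ≤ (n * Real.exp ((lam * c) ^ 2)) * (n ^ q * Real.exp (q * (lam * c) ^ 2)) := by
          rw [← Finset.sum_mul]
          gcongr
      _ = n ^ (q + 1) * Real.exp ((q + 1 : ℕ) * (lam * c) ^ 2) := by
          have : ((q + 1 : ℕ) : ℝ) * (lam * c) ^ 2 = (lam * c) ^ 2 + q * (lam * c) ^ 2 := by
            push_cast; ring
          rw [this, Real.exp_add]
          ring

lemma card_filter_le_of_bounded_differences [Nonempty V] {c lam t : ℝ} (hlam : 0 ≤ lam)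
    (hc1 : lam * c ≤ 1) (q : ℕ) (g : (Fin q → V) → ℝ)
    (hg : ∀ x i v, |g (Function.update x i v) - g x| ≤ c) (S : Finset (Fin q → V))
    (hS : ∀ x ∈ S, g x ≤ (∑ y, g y) / (Fintype.card V : ℝ) ^ q - t) :
    (S.card : ℝ) ≤ (Fintype.card V : ℝ) ^ q * Real.exp (q * (lam * c) ^ 2 - lam * t) := by
  have h := sum_exp_le_of_bounded_differences hlam hc1 q g hg
  have h2 : (S.card : ℝ) * Real.exp (lam * t) ≤
      ∑ x, Real.exp (lam * ((∑ y, g y) / (Fintype.card V : ℝ) ^ q - g x)) := by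
    calc (S.card : ℝ) * Real.exp (lam * t) = ∑ _x ∈ S, Real.exp (lam * t) := by
          rw [Finset.sum_const, nsmul_eq_mul]
      _ ≤ ∑ x ∈ S, Real.exp (lam * ((∑ y, g y) / (Fintype.card V : ℝ) ^ q - g x)) := by
          refine Finset.sum_le_sum fun x hx => Real.exp_le_exp.2 ?_
          exact mul_le_mul_of_nonneg_left (by linarith [hS x hx]) hlam
      _ ≤ _ := Finset.sum_le_sum_of_subset_of_nonneg (Finset.subset_univ S)
          fun _ _ _ => (Real.exp_pos _).le
  rw [Real.exp_sub, ← mul_div_assoc, le_div_iff₀ (Real.exp_pos _)]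
  exact h2.trans h

end BoundedDifferences

section Sampling

variable {V : Type*} [Fintype V] [DecidableEq V]

lemma card_filter_comp_eq {a b : ℕ} {e : Fin a → Fin b} (he : Function.Injective e)
    (t : Fin a → V) :
    (Finset.univ.filter fun x : Fin b → V => x ∘ e = t).card = Fintype.card V ^ (b - a) := by
  have h1 : (Finset.univ.filter fun x : Fin b → V => x ∘ e = t) =
      Fintype.piFinset fun i => Finset.univ.filter fun v => ∀ j, e j = i → v = t j := by
    ext x
    simp only [Finset.mem_filter, Finset.mem_univ, true_and, Fintype.mem_piFinset]
    constructor
    · rintro rfl i j rfl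
      rfl
    · intro h
      funext j
      exact h (e j) j rfl
  rw [h1, Fintype.card_piFinset]
  have h2 : ∀ i, (Finset.univ.filter fun v => ∀ j, e j = i → v = t j).card =
      if i ∈ Finset.univ.image e then 1 else Fintype.card V := by
    intro i
    split_ifs with hi
    · obtain ⟨j, -, rfl⟩ := Finset.mem_image.1 hi
      rw [Finset.card_eq_one]
      refine ⟨t j, ?_⟩
      ext v
      simp only [Finset.mem_filter, Finset.mem_univ, true_and, Finset.mem_singleton]
      exact ⟨fun h => h j rfl, fun h j' hj' => he hj' ▸ h⟩
    · rw [Finset.filter_true_of_mem, Finset.card_univ]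
      intro v _ j hj
      exact absurd (Finset.mem_image.2 ⟨j, Finset.mem_univ j, hj⟩) hi
  rw [Finset.prod_congr rfl fun i _ => h2 i, Finset.prod_ite]
  simp only [Finset.prod_const, one_pow, one_mul]
  congr 1
  have h3 : (Finset.univ.filter fun i => i ∉ Finset.univ.image e) = (Finset.univ.image e)ᶜ := by
    ext; simp
  rw [h3, Finset.card_compl, Finset.card_image_of_injective _ he]
  simp

lemma card_filter_image_eq {r : ℕ} {R : Finset V} (hR : R.card = r) :
    (Finset.univ.filter fun t : Fin r → V => Finset.univ.image t = R).card = r.factorial := by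
  have e : Fin r ≃ R := Fintype.equivOfCardEq (by simp [hR])
  have h1 : Fintype.card (Fin r ≃ R) = r.factorial := by
    rw [Fintype.card_equiv e, Fintype.card_fin]
  rw [← h1, ← Finset.card_univ]
  symm
  refine Finset.card_bij (fun φ _ => fun i => (φ i : V)) ?_ ?_ ?_
  · intro φ _
    simp only [Finset.mem_filter, Finset.mem_univ, true_and]
    ext v
    simp only [Finset.mem_image, Finset.mem_univ, true_and]
    constructor
    · rintro ⟨i, rfl⟩
      exact (φ i).2
    · intro hv
      exact ⟨φ.symm ⟨v, hv⟩, by simp⟩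
  · intro φ _ φ' _ h
    ext i
    exact congrFun h i
  · intro t ht
    rw [Finset.mem_filter] at ht
    have hmem : ∀ i, t i ∈ R := fun i => ht.2 ▸ Finset.mem_image_of_mem t (Finset.mem_univ i)
    have hsurj : Function.Surjective fun i => (⟨t i, hmem i⟩ : R) := by
      rintro ⟨v, hv⟩
      rw [← ht.2] at hv
      obtain ⟨i, -, hi⟩ := Finset.mem_image.1 hv
      exact ⟨i, Subtype.ext hi⟩
    have hbij := (Fintype.bijective_iff_surjective_and_card _).2 ⟨hsurj, by simp [hR]⟩
    exact ⟨Equiv.ofBijective _ hbij, Finset.mem_univ _, rfl⟩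

/-- The number of index tuples `e` such that the entries of `x` at `e` form a member of `T`. -/
def tupleCount (r : ℕ) (T : Finset (Finset V)) {q : ℕ} (x : Fin q → V) : ℕ :=
  (Finset.univ.filter fun e : Fin r → Fin q => Finset.univ.image (x ∘ e) ∈ T).card

lemma card_filter_mem_range_le (r q : ℕ) (i : Fin q) :
    (Finset.univ.filter fun e : Fin r → Fin q => ∃ a, e a = i).card ≤ r * q ^ (r - 1) := by
  have h : (Finset.univ.filter fun e : Fin r → Fin q => ∃ a, e a = i) ⊆
      Finset.univ.biUnion fun a : Fin r =>
        Finset.univ.filter fun e : Fin r → Fin q => e ∘ (fun _ : Fin 1 => a) = fun _ => i := by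
    intro e he
    rw [Finset.mem_filter] at he
    obtain ⟨-, a, ha⟩ := he
    rw [Finset.mem_biUnion]
    refine ⟨a, Finset.mem_univ a, ?_⟩
    simp only [Finset.mem_filter, Finset.mem_univ, true_and]
    funext j
    exact ha
  refine (Finset.card_le_card h).trans ((Finset.card_biUnion_le).trans ?_)
  have h2 : ∀ a : Fin r, (Finset.univ.filter fun e : Fin r → Fin q =>
      e ∘ (fun _ : Fin 1 => a) = fun _ => i).card = q ^ (r - 1) := fun a => by
    rw [card_filter_comp_eq (Function.injective_of_subsingleton _), Fintype.card_fin]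
  rw [Finset.sum_congr rfl fun a _ => h2 a]
  simp

omit [Fintype V] in
lemma tupleCount_update_le (r : ℕ) (T : Finset (Finset V)) {q : ℕ} (x : Fin q → V) (i : Fin q)
    (v : V) : tupleCount r T (Function.update x i v) ≤ tupleCount r T x + r * q ^ (r - 1) := by
  refine le_trans ?_ (Nat.add_le_add_left (card_filter_mem_range_le r q i) _)
  refine le_trans (Finset.card_le_card ?_) (Finset.card_union_le _ _)
  intro e he
  rw [Finset.mem_union]
  by_cases h : ∃ a, e a = i
  · exact Or.inr (Finset.mem_filter.2 ⟨Finset.mem_univ _, h⟩)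
  · push Not at h
    refine Or.inl (Finset.mem_filter.2 ⟨Finset.mem_univ _, ?_⟩)
    have : Function.update x i v ∘ e = x ∘ e := by
      funext a
      simp [Function.update_of_ne (h a)]
    rw [Finset.mem_filter, this] at he
    exact he.2

omit [Fintype V] in
lemma abs_tupleCount_update_sub_le (r : ℕ) (T : Finset (Finset V)) {q : ℕ} (x : Fin q → V)
    (i : Fin q) (v : V) :
    |(tupleCount r T (Function.update x i v) : ℝ) - tupleCount r T x| ≤ r * (q : ℝ) ^ (r - 1) := by
  have h1 : (tupleCount r T (Function.update x i v) : ℝ) ≤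
      tupleCount r T x + r * (q : ℝ) ^ (r - 1) := by
    exact_mod_cast tupleCount_update_le r T x i v
  have h2 : (tupleCount r T x : ℝ) ≤
      tupleCount r T (Function.update x i v) + r * (q : ℝ) ^ (r - 1) := by
    have := tupleCount_update_le r T (Function.update x i v) i (x i)
    rw [Function.update_idem, Function.update_eq_self] at this
    exact_mod_cast this
  rw [abs_le]
  constructor <;> linarith

lemma tupleCount_le {r q : ℕ} {T : Finset (Finset V)} (hT : ∀ R ∈ T, R.card = r) {x : Fin q → V}
    (hx : Function.Injective x) :
    tupleCount r T x ≤ r.factorial * (T.filter fun R => R ⊆ Finset.univ.image x).card := by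
  refine Finset.card_le_mul_card_image_of_maps_to
    (f := fun e : Fin r → Fin q => Finset.univ.image (x ∘ e)) ?_ _ ?_
  · intro e he
    rw [Finset.mem_filter] at he ⊢
    refine ⟨he.2, fun v hv => ?_⟩
    obtain ⟨a, -, rfl⟩ := Finset.mem_image.1 hv
    exact Finset.mem_image_of_mem x (Finset.mem_univ _)
  · intro R hR
    rw [← card_filter_image_eq (hT R (Finset.mem_filter.1 hR).1)]
    refine Finset.card_le_card_of_injOn (fun e => x ∘ e) ?_ ?_
    · intro e he
      simpa using (Finset.mem_filter.1 he).2
    · intro e _ e' _ h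
      exact hx.comp_left h

lemma le_sum_tupleCount {r q : ℕ} {T : Finset (Finset V)} (hT : ∀ R ∈ T, R.card = r) :
    q.descFactorial r * (T.card * r.factorial * Fintype.card V ^ (q - r)) ≤
      ∑ x : Fin q → V, tupleCount r T x := by
  have hswap : ∑ x : Fin q → V, tupleCount r T x =
      ∑ e : Fin r → Fin q,
        (Finset.univ.filter fun x : Fin q → V => Finset.univ.image (x ∘ e) ∈ T).card := by
    simp only [tupleCount, Finset.card_filter]
    exact Finset.sum_comm
  rw [hswap]
  have hinj : ∀ e ∈ Finset.univ.filter fun e : Fin r → Fin q => Function.Injective e,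
      T.card * r.factorial * Fintype.card V ^ (q - r) ≤
        (Finset.univ.filter fun x : Fin q → V => Finset.univ.image (x ∘ e) ∈ T).card := by
    intro e he
    replace he := (Finset.mem_filter.1 he).2
    rw [Finset.card_eq_sum_card_fiberwise
      (f := fun x : Fin q → V => x ∘ e)
      (t := Finset.univ.filter fun t : Fin r → V => Finset.univ.image t ∈ T)
      (fun x hx => by simpa using (Finset.mem_filter.1 hx).2)]
    have h1 : ∀ t ∈ Finset.univ.filter fun t : Fin r → V => Finset.univ.image t ∈ T,
        (((Finset.univ.filter fun x : Fin q → V => Finset.univ.image (x ∘ e) ∈ T).filter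
          fun x => x ∘ e = t)).card = Fintype.card V ^ (q - r) := by
      intro t ht
      rw [← card_filter_comp_eq he t, Finset.filter_filter]
      congr 1
      refine Finset.filter_congr fun x _ => ⟨fun h => h.2, fun h => ⟨?_, h⟩⟩
      rw [h]
      exact (Finset.mem_filter.1 ht).2
    rw [Finset.sum_congr rfl h1, Finset.sum_const, smul_eq_mul]
    refine Nat.mul_le_mul_right _ (le_of_eq ?_)
    rw [Finset.card_eq_sum_card_fiberwise
      (s := Finset.univ.filter fun t : Fin r → V => Finset.univ.image t ∈ T)
      (f := fun t : Fin r → V => Finset.univ.image t) (t := T) (fun t ht => by simpa using ht)]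
    have h2 : ∀ R ∈ T, ((Finset.univ.filter fun t : Fin r → V => Finset.univ.image t ∈ T).filter
        fun t => Finset.univ.image t = R).card = r.factorial := by
      intro R hR
      rw [← card_filter_image_eq (hT R hR), Finset.filter_filter]
      congr 1
      refine Finset.filter_congr fun t _ => ⟨fun h => h.2, fun h => ⟨?_, h⟩⟩
      rwa [h]
    rw [Finset.sum_congr rfl h2, Finset.sum_const, smul_eq_mul]
  have hcount : (Finset.univ.filter fun e : Fin r → Fin q => Function.Injective e).card =
      q.descFactorial r := by
    have h := Fintype.card_embedding_eq (α := Fin r) (β := Fin q)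
    rw [Fintype.card_fin, Fintype.card_fin] at h
    rw [← h, ← Fintype.card_subtype]
    exact Fintype.card_congr (Equiv.subtypeInjectiveEquivEmbedding _ _)
  calc q.descFactorial r * (T.card * r.factorial * Fintype.card V ^ (q - r))
      = ∑ _e ∈ Finset.univ.filter fun e : Fin r → Fin q => Function.Injective e,
          T.card * r.factorial * Fintype.card V ^ (q - r) := by
        rw [Finset.sum_const, smul_eq_mul, hcount]
    _ ≤ ∑ e ∈ Finset.univ.filter fun e : Fin r → Fin q => Function.Injective e, _ :=
        Finset.sum_le_sum hinj
    _ ≤ _ := Finset.sum_le_sum_of_subset (Finset.filter_subset _ _)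

/-- Few `q`-sets contain substantially fewer members of `T` than expected. -/
lemma card_low_mul_factorial_le [Nonempty V] {r q : ℕ} (hrq : r ≤ q) {T : Finset (Finset V)}
    (hT : ∀ R ∈ T, R.card = r) {lam t θ : ℝ} (hlam : 0 ≤ lam)
    (hc1 : lam * (r * (q : ℝ) ^ (r - 1)) ≤ 1)
    (hθ : r.factorial * θ ≤
      q.descFactorial r * (T.card * r.factorial) / (Fintype.card V : ℝ) ^ r - t) :
    (((Finset.univ.powersetCard q).filter
      fun D : Finset V => ((T.filter fun R => R ⊆ D).card : ℝ) < θ).card : ℝ) * q.factorial ≤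
      (Fintype.card V : ℝ) ^ q *
        Real.exp (q * (lam * (r * (q : ℝ) ^ (r - 1))) ^ 2 - lam * t) := by
  have hn : (0 : ℝ) < Fintype.card V := by exact_mod_cast Fintype.card_pos
  set L := (Finset.univ.powersetCard q).filter
      fun D : Finset V => ((T.filter fun R => R ⊆ D).card : ℝ) < θ with hL
  set S := Finset.univ.filter fun x : Fin q → V => Finset.univ.image x ∈ L with hS
  have hcard : S.card = L.card * q.factorial := by
    rw [Finset.card_eq_sum_card_fiberwise (s := S)
      (f := fun x : Fin q → V => Finset.univ.image x) (t := L)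
      (fun x hx => (Finset.mem_filter.1 hx).2)]
    have h2 : ∀ D ∈ L, (S.filter fun x => Finset.univ.image x = D).card = q.factorial := by
      intro D hD
      have hDq := (Finset.mem_powersetCard.1 (Finset.mem_filter.1 hD).1).2
      rw [← card_filter_image_eq hDq, hS, Finset.filter_filter]
      congr 1
      refine Finset.filter_congr fun x _ => ⟨fun h => h.2, fun h => ⟨?_, h⟩⟩
      rwa [h]
    rw [Finset.sum_congr rfl h2, Finset.sum_const, smul_eq_mul]
  have h := card_filter_le_of_bounded_differences (t := t) hlam hc1 q
    (fun x => (tupleCount r T x : ℝ)) (abs_tupleCount_update_sub_le r T) S (by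
      intro x hx
      have hxL : Finset.univ.image x ∈ L := (Finset.mem_filter.1 hx).2
      obtain ⟨hxq, hlow⟩ := Finset.mem_filter.1 hxL
      have hinj : Function.Injective x := by
        rw [← Set.injOn_univ, ← Finset.coe_univ, ← Finset.card_image_iff,
          (Finset.mem_powersetCard.1 hxq).2]
        simp
      have h1 : (tupleCount r T x : ℝ) ≤
          r.factorial * ((T.filter fun R => R ⊆ Finset.univ.image x).card : ℝ) := by
        exact_mod_cast tupleCount_le hT hinj
      have h2 : (q.descFactorial r : ℝ) * (T.card * r.factorial * (Fintype.card V : ℝ) ^ (q - r)) ≤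
          ∑ y : Fin q → V, (tupleCount r T y : ℝ) := by
        exact_mod_cast le_sum_tupleCount (V := V) (q := q) hT
      have h3 : (q.descFactorial r : ℝ) * (T.card * r.factorial) / (Fintype.card V : ℝ) ^ r ≤
          (∑ y : Fin q → V, (tupleCount r T y : ℝ)) / (Fintype.card V : ℝ) ^ q := by
        rw [div_le_div_iff₀ (by positivity) (by positivity)]
        calc (q.descFactorial r : ℝ) * (T.card * r.factorial) * (Fintype.card V : ℝ) ^ q
            = (q.descFactorial r : ℝ) * (T.card * r.factorial *
                (Fintype.card V : ℝ) ^ (q - r)) * (Fintype.card V : ℝ) ^ r := by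
              rw [← pow_sub_mul_pow (Fintype.card V : ℝ) hrq]
              ring
          _ ≤ _ := mul_le_mul_of_nonneg_right h2 (by positivity)
      have h4 : (r.factorial : ℝ) * ((T.filter fun R => R ⊆ Finset.univ.image x).card : ℝ) ≤
          r.factorial * θ := by gcongr
      linarith)
  rw [hcard] at h
  exact_mod_cast h

end Sampling

lemma one_sub_le_descFactorial_div {n r : ℕ} (hn : 1 ≤ n) (hr : r ≤ n) :
    1 - (r : ℝ) ^ 2 / n ≤ (n.descFactorial r : ℝ) / (n : ℝ) ^ r := by
  have hn0 : (0 : ℝ) < n := by exact_mod_cast hn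
  have h1 : ((n - r : ℕ) : ℝ) ^ r ≤ n.descFactorial r := by
    have h2 := Nat.pow_sub_le_descFactorial n r
    have h3 : (n - r) ^ r ≤ (n + 1 - r) ^ r := Nat.pow_le_pow_left (by omega) r
    exact_mod_cast h3.trans h2
  rw [Nat.cast_sub hr] at h1
  have hrn : (r : ℝ) / n ≤ 1 := by
    rw [div_le_one hn0]
    exact_mod_cast hr
  have h4 := one_add_mul_le_pow (a := -((r : ℝ) / n)) (by linarith) r
  calc 1 - (r : ℝ) ^ 2 / n = 1 + r * -((r : ℝ) / n) := by ring
    _ ≤ (1 + -((r : ℝ) / n)) ^ r := h4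
    _ = ((n : ℝ) - r) ^ r / (n : ℝ) ^ r := by
        rw [← div_pow]
        congr 1
        field_simp
        ring
    _ ≤ _ := by gcongr

/-- If `T` has density at least `α + η` among `r`-sets, then all but an exponentially small
proportion of the `q`-sets contain a proportion `α` of their `r`-subsets in `T`. -/
lemma card_sparse_mul_factorial_le {r : ℕ} (hr : 1 ≤ r) {η α : ℝ} (hη : 0 < η) (hα : 0 ≤ α)
    {q n : ℕ} (hq : 2 * r ≤ q) (hrn : r ≤ n) (hn : 2 * (r : ℝ) ^ 2 ≤ η * n)
    {T : Finset (Finset (Fin n))} (hT : ∀ R ∈ T, R.card = r)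
    (hTα : (α + η) * n.choose r ≤ T.card) :
    (((Finset.univ.powersetCard q).filter
      fun D : Finset (Fin n) => ((T.filter fun R => R ⊆ D).card : ℝ) < α * q.choose r).card : ℝ) *
        q.factorial ≤ (n : ℝ) ^ q * Real.exp (-(η ^ 2 / (4 ^ (r + 2) * r ^ 2) * q)) := by
  have hn1 : 1 ≤ n := hr.trans hrn
  have hn0 : (0 : ℝ) < n := by exact_mod_cast hn1
  have hq1 : 1 ≤ q := by omega
  have hq0 : (0 : ℝ) < q := by exact_mod_cast hq1
  have hr0 : (0 : ℝ) < r := by exact_mod_cast hr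
  have : Nonempty (Fin n) := ⟨⟨0, hn1⟩⟩
  have hTle : (T.card : ℝ) ≤ n.choose r := by
    have : T ⊆ Finset.univ.powersetCard r := fun R hR =>
      Finset.mem_powersetCard.2 ⟨Finset.subset_univ R, hT R hR⟩
    have := Finset.card_le_card this
    rw [Finset.card_powersetCard, Finset.card_univ, Fintype.card_fin] at this
    exact_mod_cast this
  have hch : (0 : ℝ) < n.choose r := by exact_mod_cast Nat.choose_pos hrn
  have hα1 : α + η ≤ 1 := by
    by_contra h
    push Not at h
    nlinarith
  have hdf : ∀ N : ℕ, (N.descFactorial r : ℝ) = r.factorial * N.choose r := fun N => by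
    exact_mod_cast Nat.descFactorial_eq_factorial_mul_choose N r
  set t : ℝ := η / 2 * q.descFactorial r with ht
  set c : ℝ := r * (q : ℝ) ^ (r - 1) with hc
  have hc0 : 0 < c := by positivity
  have hqc : q * c = r * (q : ℝ) ^ r := by
    rw [hc, ← mul_pow_sub_one (by omega : r ≠ 0) (q : ℝ)]
    ring
  have htpos : 0 ≤ t := by positivity
  have hdq : (q.descFactorial r : ℝ) ≤ (q : ℝ) ^ r := by
    exact_mod_cast Nat.descFactorial_le_pow q r
  have hdq' : ((q : ℝ) / 2) ^ r ≤ q.descFactorial r := by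
    have h2 : ((q + 1 - r : ℕ) : ℝ) ^ r ≤ q.descFactorial r := by
      exact_mod_cast Nat.pow_sub_le_descFactorial q r
    refine le_trans (pow_le_pow_left₀ (by positivity) ?_ r) h2
    rw [div_le_iff₀ two_pos]
    exact_mod_cast (by omega : q ≤ (q + 1 - r) * 2)
  set lam : ℝ := t / (2 * q * c ^ 2) with hlam
  have hlamc : lam * c = t / (2 * (q * c)) := by
    rw [hlam]
    field_simp
  have hx := one_sub_le_descFactorial_div hn1 hrn
  have hx2 : (r : ℝ) ^ 2 / n ≤ η / 2 := by
    rw [div_le_iff₀ hn0]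
    linarith
  have hx1 : (n.descFactorial r : ℝ) / (n : ℝ) ^ r ≤ 1 := by
    rw [div_le_one (by positivity)]
    exact_mod_cast Nat.descFactorial_le_pow n r
  have hmain := card_low_mul_factorial_le (V := Fin n) (q := q) (by omega : r ≤ q) hT
    (lam := lam) (t := t) (θ := α * q.choose r) (by positivity) ?_ ?_
  · rw [Fintype.card_fin] at hmain
    refine hmain.trans ?_
    refine mul_le_mul_of_nonneg_left (Real.exp_le_exp.2 ?_) (by positivity)
    have h1 : q * (lam * c) ^ 2 - lam * t = -(q * (t / (q * c)) ^ 2 / 4) := by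
      rw [hlamc, hlam]
      field_simp
      ring
    rw [h1, neg_le_neg_iff, hqc]
    have h2 : η / 2 * ((q : ℝ) / 2) ^ r / (r * (q : ℝ) ^ r) ≤ t / (r * (q : ℝ) ^ r) := by
      rw [ht]
      gcongr
    have h3 : η / 2 * ((q : ℝ) / 2) ^ r / (r * (q : ℝ) ^ r) = η / (2 * (r * 2 ^ r)) := by
      rw [div_pow]
      field_simp
    rw [h3] at h2
    have h4 : η ^ 2 / (4 ^ (r + 2) * (r : ℝ) ^ 2) * q = q * (η / (2 * (r * 2 ^ r))) ^ 2 / 4 := by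
      have : (4 : ℝ) ^ (r + 2) = 16 * (2 ^ r) ^ 2 := by
        rw [← pow_mul, mul_comm r 2, pow_mul]
        norm_num [pow_add]
        ring
      rw [this]
      field_simp
      norm_num
    rw [h4]
    gcongr
  · rw [← hc, hlamc, hqc, div_le_one (by positivity)]
    have hr1 : (1 : ℝ) ≤ r := by exact_mod_cast hr
    have hη1 : η ≤ 1 := by linarith
    calc t ≤ 1 / 2 * (q : ℝ) ^ r := by
          rw [ht]
          gcongr
      _ ≤ 2 * (r * (q : ℝ) ^ r) := by
          nlinarith [pow_pos hq0 r]
  · rw [Fintype.card_fin]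
    have h1 : (α + η / 2) ≤ (T.card : ℝ) * r.factorial / (n : ℝ) ^ r := by
      calc α + η / 2 ≤ (α + η) * ((n.descFactorial r : ℝ) / (n : ℝ) ^ r) := by
            nlinarith
        _ = ((α + η) * n.choose r) * r.factorial / (n : ℝ) ^ r := by
            rw [hdf]
            ring
        _ ≤ _ := by gcongr
    calc (r.factorial : ℝ) * (α * q.choose r) = q.descFactorial r * (α + η / 2) - t := by
          rw [ht, hdf]
          ring
      _ ≤ q.descFactorial r * ((T.card : ℝ) * r.factorial / (n : ℝ) ^ r) - t := by gcongr
      _ = _ := by ring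

/-- Every `l`-subset of `B` has at least `d` times the maximum possible degree in `H[B]`. -/
def IsRich {n : ℕ} (H : Finset (Finset (Fin n))) (k l : ℕ) (d : ℝ) (B : Finset (Fin n)) : Prop :=
  ∀ S ⊆ B, S.card = l →
    d * (B.card.choose (k - l) : ℝ) ≤ ((H.filter fun e => S ⊆ e ∧ e ⊆ B).card : ℝ)

section PoorBlocks

variable {n : ℕ} {H : Finset (Finset (Fin n))} {k l : ℕ}

/-- The link of `S` in `H`. -/
def link (H : Finset (Finset (Fin n))) (S : Finset (Fin n)) : Finset (Finset (Fin n)) :=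
  (H.filter fun e => S ⊆ e).image fun e => e \ S

lemma card_link (S : Finset (Fin n)) : (link H S).card = hDeg H S := by
  refine Finset.card_image_of_injOn fun e he e' he' h => ?_
  have h1 := (Finset.mem_filter.1 he).2
  have h2 := (Finset.mem_filter.1 he').2
  rw [← Finset.sdiff_union_of_subset h1, ← Finset.sdiff_union_of_subset h2]
  exact congrArg (· ∪ S) h

lemma card_of_mem_link (hH : ∀ e ∈ H, e.card = k) {S R : Finset (Fin n)} (hS : S.card = l)
    (hR : R ∈ link H S) : R.card = k - l := by
  obtain ⟨e, he, rfl⟩ := Finset.mem_image.1 hR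
  rw [Finset.mem_filter] at he
  rw [Finset.card_sdiff_of_subset he.2, hH e he.1, hS]

lemma card_link_filter_le {S D B : Finset (Fin n)} (hS : S ⊆ B) (hD : D ⊆ B) :
    ((link H S).filter fun R => R ⊆ D).card ≤ (H.filter fun e => S ⊆ e ∧ e ⊆ B).card := by
  have h : (link H S).filter (fun R => R ⊆ D) ⊆
      (H.filter fun e => S ⊆ e ∧ e ⊆ B).image fun e => e \ S := by
    intro R hR
    obtain ⟨hR1, hR2⟩ := Finset.mem_filter.1 hR
    obtain ⟨e, he, rfl⟩ := Finset.mem_image.1 hR1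
    rw [Finset.mem_filter] at he
    refine Finset.mem_image.2 ⟨e, Finset.mem_filter.2 ⟨he.1, he.2, ?_⟩, rfl⟩
    rw [← Finset.sdiff_union_of_subset he.2]
    exact Finset.union_subset (hR2.trans hD) hS
  exact (Finset.card_le_card h).trans Finset.card_image_le

open Classical in
/-- The sets of size `s` containing `v` that are not rich are covered by the sparse sets in the
links of `l`-sets. -/
lemma card_not_isRich_le {d d' : ℝ} {s : ℕ} {L : ℝ} (hL0 : 0 ≤ L) (hls : l + 1 ≤ s)
    (hd : d * s.choose (k - l) ≤ d' * (s - (l + 1)).choose (k - l))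
    (hL : ∀ S : Finset (Fin n), S.card = l →
      (((Finset.univ.powersetCard (s - (l + 1))).filter fun D : Finset (Fin n) =>
        (((link H S).filter fun R => R ⊆ D).card : ℝ) <
          d' * (s - (l + 1)).choose (k - l)).card : ℝ) ≤ L) (v : Fin n) :
    (((Finset.univ.powersetCard s).filter fun B => v ∈ B ∧ ¬ IsRich H k l d B).card : ℝ) ≤
      (n : ℝ) ^ l * ((l + 1) * L) := by
  set low : Finset (Fin n) → Finset (Finset (Fin n)) := fun S =>
    (Finset.univ.powersetCard (s - (l + 1))).filter fun D : Finset (Fin n) =>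
        (((link H S).filter fun R => R ⊆ D).card : ℝ) <
          d' * (s - (l + 1)).choose (k - l) with hlow
  set 𝒰 := (Finset.univ.powersetCard l).image (fun U' : Finset (Fin n) => insert v U') with h𝒰
  have hcov : (Finset.univ.powersetCard s).filter (fun B => v ∈ B ∧ ¬ IsRich H k l d B) ⊆
      𝒰.biUnion fun U => (U.powersetCard l).biUnion fun S =>
        (low S).image fun D => U ∪ D := by
    intro B hB
    obtain ⟨hBs, hvB, hB2⟩ := Finset.mem_filter.1 hB
    have hBcard := (Finset.mem_powersetCard.1 hBs).2
    simp only [IsRich, not_forall, not_le] at hB2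
    obtain ⟨S, hSB, hSl, hSlow⟩ := hB2
    have hU : ∃ U, insert v S ⊆ U ∧ U ⊆ B ∧ U.card = l + 1 :=
      Finset.exists_subsuperset_card_eq (Finset.insert_subset hvB hSB)
        ((Finset.card_insert_le v S).trans (by omega)) (by omega)
    obtain ⟨U, hSU, hUB, hUcard⟩ := hU
    have hvU : v ∈ U := hSU (Finset.mem_insert_self v S)
    have hSU' : S ⊆ U := (Finset.subset_insert v S).trans hSU
    refine Finset.mem_biUnion.2 ⟨U, ?_, Finset.mem_biUnion.2 ⟨S, ?_, ?_⟩⟩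
    · refine Finset.mem_image.2 ⟨U.erase v, ?_, Finset.insert_erase hvU⟩
      rw [Finset.mem_powersetCard, Finset.card_erase_of_mem hvU, hUcard]
      exact ⟨Finset.subset_univ _, rfl⟩
    · exact Finset.mem_powersetCard.2 ⟨hSU', hSl⟩
    · refine Finset.mem_image.2 ⟨B \ U, ?_, Finset.union_sdiff_of_subset hUB⟩
      rw [hlow, Finset.mem_filter, Finset.mem_powersetCard]
      refine ⟨⟨Finset.subset_univ _, ?_⟩, ?_⟩
      · rw [Finset.card_sdiff_of_subset hUB, hBcard, hUcard]
      · have h1 : (((link H S).filter fun R => R ⊆ B \ U).card : ℝ) ≤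
            ((H.filter fun e => S ⊆ e ∧ e ⊆ B).card : ℝ) := by
          exact_mod_cast card_link_filter_le hSB Finset.sdiff_subset
        rw [hBcard] at hSlow
        exact h1.trans_lt (hSlow.trans_le hd)
  have h𝒰card : (𝒰.card : ℝ) ≤ (n : ℝ) ^ l := by
    have h1 : 𝒰.card ≤ n.choose l := by
      refine Finset.card_image_le.trans ?_
      rw [Finset.card_powersetCard, Finset.card_univ, Fintype.card_fin]
    exact_mod_cast h1.trans (Nat.choose_le_pow n l)
  have h𝒰mem : ∀ U ∈ 𝒰, U.card ≤ l + 1 := by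
    intro U hU
    obtain ⟨U', hU', rfl⟩ := Finset.mem_image.1 hU
    rw [← (Finset.mem_powersetCard.1 hU').2]
    exact Finset.card_insert_le v U'
  have h1 := (Finset.card_le_card hcov).trans Finset.card_biUnion_le
  calc (((Finset.univ.powersetCard s).filter fun B => v ∈ B ∧ ¬ IsRich H k l d B).card : ℝ)
      ≤ ∑ U ∈ 𝒰, (((U.powersetCard l).biUnion fun S =>
        (low S).image fun D => U ∪ D).card : ℝ) := by exact_mod_cast h1
    _ ≤ ∑ _U ∈ 𝒰, (l + 1) * L := by
        refine Finset.sum_le_sum fun U hU => ?_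
        have h2 : (((U.powersetCard l).biUnion fun S =>
            (low S).image fun D => U ∪ D).card : ℝ) ≤
            ∑ S ∈ U.powersetCard l, ((low S).card : ℝ) := by
          have h3 : ((U.powersetCard l).biUnion fun S => (low S).image fun D => U ∪ D).card ≤
              ∑ S ∈ U.powersetCard l, (low S).card :=
            Finset.card_biUnion_le.trans (Finset.sum_le_sum fun S _ => Finset.card_image_le)
          exact_mod_cast h3
        refine h2.trans ((Finset.sum_le_card_nsmul _ _ L fun S hS =>
          hL S (Finset.mem_powersetCard.1 hS).2).trans ?_)
        rw [nsmul_eq_mul, Finset.card_powersetCard]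
        refine mul_le_mul_of_nonneg_right ?_ hL0
        have h4 : U.card.choose l ≤ l + 1 :=
          (Nat.choose_le_choose l (h𝒰mem U hU)).trans (by rw [Nat.choose_succ_self_right])
        exact_mod_cast h4
    _ ≤ _ := by
        rw [Finset.sum_const, nsmul_eq_mul]
        gcongr

end PoorBlocks

lemma le_mul_choose_sub {d d' : ℝ} (hd' : 0 ≤ d') {a r s : ℕ} (hs : a + r ≤ s) (hr : 1 ≤ r)
    (h : d' * ((a + r) * r) ≤ (d' - d) * s) :
    d * s.choose r ≤ d' * (s - a).choose r := by
  have hs0 : (0 : ℝ) < s := by exact_mod_cast (by omega : 0 < s)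
  have h1 : ((s - (a + r) : ℕ) : ℝ) ^ r ≤ (s - a).descFactorial r := by
    have h2 := Nat.pow_sub_le_descFactorial (s - a) r
    have h3 : (s - (a + r)) ^ r ≤ (s - a + 1 - r) ^ r := Nat.pow_le_pow_left (by omega) r
    exact_mod_cast h3.trans h2
  rw [Nat.cast_sub hs] at h1
  push_cast at h1
  have har : ((a : ℝ) + r) / s ≤ 1 := by
    rw [div_le_one hs0]
    exact_mod_cast hs
  have h4 := one_add_mul_le_pow (a := -(((a : ℝ) + r) / s)) (by linarith) r
  have h5 : (s : ℝ) ^ r * (1 + -(((a : ℝ) + r) / s)) ^ r = (s - (a + r)) ^ r := by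
    rw [← mul_pow]
    congr 1
    field_simp
    ring
  have h6 : d ≤ d' * (1 + r * -(((a : ℝ) + r) / s)) := by
    have : d' * ((a + r) * r) / s ≤ d' - d := by
      rw [div_le_iff₀ hs0]
      exact h
    have h7 : d' * (1 + r * -(((a : ℝ) + r) / s)) = d' - d' * ((a + r) * r) / s := by ring
    linarith
  have hdf : ∀ N : ℕ, (N.descFactorial r : ℝ) = r.factorial * N.choose r := fun N => by
    exact_mod_cast Nat.descFactorial_eq_factorial_mul_choose N r
  have hle : (s.descFactorial r : ℝ) ≤ (s : ℝ) ^ r := by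
    exact_mod_cast Nat.descFactorial_le_pow s r
  have hfac : (0 : ℝ) < r.factorial := by exact_mod_cast r.factorial_pos
  have hkey : d * s.descFactorial r ≤ d' * (s - a).descFactorial r := by
    rcases le_or_gt d 0 with hd0 | hd0
    · exact (mul_nonpos_of_nonpos_of_nonneg hd0 (by positivity)).trans (by positivity)
    calc d * s.descFactorial r ≤ d * (s : ℝ) ^ r := by gcongr
      _ ≤ d' * (1 + r * -(((a : ℝ) + r) / s)) * (s : ℝ) ^ r := by gcongr
      _ ≤ d' * (1 + -(((a : ℝ) + r) / s)) ^ r * (s : ℝ) ^ r := by gcongr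
      _ = d' * (s - (a + r)) ^ r := by
          rw [← h5]
          ring
      _ ≤ _ := by gcongr
  rw [hdf, hdf] at hkey
  refine le_of_mul_le_mul_left ?_ hfac
  linarith

open Filter Topology in
lemma eventually_pow_mul_exp_le (a : ℕ) {c K : ℝ} (hc : 0 < c) :
    ∀ᶠ s : ℕ in atTop, K * ((s : ℝ) ^ a * Real.exp (-(c * ((s - a : ℕ) : ℝ)))) ≤ 1 := by
  have h1 : Tendsto (fun s : ℕ => ((s : ℝ) ^ a * Real.exp (-c * s))) atTop (𝓝 0) := by
    have h2 := (isLittleO_pow_exp_pos_mul_atTop a hc).tendsto_div_nhds_zero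
    have h3 := h2.comp tendsto_natCast_atTop_atTop
    refine h3.congr fun s => ?_
    simp only [Function.comp]
    rw [neg_mul, Real.exp_neg, div_eq_mul_inv]
  have h2 : Tendsto (fun s : ℕ => K * Real.exp (c * a) * ((s : ℝ) ^ a * Real.exp (-c * s))) atTop
      (𝓝 0) := by
    simpa using h1.const_mul (K * Real.exp (c * a))
  filter_upwards [h2.eventually_le_const zero_lt_one, eventually_ge_atTop a] with s hs hsa
  refine le_trans (le_of_eq ?_) hs
  rw [Nat.cast_sub hsa]
  have : -(c * ((s : ℝ) - a)) = c * a + -c * s := by ring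
  rw [this, Real.exp_add]
  ring

open Classical Filter in
/-- In a hypergraph of large minimum degree, the sets of size `s` inheriting the degree condition
are overwhelmingly many, even among those containing a given vertex. -/
lemma eventually_card_not_isRich_le {k l : ℕ} (hlk : l < k) {δ ε : ℝ} (hδ : 0 ≤ δ)
    (hε : 0 < ε) :
    ∀ᶠ s : ℕ in atTop, ∀ᶠ n : ℕ in atTop, ∀ H : Finset (Finset (Fin n)), (∀ e ∈ H, e.card = k) →
      (∀ S : Finset (Fin n), S.card = l → (δ + ε) * (n.choose (k - l) : ℝ) ≤ (hDeg H S : ℝ)) →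
      ∀ v : Fin n, 16 * n * (((Finset.univ.powersetCard s).filter
        fun B => v ∈ B ∧ ¬ IsRich H k l (δ + ε / 2) B).card : ℝ) ≤ n.choose s := by
  set r := k - l with hr
  have hr1 : 1 ≤ r := by omega
  have hr0 : (0 : ℝ) < r := by exact_mod_cast hr1
  set c : ℝ := (ε / 4) ^ 2 / (4 ^ (r + 2) * r ^ 2) with hc
  have hc0 : 0 < c := by positivity
  have hlin : ∀ᶠ s : ℕ in atTop, (δ + 3 * ε / 4) * ((((l + 1 : ℕ) : ℝ) + r) * r) ≤
      ((δ + 3 * ε / 4) - (δ + ε / 2)) * s := by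
    have : Tendsto (fun s : ℕ => ((δ + 3 * ε / 4) - (δ + ε / 2)) * (s : ℝ)) atTop atTop :=
      tendsto_natCast_atTop_atTop.const_mul_atTop (by linarith)
    exact this.eventually_ge_atTop _
  filter_upwards [hlin, eventually_pow_mul_exp_le (l + 1) (K := 32 * (l + 1)) hc0,
    eventually_ge_atTop (l + 1 + 2 * r)] with s hs1 hs2 hs3
  have hlin2 : ∀ᶠ n : ℕ in atTop, 2 * (r : ℝ) ^ 2 ≤ ε / 4 * n := by
    have : Tendsto (fun n : ℕ => ε / 4 * (n : ℝ)) atTop atTop :=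
      tendsto_natCast_atTop_atTop.const_mul_atTop (by linarith)
    exact this.eventually_ge_atTop _
  filter_upwards [hlin2, eventually_ge_atTop r, eventually_ge_atTop s,
    eventually_ge_atTop (2 * s ^ 2)] with n hn1 hn2 hn3 hn4 H hH hdeg v
  set q := s - (l + 1) with hq
  have hs0 : 1 ≤ s := by omega
  have hn0 : (0 : ℝ) < n := by exact_mod_cast (by omega : 0 < n)
  set L : ℝ := (n : ℝ) ^ q * Real.exp (-(c * q)) / q.factorial with hLdef
  have hbad := card_not_isRich_le (H := H) (k := k) (l := l) (d := δ + ε / 2)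
    (d' := δ + 3 * ε / 4) (s := s) (L := L) (by positivity) (by omega)
    (le_mul_choose_sub (by positivity) (by omega) hr1 hs1) (fun S hS => by
      rw [hLdef, le_div_iff₀ (by positivity)]
      refine card_sparse_mul_factorial_le hr1 (η := ε / 4) (by positivity) (by positivity)
        (by omega) hn2 hn1 (fun R hR => card_of_mem_link hH hS hR) ?_
      rw [card_link]
      refine le_trans (le_of_eq ?_) (hdeg S hS)
      ring) v
  have hfac : (s.factorial : ℝ) ≤ (s : ℝ) ^ (l + 1) * q.factorial := by
    have h1 := Nat.factorial_mul_descFactorial (by omega : l + 1 ≤ s)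
    have h2 : s.factorial ≤ s ^ (l + 1) * q.factorial := by
      rw [← h1, mul_comm]
      exact Nat.mul_le_mul_right _ (Nat.descFactorial_le_pow s (l + 1))
    exact_mod_cast h2
  have hchoose : (n : ℝ) ^ s / 2 ≤ s.factorial * n.choose s := by
    have h1 := one_sub_le_descFactorial_div (by omega : 1 ≤ n) hn3
    have h2 : (s : ℝ) ^ 2 / n ≤ 1 / 2 := by
      rw [div_le_iff₀ hn0]
      have : ((2 * s ^ 2 : ℕ) : ℝ) ≤ n := by exact_mod_cast hn4
      push_cast at this
      linarith
    rw [le_div_iff₀ (by positivity), Nat.descFactorial_eq_factorial_mul_choose] at h1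
    push_cast at h1
    refine le_trans ?_ h1
    rw [div_eq_mul_inv, mul_comm]
    gcongr
    linarith
  have hsf : (0 : ℝ) < s.factorial := by exact_mod_cast s.factorial_pos
  refine le_of_mul_le_mul_left ?_ hsf
  calc (s.factorial : ℝ) * (16 * n * (((Finset.univ.powersetCard s).filter
        fun B => v ∈ B ∧ ¬ IsRich H k l (δ + ε / 2) B).card : ℝ))
      ≤ ((s : ℝ) ^ (l + 1) * q.factorial) * (16 * n * ((n : ℝ) ^ l * ((l + 1) * L))) := by
        gcongr
    _ = 32 * (l + 1) * ((s : ℝ) ^ (l + 1) * Real.exp (-(c * q))) *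
          ((n : ℝ) ^ (l + 1) * (n : ℝ) ^ q / 2) := by
        rw [hLdef]
        field_simp
        ring
    _ ≤ 1 * ((n : ℝ) ^ (l + 1) * (n : ℝ) ^ q / 2) := by gcongr
    _ = (n : ℝ) ^ s / 2 := by
        rw [← pow_add, one_mul]
        congr 3
        omega
    _ ≤ _ := hchoose

section Dirac

variable {k l : ℕ}

lemma hDeg_le_choose {n : ℕ} {H : Finset (Finset (Fin n))} (hH : ∀ e ∈ H, e.card = k)
    {S : Finset (Fin n)} (hS : S.card = l) : hDeg H S ≤ n.choose (k - l) := by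
  have : link H S ⊆ Finset.univ.powersetCard (k - l) := fun R hR =>
    Finset.mem_powersetCard.2 ⟨Finset.subset_univ R, card_of_mem_link hH hS hR⟩
  have := Finset.card_le_card this
  rwa [card_link, Finset.card_powersetCard, Finset.card_univ, Fintype.card_fin] at this

lemma choose_succ_mem_diracT {n : ℕ} (hn : l ≤ n) :
    n.choose (k - l) + 1 ∈ {d : ℕ | ∀ H : Finset (Finset (Fin n)), (∀ e ∈ H, e.card = k) →
      (∀ S : Finset (Fin n), S.card = l → d ≤ hDeg H S) → ∃ M, HyperPM H M} := by
  intro H hH hdeg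
  obtain ⟨S, -, hS⟩ := Finset.exists_subset_card_eq
    (s := (Finset.univ : Finset (Fin n))) (n := l) (by simpa using hn)
  exact absurd ((hdeg S hS).trans (hDeg_le_choose hH hS)) (by omega)

lemma exists_hyperPM_of_diracT_le {n : ℕ} (hn : l ≤ n) {H : Finset (Finset (Fin n))}
    (hH : ∀ e ∈ H, e.card = k) (hdeg : ∀ S : Finset (Fin n), S.card = l → diracT n k l ≤ hDeg H S) :
    ∃ M, HyperPM H M :=
  Nat.sInf_mem ⟨_, choose_succ_mem_diracT hn⟩ H hH hdeg

open Filter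

lemma neBot_atTop_inf_principal_dvd (hk : 0 < k) : (atTop ⊓ 𝓟 {n : ℕ | k ∣ n}).NeBot := by
  rw [← frequently_mem_iff_neBot, frequently_atTop]
  intro a
  exact ⟨k * a, Nat.le_mul_of_pos_left a hk, dvd_mul_right k a⟩

lemma isBoundedUnder_diracT_div (hlk : l < k) :
    IsBoundedUnder (· ≤ ·) (atTop ⊓ 𝓟 {n : ℕ | k ∣ n})
      fun n : ℕ => (diracT n k l : ℝ) / (n.choose (k - l)) := by
  refine isBoundedUnder_of_eventually_le (a := 2) ?_
  refine Eventually.filter_mono inf_le_left ?_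
  filter_upwards [eventually_ge_atTop k] with n hn
  have h1 : diracT n k l ≤ n.choose (k - l) + 1 := Nat.sInf_le (choose_succ_mem_diracT (by omega))
  have h2 : 1 ≤ n.choose (k - l) := Nat.choose_pos (by omega)
  rw [div_le_iff₀ (by exact_mod_cast h2)]
  exact_mod_cast (by omega : diracT n k l ≤ 2 * n.choose (k - l))

lemma diracThreshold_nonneg (hlk : l < k) : 0 ≤ diracThreshold k l := by
  have := neBot_atTop_inf_principal_dvd (k := k) (by omega)
  exact le_limsup_of_frequently_le (Frequently.of_forall fun n => by positivity)
    (isBoundedUnder_diracT_div hlk)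

lemma eventually_exists_hyperPM (hlk : l < k) {ε : ℝ} (hε : 0 < ε) :
    ∀ᶠ s : ℕ in atTop, k ∣ s → ∀ H : Finset (Finset (Fin s)), (∀ e ∈ H, e.card = k) →
      (∀ S : Finset (Fin s), S.card = l →
        (diracThreshold k l + ε) * (s.choose (k - l) : ℝ) ≤ (hDeg H S : ℝ)) →
      ∃ M, HyperPM H M := by
  have h1 := eventually_lt_of_limsup_lt (lt_add_of_pos_right (diracThreshold k l) hε)
    (isBoundedUnder_diracT_div hlk)
  rw [eventually_inf_principal] at h1
  filter_upwards [h1, eventually_ge_atTop k] with s hs hsk hks H hH hdeg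
  refine exists_hyperPM_of_diracT_le (l := l) (by omega) hH fun S hS => ?_
  have h2 : (0 : ℝ) < s.choose (k - l) := by exact_mod_cast Nat.choose_pos (by omega)
  have h3 := (div_lt_iff₀ h2).1 (hs hks)
  exact_mod_cast h3.le.trans (hdeg S hS)

lemma IsRich.exists_matching {n : ℕ} {H : Finset (Finset (Fin n))} {d : ℝ} {B : Finset (Fin n)}
    {s : ℕ} (hs : B.card = s)
    (hH : ∀ e ∈ H, e.card = k) (hB : IsRich H k l d B)
    (hd : ∀ H' : Finset (Finset (Fin s)), (∀ e ∈ H', e.card = k) →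
      (∀ S : Finset (Fin s), S.card = l →
        d * (s.choose (k - l) : ℝ) ≤ (hDeg H' S : ℝ)) → ∃ M, HyperPM H' M) :
    ∃ M ⊆ H, (M : Set (Finset (Fin n))).PairwiseDisjoint id ∧ M.biUnion id = B := by
  set φ : Fin s ↪ Fin n := (B.orderEmbOfFin hs).toEmbedding with hφ
  have hφB : Finset.univ.map φ = B := Finset.map_orderEmbOfFin_univ B hs
  have hmapB : ∀ S : Finset (Fin s), S.map φ ⊆ B := fun S => by
    rw [← hφB]
    exact Finset.map_subset_map.2 (Finset.subset_univ S)
  obtain ⟨M, hMH, hMd, hMc⟩ := hd (Finset.univ.filter fun e => e.map φ ∈ H)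
    (fun e he => by
      rw [← Finset.card_map φ]
      exact hH _ (Finset.mem_filter.1 he).2) (fun S hS => by
      rw [IsRich, hs] at hB
      refine (hB (S.map φ) (hmapB S) (by rw [Finset.card_map, hS])).trans ?_
      have : (H.filter fun e => S.map φ ⊆ e ∧ e ⊆ B) ⊆
          ((Finset.univ.filter fun e : Finset (Fin s) => e.map φ ∈ H).filter
            fun e => S ⊆ e).image fun e => e.map φ := by
        intro e he
        obtain ⟨heH, hSe, heB⟩ := Finset.mem_filter.1 he
        rw [← hφB] at heB
        obtain ⟨e', -, rfl⟩ := Finset.subset_map_iff.1 heB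
        refine Finset.mem_image.2 ⟨e', ?_, rfl⟩
        simp only [Finset.mem_filter, Finset.mem_univ, true_and]
        exact ⟨heH, Finset.map_subset_map.1 hSe⟩
      exact_mod_cast (Finset.card_le_card this).trans Finset.card_image_le)
  refine ⟨M.image fun e => e.map φ, ?_, ?_, ?_⟩
  · intro e he
    obtain ⟨e', he', rfl⟩ := Finset.mem_image.1 he
    exact (Finset.mem_filter.1 (hMH he')).2
  · intro e he e' he' hne
    obtain ⟨f, hf, rfl⟩ := Finset.mem_image.1 (Finset.mem_coe.1 he)
    obtain ⟨f', hf', rfl⟩ := Finset.mem_image.1 (Finset.mem_coe.1 he')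
    have hne' : f ≠ f' := fun h => hne (by rw [h])
    exact (Finset.disjoint_map φ).2 (hMd hf hf' hne')
  · ext v
    rw [← hφB, ← hMc]
    simp only [Finset.mem_biUnion, Finset.mem_image, id, Finset.mem_map]
    constructor
    · rintro ⟨_, ⟨e, he, rfl⟩, hv⟩
      obtain ⟨x, hx, rfl⟩ := Finset.mem_map.1 hv
      exact ⟨x, ⟨e, he, hx⟩, rfl⟩
    · rintro ⟨x, ⟨e, he, hx⟩, rfl⟩
      exact ⟨_, ⟨e, he, rfl⟩, Finset.mem_map_of_mem φ hx⟩

end Dirac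

/-- Unions of matchings inside the blocks of vertex-spread partitions are spread. -/
lemma card_filter_subset_matching_le {n m k : ℕ} {H : Finset (Finset (Fin n))}
    (hH : ∀ e ∈ H, e.card = k) {I : Finset (Fin n → Fin m)}
    {M : (Fin n → Fin m) → Finset (Finset (Fin n))} {ρ : ℝ} (hρ : 0 ≤ ρ)
    (hM : ∀ f ∈ I, HyperPM H (M f)) (hmono : ∀ f ∈ I, ∀ e ∈ M f, ∃ j, ∀ v ∈ e, f v = j)
    (hI : ∀ (b : Fin n → Fin m) (Y : Finset (Fin n)),
      ((I.filter fun f => ∀ y ∈ Y, f y = b y).card : ℝ) ≤ ρ ^ Y.card * I.card)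
    (S : Finset (Finset (Fin n))) :
    ((I.filter fun f => S ⊆ M f).card : ℝ) ≤ (m * ρ ^ k) ^ S.card * I.card := by
  classical
  rcases (I.filter fun f => S ⊆ M f).eq_empty_or_nonempty with hemp | ⟨f₀, hf₀⟩
  · rw [hemp, Finset.card_empty, Nat.cast_zero]
    positivity
  obtain ⟨hf₀I, hSf₀⟩ := Finset.mem_filter.1 hf₀
  obtain ⟨hMH, hMd, -⟩ := hM f₀ hf₀I
  have hY : (S.biUnion id).card = k * S.card := by
    rw [Finset.card_biUnion fun e he e' he' hne => hMd (hSf₀ he) (hSf₀ he') hne,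
      Finset.sum_congr rfl fun e he => (hH e (hMH (hSf₀ he)) : (id e).card = k), Finset.sum_const, smul_eq_mul,
      mul_comm]
  set b : (S → Fin m) → Fin n → Fin m := fun c v =>
    if h : ∃ e : S, v ∈ e.1 then c h.choose else f₀ v with hb
  have hcov : (I.filter fun f => S ⊆ M f) ⊆ Finset.univ.biUnion fun c : S → Fin m =>
      I.filter fun f => ∀ y ∈ S.biUnion id, f y = b c y := by
    intro f hf
    obtain ⟨hfI, hSf⟩ := Finset.mem_filter.1 hf
    choose c hc using fun e : S => hmono f hfI e.1 (hSf e.2)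
    refine Finset.mem_biUnion.2 ⟨c, Finset.mem_univ c, Finset.mem_filter.2 ⟨hfI, fun y hy => ?_⟩⟩
    obtain ⟨e, he, hye⟩ := Finset.mem_biUnion.1 hy
    have hex : ∃ e : S, y ∈ e.1 := ⟨⟨e, he⟩, hye⟩
    simp only [hb, dif_pos hex]
    exact hc _ y hex.choose_spec
  have h1 : ((I.filter fun f => S ⊆ M f).card : ℝ) ≤ ∑ c : S → Fin m,
      ((I.filter fun f => ∀ y ∈ S.biUnion id, f y = b c y).card : ℝ) := by
    exact_mod_cast (Finset.card_le_card hcov).trans Finset.card_biUnion_le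
  refine h1.trans ((Finset.sum_le_sum fun c _ => hI (b c) _).trans (le_of_eq ?_))
  rw [Finset.sum_const, Finset.card_univ, hY]
  simp only [Fintype.card_fun, Fintype.card_fin, Fintype.card_coe, nsmul_eq_mul, Nat.cast_pow]
  rw [mul_pow, ← pow_mul]
  ring

open Filter in
/-- A hypergraph whose minimum degree exceeds the Dirac threshold supports a spread probability
distribution on its perfect matchings. -/
theorem exists_spread_perfect_matchings {k l : ℕ} (hlk : l < k) {ε : ℝ} (hε : 0 < ε) :
    ∃ K : ℝ, 0 < K ∧ ∀ᶠ n : ℕ in atTop, k ∣ n → ∀ H : Finset (Finset (Fin n)),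
      (∀ e ∈ H, e.card = k) →
      (∀ S : Finset (Fin n), S.card = l →
        (diracThreshold k l + ε) * (n.choose (k - l) : ℝ) ≤ (hDeg H S : ℝ)) →
      ∃ (ι : Type) (I : Finset ι) (w : ι → ℝ) (M : ι → Finset (Finset (Fin n))),
        (∀ i ∈ I, 0 ≤ w i) ∧ ∑ i ∈ I, w i = 1 ∧ (∀ i ∈ I, HyperPM H (M i)) ∧
          IsSpread I w M (K / (n : ℝ) ^ (k - 1)) := by
  classical
  obtain ⟨Q₀, hQ₀⟩ := eventually_atTop.1
    ((eventually_card_not_isRich_le hlk (diracThreshold_nonneg hlk) hε).and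
      (eventually_exists_hyperPM hlk (half_pos hε)))
  set Q := k * (Q₀ + 1) with hQdef
  have hQQ₀ : Q₀ + 1 ≤ Q := Nat.le_mul_of_pos_left _ (by omega)
  have hkQ : k ∣ Q := dvd_mul_right _ _
  have hQ0 : (0 : ℝ) < Q := by exact_mod_cast (by omega : 0 < Q)
  refine ⟨(12 * Q) ^ k, by positivity, ?_⟩
  have hall : ∀ᶠ n : ℕ in atTop, ∀ s ∈ Finset.Ico Q (2 * Q), _ :=
    (Filter.eventually_all_finset (Finset.Ico Q (2 * Q))).2 fun s hs =>
      (hQ₀ s (by have := (Finset.mem_Ico.1 hs).1; omega)).1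
  filter_upwards [hall, eventually_ge_atTop (2 * Q)] with n hn hnQ hkn H hH hdeg
  replace hn := fun s hs => hn s hs H hH hdeg
  have hn0 : (0 : ℝ) < n := by exact_mod_cast (by omega : 0 < n)
  set d := diracThreshold k l + ε / 2 with hd
  set m := n / Q with hm
  have hm1 : 1 ≤ m := (Nat.one_le_div_iff (by omega)).2 (by omega)
  have hmQ : m * Q ≤ n := Nat.div_mul_le_self n Q
  have : NeZero m := ⟨by omega⟩
  set s : Fin m → ℕ := fun j => if j = 0 then Q + n % Q else Q with hs
  have hmod : n % Q < Q := Nat.mod_lt _ (by omega)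
  have hsIco : ∀ j, s j ∈ Finset.Ico Q (2 * Q) := fun j => by
    rw [Finset.mem_Ico]
    simp only [hs]
    split_ifs <;> omega
  have hsk : ∀ j, k ∣ s j := fun j => by
    simp only [hs]
    split_ifs
    · exact dvd_add hkQ ((Nat.dvd_mod_iff hkQ).2 hkn)
    · exact hkQ
  have hssum : ∑ j, s j = n := by
    have h1 : ∀ j, s j = Q + if j = 0 then n % Q else 0 := fun j => by
      simp only [hs]
      split_ifs <;> simp
    rw [Finset.sum_congr rfl fun j _ => h1 j, Finset.sum_add_distrib, Finset.sum_ite_eq']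
    simp only [Finset.sum_const, Finset.card_univ, Fintype.card_fin, smul_eq_mul,
      Finset.mem_univ, if_true]
    exact Nat.div_add_mod' n Q
  set 𝓐 : Finset (Fin m × Finset (Fin n)) :=
    Finset.univ.filter fun p => p.2.card = s p.1 ∧ ¬ IsRich H k l d p.2 with h𝓐
  have hcell : ∀ (j : Fin m) (x : Fin n), ∑ p ∈ 𝓐 with p.1 = j ∧ x ∈ p.2,
      (n.choose (s p.1) : ℝ)⁻¹ ≤ 1 / (16 * n) := by
    intro j x
    have hch : (0 : ℝ) < n.choose (s j) := by
      have := Finset.mem_Ico.1 (hsIco j)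
      exact_mod_cast Nat.choose_pos (by omega)
    have h1 : (𝓐.filter fun p => p.1 = j ∧ x ∈ p.2).card ≤
        ((Finset.univ.powersetCard (s j)).filter fun B => x ∈ B ∧ ¬ IsRich H k l d B).card := by
      refine Finset.card_le_card_of_injOn Prod.snd ?_ ?_
      · rintro ⟨j', B⟩ hp
        simp only [h𝓐, Finset.coe_filter, Finset.mem_filter, Finset.mem_univ, true_and,
          Set.mem_ofPred_eq] at hp
        obtain ⟨⟨hB1, hB2⟩, rfl, hx⟩ := hp
        simp [hB1, hB2, hx]
      · rintro ⟨j', B⟩ hp ⟨j'', B'⟩ hp' h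
        have e1 := (Finset.mem_filter.1 hp).2.1
        have e2 := (Finset.mem_filter.1 hp').2.1
        exact Prod.ext (e1.trans e2.symm) h
    have h2 := hn (s j) (hsIco j) x
    have h3 : ∑ p ∈ 𝓐 with p.1 = j ∧ x ∈ p.2, (n.choose (s p.1) : ℝ)⁻¹ =
        ((𝓐.filter fun p => p.1 = j ∧ x ∈ p.2).card : ℝ) * (n.choose (s j) : ℝ)⁻¹ := by
      rw [← nsmul_eq_mul, ← Finset.sum_const]
      refine Finset.sum_congr rfl fun p hp => ?_
      rw [(Finset.mem_filter.1 hp).2.1]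
    rw [h3, ← div_eq_mul_inv, div_le_div_iff₀ hch (by positivity), one_mul]
    refine le_trans ?_ h2
    rw [mul_comm]
    gcongr
  have hspread := avoidingColorings_spread (V := Fin n) (s := s) (Q := 2 * Q) (𝓐 := 𝓐)
    (by omega) (fun j => by have := Finset.mem_Ico.1 (hsIco j); omega)
    (fun j => (Finset.mem_Ico.1 (hsIco j)).2.le) (by rw [hssum, Fintype.card_fin])
    (fun p hp => (Finset.mem_filter.1 hp).2.1) (fun j => by
      rw [Fintype.card_fin]
      have hsub : 𝓐.filter (fun p => p.1 = j) ⊆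
          Finset.univ.biUnion fun x => 𝓐.filter fun p => p.1 = j ∧ x ∈ p.2 := by
        intro p hp
        obtain ⟨hp1, hp2⟩ := Finset.mem_filter.1 hp
        have hpc := (Finset.mem_filter.1 hp1).2.1
        have := Finset.mem_Ico.1 (hsIco p.1)
        obtain ⟨x, hx⟩ := Finset.card_pos.1 (by omega : 0 < p.2.card)
        exact Finset.mem_biUnion.2 ⟨x, Finset.mem_univ x, Finset.mem_filter.2 ⟨hp1, hp2, hx⟩⟩
      calc ∑ p ∈ 𝓐 with p.1 = j, (n.choose (s p.1) : ℝ)⁻¹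
          ≤ ∑ p ∈ Finset.univ.biUnion fun x => 𝓐.filter fun p => p.1 = j ∧ x ∈ p.2,
              (n.choose (s p.1) : ℝ)⁻¹ :=
            Finset.sum_le_sum_of_subset_of_nonneg hsub fun _ _ _ => by positivity
        _ ≤ ∑ x, ∑ p ∈ 𝓐 with p.1 = j ∧ x ∈ p.2, (n.choose (s p.1) : ℝ)⁻¹ :=
            sum_biUnion_le_sum_sum _ _ fun _ => by positivity
        _ ≤ ∑ _x : Fin n, 1 / (16 * (n : ℝ)) := Finset.sum_le_sum fun x _ => hcell j x
        _ = 1 / 16 := by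
            rw [Finset.sum_const, Finset.card_univ, Fintype.card_fin, nsmul_eq_mul]
            field_simp
        _ ≤ 1 / 8 := by norm_num) (fun x => by
      rw [Fintype.card_fin]
      have hsub : 𝓐.filter (fun p => x ∈ p.2) ⊆
          Finset.univ.biUnion fun j => 𝓐.filter fun p => p.1 = j ∧ x ∈ p.2 := by
        intro p hp
        obtain ⟨hp1, hp2⟩ := Finset.mem_filter.1 hp
        exact Finset.mem_biUnion.2 ⟨p.1, Finset.mem_univ _, Finset.mem_filter.2 ⟨hp1, rfl, hp2⟩⟩
      calc ∑ p ∈ 𝓐 with x ∈ p.2, (n.choose (s p.1) : ℝ)⁻¹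
          ≤ ∑ p ∈ Finset.univ.biUnion fun j => 𝓐.filter fun p => p.1 = j ∧ x ∈ p.2,
              (n.choose (s p.1) : ℝ)⁻¹ :=
            Finset.sum_le_sum_of_subset_of_nonneg hsub fun _ _ _ => by positivity
        _ ≤ ∑ j, ∑ p ∈ 𝓐 with p.1 = j ∧ x ∈ p.2, (n.choose (s p.1) : ℝ)⁻¹ :=
            sum_biUnion_le_sum_sum _ _ fun _ => by positivity
        _ ≤ ∑ _j : Fin m, 1 / (16 * (n : ℝ)) := Finset.sum_le_sum fun j _ => hcell j x
        _ = m / (16 * n) := by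
            rw [Finset.sum_const, Finset.card_univ, Fintype.card_fin, nsmul_eq_mul]
            ring
        _ ≤ 1 / (8 * ((2 * Q : ℕ) : ℝ)) := by
            have hmQ' : (m : ℝ) * Q ≤ n := by exact_mod_cast hmQ
            push_cast
            rw [div_le_div_iff₀ (by positivity) (by positivity)]
            linarith)
  set I := avoidingColorings s (fun _ => 0) ∅ 𝓐 with hIdef
  have hIne : I.Nonempty := (hspread fun _ => 0).1
  have hI : ∀ (b : Fin n → Fin m) (Y : Finset (Fin n)),
      ((I.filter fun f => ∀ y ∈ Y, f y = b y).card : ℝ) ≤ (12 * Q / n) ^ Y.card * I.card := by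
    intro b Y
    have h1 := (hspread b).2 Y
    rw [avoidingColorings_empty_eq s b (fun _ => 0), Fintype.card_fin] at h1
    have h2 : I.filter (fun f => ∀ y ∈ Y, f y = b y) ⊆ avoidingColorings s b Y 𝓐 := by
      intro f hf
      obtain ⟨hfI, hfY⟩ := Finset.mem_filter.1 hf
      have := mem_avoidingColorings.1 hfI
      exact mem_avoidingColorings.2 ⟨this.1, hfY, this.2.2⟩
    have h3 : ((I.filter fun f => ∀ y ∈ Y, f y = b y).card : ℝ) ≤
        (avoidingColorings s b Y 𝓐).card := by exact_mod_cast Finset.card_le_card h2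
    have h4 : 6 * ((2 * Q : ℕ) : ℝ) / n = 12 * Q / n := by
      push_cast
      ring
    rw [h4] at h1
    exact h3.trans h1
  have hmatch : ∀ f ∈ I, ∃ M, HyperPM H M ∧ ∀ e ∈ M, ∃ j, ∀ v ∈ e, f v = j := by
    intro f hf
    obtain ⟨hfc, -, hfA⟩ := mem_avoidingColorings.1 hf
    have hblock : ∀ j, ∃ M ⊆ H, (M : Set (Finset (Fin n))).PairwiseDisjoint id ∧
        M.biUnion id = Finset.univ.filter fun v => f v = j := by
      intro j
      have hrich : IsRich H k l d (Finset.univ.filter fun v => f v = j) := by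
        by_contra hnot
        obtain ⟨x, hx, hxj⟩ := hfA (j, Finset.univ.filter fun v => f v = j)
          (Finset.mem_filter.2 ⟨Finset.mem_univ _, hfc j, hnot⟩)
        exact hxj (Finset.mem_filter.1 hx).2
      refine hrich.exists_matching (hfc j) hH ?_
      refine (hQ₀ (s j) ?_).2 (hsk j)
      have := Finset.mem_Ico.1 (hsIco j)
      omega
    choose M hMH hMd hMc using hblock
    have hmem : ∀ j, ∀ e ∈ M j, ∀ v ∈ e, f v = j := fun j e he v hv => by
      have : v ∈ (M j).biUnion id := Finset.mem_biUnion.2 ⟨e, he, hv⟩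
      rw [hMc j] at this
      exact (Finset.mem_filter.1 this).2
    refine ⟨Finset.univ.biUnion M, ⟨?_, ?_, ?_⟩, ?_⟩
    · exact Finset.biUnion_subset.2 fun j _ => hMH j
    · intro e he e' he' hne
      obtain ⟨j, -, hej⟩ := Finset.mem_biUnion.1 (Finset.mem_coe.1 he)
      obtain ⟨j', -, hej'⟩ := Finset.mem_biUnion.1 (Finset.mem_coe.1 he')
      by_cases hjj : j = j'
      · subst hjj
        exact hMd j hej hej' hne
      · refine Finset.disjoint_left.2 fun v hv hv' => hjj ?_
        rw [← hmem j e hej v hv, ← hmem j' e' hej' v hv']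
    · refine Finset.eq_univ_of_forall fun v => ?_
      have hv : v ∈ (M (f v)).biUnion id := by
        rw [hMc (f v)]
        simp
      obtain ⟨e, he, hve⟩ := Finset.mem_biUnion.1 hv
      exact Finset.mem_biUnion.2 ⟨e, Finset.mem_biUnion.2 ⟨f v, Finset.mem_univ _, he⟩, hve⟩
    · intro e he
      obtain ⟨j, -, hej⟩ := Finset.mem_biUnion.1 he
      exact ⟨j, hmem j e hej⟩
  choose! M hM hmono using hmatch
  have hI0 : (0 : ℝ) < I.card := by exact_mod_cast hIne.card_pos
  refine ⟨Fin n → Fin m, I, fun _ => (I.card : ℝ)⁻¹, M, fun _ _ => by positivity, ?_, hM, ?_⟩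
  · rw [Finset.sum_const, nsmul_eq_mul, mul_inv_cancel₀ hI0.ne']
  · intro S
    rw [Finset.sum_const, nsmul_eq_mul, ← div_eq_mul_inv, div_le_iff₀ hI0]
    refine (card_filter_subset_matching_le hH (by positivity) hM hmono hI S).trans ?_
    gcongr
    have hmn : (m : ℝ) ≤ n := by exact_mod_cast Nat.div_le_self n Q
    calc (m : ℝ) * (12 * Q / n) ^ k ≤ n * (12 * Q / n) ^ k := by gcongr
      _ = (12 * Q) ^ k / (n : ℝ) ^ (k - 1) := by
          rw [div_pow, ← mul_pow_sub_one (by omega : k ≠ 0) (n : ℝ)]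
          field_simp

lemma HyperPM.card_le {n k : ℕ} (hk : 1 ≤ k) {H M : Finset (Finset (Fin n))}
    (hH : ∀ e ∈ H, e.card = k) (hM : HyperPM H M) : M.card ≤ n := by
  have h1 : (M.biUnion id).card = ∑ e ∈ M, e.card :=
    Finset.card_biUnion fun e he e' he' hne => hM.2.1 he he' hne
  rw [hM.2.2, Finset.card_univ, Fintype.card_fin] at h1
  refine le_trans ?_ h1.ge
  rw [Finset.card_eq_sum_ones]
  exact Finset.sum_le_sum fun e he => by rw [hH e (hM.1 he)]; exact hk

lemma natCast_clog_two_le {n : ℕ} (hn : 1 ≤ Real.log n) : (Nat.clog 2 n : ℝ) ≤ 3 * Real.log n := by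
  have hn0 : n ≠ 0 := by
    rintro rfl
    norm_num at hn
  have h1 : (Nat.clog 2 n : ℝ) ≤ Nat.log 2 n + 1 := by
    exact_mod_cast Nat.clog_le_of_le_pow (Nat.lt_pow_succ_log_self one_lt_two n).le
  have h2 : (Nat.log 2 n : ℝ) * Real.log 2 ≤ Real.log n := by
    rw [← Real.log_pow]
    refine Real.log_le_log (by positivity) ?_
    exact_mod_cast Nat.pow_log_le_self 2 hn0
  have h3 := Real.log_two_gt_d9
  have h4 : (0 : ℝ) ≤ Nat.log 2 n := Nat.cast_nonneg _
  nlinarith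

/-- Robust Dirac thresholds for perfect matchings in hypergraphs: for `1 ≤ ℓ < k` and `ε > 0`
there is `C > 0` such that for every `γ > 0`, for all sufficiently large `n` divisible by `k`,
every `n`-vertex `k`-uniform hypergraph `𝓗` with `δ_ℓ(𝓗) ≥ (δ⁺_{ℓ,k} + ε)·C(n,k-ℓ)` is such that
`𝓗(C log n / n^{k-1})` contains a perfect matching with probability at least `1 - γ`. -/
theorem statement0 :
    ∀ k l : ℕ, 1 ≤ l → l < k → ∀ ε : ℝ, 0 < ε →
    ∃ C : ℝ, 0 < C ∧ ∀ γ : ℝ, 0 < γ →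
    ∃ n₀ : ℕ, ∀ n : ℕ, n₀ ≤ n → k ∣ n →
    ∀ H : Finset (Finset (Fin n)), (∀ e ∈ H, e.card = k) →
    (∀ S : Finset (Fin n), S.card = l →
      (diracThreshold k l + ε) * (n.choose (k - l) : ℝ) ≤ (hDeg H S : ℝ)) →
    1 - γ ≤ edgeProb H (C * Real.log n / (n : ℝ) ^ (k - 1))
      (fun E' => ∃ M, HyperPM E' M) := by
  intro k l hl hlk ε hε
  obtain ⟨K, hK, hspread⟩ := exists_spread_perfect_matchings hlk hε
  refine ⟨49 * K, by positivity, fun γ hγ => ?_⟩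
  obtain ⟨s₁, hs₁⟩ := exists_pow_lt_of_lt_one (by positivity : 0 < γ / 4)
    (by norm_num : (1 / 4 : ℝ) < 1)
  set s₀ := s₁ + 1 with hs₀
  have hs₀γ : 2 * (1 / 4 : ℝ) ^ s₀ ≤ γ / 2 := by
    rw [hs₀, pow_succ]
    have : (0 : ℝ) < (1 / 4) ^ s₁ := by positivity
    linarith
  have hlog : Filter.Tendsto (fun n : ℕ => Real.log n) Filter.atTop Filter.atTop :=
    Real.tendsto_log_atTop.comp tendsto_natCast_atTop_atTop
  have hlim : ∀ᶠ n : ℕ in Filter.atTop, (1 + 1 / Real.log n) ^ s₀ ≤ 1 + γ / 2 := by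
    have h1 : Filter.Tendsto (fun n : ℕ => (1 + 1 / Real.log n) ^ s₀) Filter.atTop
        (nhds ((1 + 0) ^ s₀)) := by
      simp only [one_div]
      exact (tendsto_const_nhds.add hlog.inv_tendsto_atTop).pow s₀
    refine h1.eventually_le_const ?_
    simp [hγ]
  have hsmall : ∀ᶠ n : ℕ in Filter.atTop, 49 * K * (Real.log n / n) ≤ 1 := by
    have h1 : Filter.Tendsto (fun n : ℕ => 49 * K * (Real.log n / n)) Filter.atTop
        (nhds (49 * K * 0)) :=
      (Real.isLittleO_log_id_atTop.tendsto_div_nhds_zero.comp tendsto_natCast_atTop_atTop).const_mul _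
    refine h1.eventually_le_const ?_
    simp
  rw [← Filter.eventually_atTop]
  filter_upwards [hspread, hlim, hsmall, hlog.eventually_ge_atTop 1, Filter.eventually_ge_atTop 1]
    with n hn hlim hsmall hlog hn1 hkn H hH hdeg
  obtain ⟨ι, I, w, M, hw, hw1, hM, hsp⟩ := hn hkn H hH hdeg
  have hn0 : (1 : ℝ) ≤ n := by exact_mod_cast hn1
  have hnk : (n : ℝ) ≤ (n : ℝ) ^ (k - 1) := le_self_pow₀ hn0 (by omega)
  set q := K / (n : ℝ) ^ (k - 1) with hq
  have hq0 : 0 < q := by positivity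
  have hp : 49 * K * Real.log n / (n : ℝ) ^ (k - 1) = 49 * (q * Real.log n) := by
    rw [hq]
    ring
  have hp1 : 49 * (q * Real.log n) ≤ 1 := by
    rw [← hp]
    refine le_trans ?_ hsmall
    rw [mul_div_assoc]
    gcongr
  have hqlog : q ≤ q * Real.log n := le_mul_of_one_le_right hq0.le hlog
  have hclog := natCast_clog_two_le hlog
  have hmain := hsp.le_edgeProb (E := H) (a := q * Real.log n) (p := 49 * (q * Real.log n))
    (s₀ := s₀) (m := Nat.clog 2 n) hq0 (by linarith) (by positivity) (by linarith) (by omega)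
    hw hw1 (fun i hi => (hM i hi).1) (fun i hi => by
      refine ((hM i hi).card_le (by omega) hH).trans ?_
      exact (Nat.le_pow_clog one_lt_two n).trans (Nat.le_mul_of_pos_left _ (by omega)))
    (by nlinarith) hp1
  have hqa : q / (q * Real.log n) = 1 / Real.log n := by
    field_simp
  rw [hqa] at hmain
  rw [hp]
  refine le_trans (by linarith) (hmain.trans (edgeProb_mono (by positivity) hp1 ?_))
  rintro W ⟨i, hi, hiW⟩
  exact ⟨M i, hiW, (hM i hi).2⟩
end

section
/- For every integer r ≥ 2 and every d > 0 there exist ε₀ > 0 and, for each ε ∈ (0, ε₀], constants C = C(d,ε,r) and n₀ such that the following holds for all n ≥ n₀. Let G be an r-partite graph with parts A₁,…,A_r, each of size n, such that for all i ≠ j the pair G[A_i,A_j] is (d_{i,j}, ε)-super-regular for some d_{i,j} ≥ d. Let 𝓗 be the r-uniform hypergraph on vertex set A₁ ∪ ⋯ ∪ A_r whose hyperedges are the vertex sets of the r-partite r-cliques of G (cliques with exactly one vertex in each part). Then there exists a (C/n^{r−1})-spread distribution on the set of perfect matchings of 𝓗 (ground set 𝓗). -/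
open Finset

variable {V : Type*} [Fintype V] [DecidableEq V]

/-- The number of neighbours of `v` in the set `B`. -/
def nbrCount (G : SimpleGraph V) [DecidableRel G.Adj] (v : V) (B : Finset V) : ℕ :=
  (B.filter (fun w => G.Adj v w)).card

/-- The edge density `d_G(A,B) = e_G(A,B)/(|A||B|)` between the vertex sets `A` and `B`. -/
noncomputable def pairDensity (G : SimpleGraph V) [DecidableRel G.Adj] (A B : Finset V) : ℝ :=
  (∑ v ∈ A, (nbrCount G v B : ℝ)) / ((A.card : ℝ) * (B.card : ℝ))

/-- The pair `(A,B)` is `(d,ε)`-regular in `G`: it has density `d`, and all pairs of subsets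
`X ⊆ A`, `Y ⊆ B` with `|X| ≥ ε|A|`, `|Y| ≥ ε|B|` have density within `ε` of `d`. -/
def IsRegularPair (G : SimpleGraph V) [DecidableRel G.Adj] (A B : Finset V) (d ε : ℝ) : Prop :=
  pairDensity G A B = d ∧
    ∀ X ⊆ A, ∀ Y ⊆ B, ε * A.card ≤ X.card → ε * B.card ≤ Y.card →
      |pairDensity G X Y - d| ≤ ε

/-- The pair `(A,B)` is `(d,ε,δ')`-super-regular in `G`: it is `(d,ε)`-regular and every vertex
of one side has at least `δ'` times the size of the other side many neighbours there. -/
def IsSuperRegular3 (G : SimpleGraph V) [DecidableRel G.Adj] (A B : Finset V)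
    (d ε δ' : ℝ) : Prop :=
  IsRegularPair G A B d ε ∧
    (∀ v ∈ A, δ' * B.card ≤ (nbrCount G v B : ℝ)) ∧
    (∀ v ∈ B, δ' * A.card ≤ (nbrCount G v A : ℝ))

/-- `(d,ε)`-super-regular means `(d,ε,d-ε)`-super-regular. -/
def IsSuperRegular (G : SimpleGraph V) [DecidableRel G.Adj] (A B : Finset V) (d ε : ℝ) : Prop :=
  IsSuperRegular3 G A B d ε (d - ε)

/-- `μ` is a `q`-spread probability distribution on the collection of finite subsets (of the
ground set of elements of type `α`) satisfying `Fam`. -/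
def IsSpreadDist {α : Type*} [Fintype α] [DecidableEq α] (q : ℝ)
    (Fam : Finset α → Prop) (μ : Finset α → ℝ) : Prop :=
  (∀ A, 0 ≤ μ A) ∧ (∑ A : Finset α, μ A = 1) ∧ (∀ A, μ A ≠ 0 → Fam A) ∧
    ∀ S : Finset α, ∑ A ∈ Finset.univ.filter (fun A : Finset α => S ⊆ A), μ A ≤ q ^ S.card

open Classical in
/-- The `r`-partite `r`-cliques of `G` with respect to the parts `A i`: cliques having exactly
one vertex in each part. -/
noncomputable def transvCliques {V : Type*} [Fintype V] [DecidableEq V] (G : SimpleGraph V)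
    {r : ℕ} (A : Fin r → Finset V) : Finset (Finset V) :=
  Finset.univ.filter (fun K : Finset V => G.IsClique ↑K ∧ ∀ i, (K ∩ A i).card = 1)

section Counting

open Classical

theorem partiteCount {X : Type*} [Fintype X] {δ e g : ℝ} (hδ : 0 < δ) (hδ1 : δ ≤ 1)
    (he : 0 ≤ e) (hg : 0 ≤ g) (k : ℕ) (hk : k * e ≤ g / 2)
    (E : Fin k → Fin k → X → X → Prop)
    (hE : ∀ a b, a < b → ∀ Y : Finset X, e ≤ #Y →
      (#{x | (#{y ∈ Y | E a b x y} : ℝ) < δ * #Y} : ℝ) ≤ e)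
    (U : Fin k → Finset X) (w : ℝ) (hw : 0 ≤ w) (hU : ∀ a, w ≤ #(U a)) (hgw : g ≤ δ ^ k * w) :
    (g / 2) ^ k ≤
      #{t : Fin k → X | (∀ a, t a ∈ U a) ∧ ∀ a b, a < b → E a b (t a) (t b)} := by
  induction k generalizing w with
  | zero => simp
  | succ k ih =>
    have hgw' : g ≤ w := hgw.trans (mul_le_of_le_one_left hw (pow_le_one₀ hδ.le hδ1))
    have hk0 : (0 : ℝ) ≤ k * e := by positivity
    push_cast at hk
    have hew : e ≤ w := by linarith
    set bad : Fin k → Finset X := fun b =>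
      {x | (#{y ∈ U b.succ | E 0 b.succ x y} : ℝ) < δ * #(U b.succ)} with hbad
    set good : Finset X := U 0 \ univ.biUnion bad with hgood
    have hbadcard : (#(univ.biUnion bad) : ℝ) ≤ k * e := by
      calc (#(univ.biUnion bad) : ℝ) ≤ ∑ b, (#(bad b) : ℝ) := by
            exact_mod_cast card_biUnion_le
        _ ≤ ∑ _b : Fin k, e := sum_le_sum fun b _ =>
            hE 0 b.succ (Fin.succ_pos b) _ (hew.trans (hU _))
        _ = k * e := by simp
    have hgoodcard : g / 2 ≤ #good := by
      have h1 : (#(U 0) : ℝ) ≤ #good + #(univ.biUnion bad) := by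
        exact_mod_cast card_le_card_sdiff_add_card
      have := hU 0
      linarith
    set T : X → Finset (Fin k → X) := fun x =>
      {t | (∀ a, t a ∈ {y ∈ U a.succ | E 0 a.succ x y}) ∧
        ∀ a b, a < b → E a.succ b.succ (t a) (t b)} with hT
    have hTcard : ∀ x ∈ good, (g / 2) ^ k ≤ #(T x) := by
      intro x hx
      refine ih (by linarith) (fun a b => E a.succ b.succ)
        (fun a b hab => hE _ _ (Fin.succ_lt_succ_iff.2 hab))
        (fun a => {y ∈ U a.succ | E 0 a.succ x y}) (δ * w) (by positivity) (fun a => ?_)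
        (by rw [← mul_assoc, ← pow_succ]; exact hgw)
      have hxa : x ∉ bad a := fun h =>
        (mem_sdiff.1 hx).2 (mem_biUnion.2 ⟨a, mem_univ _, h⟩)
      simp only [hbad, mem_filter, mem_univ, true_and, not_lt] at hxa
      exact (mul_le_mul_of_nonneg_left (hU _) hδ.le).trans hxa
    calc (g / 2) ^ (k + 1) = g / 2 * (g / 2) ^ k := pow_succ' _ _
      _ ≤ #good * (g / 2) ^ k := by gcongr
      _ = ∑ _x ∈ good, (g / 2) ^ k := by simp
      _ ≤ ∑ x ∈ good, (#(T x) : ℝ) := sum_le_sum hTcard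
      _ = #(good.sigma T) := by rw [card_sigma]; push_cast; rfl
      _ ≤ _ := by
        refine Nat.cast_le.2 (card_le_card_of_injOn
          (fun p => (Fin.cons p.1 p.2 : Fin (k + 1) → X)) ?_ ?_)
        · rintro ⟨x, t⟩ hp
          simp only [coe_sigma, Set.mem_sigma_iff, mem_coe, hT, mem_filter, mem_univ,
            true_and] at hp
          obtain ⟨hx, h1, h2⟩ := hp
          simp only [coe_filter, mem_univ, true_and, Set.mem_ofPred_eq]
          refine ⟨fun a => ?_, fun a b hab => ?_⟩
          · refine Fin.cases ?_ (fun a => ?_) a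
            · exact (mem_sdiff.1 hx).1
            · exact (h1 a).1
          · induction b using Fin.cases with
            | zero => simp at hab
            | succ b =>
              induction a using Fin.cases with
              | zero => exact (h1 b).2
              | succ a => exact h2 a b (Fin.succ_lt_succ_iff.1 hab)
        · rintro ⟨x, t⟩ _ ⟨x', t'⟩ _ h
          have h1 := congrFun h 0
          have h2 := fun a : Fin k => congrFun h a.succ
          simp only [Fin.cons_zero, Fin.cons_succ] at h1 h2
          subst h1
          rw [funext h2]

end Counting
section Switching

open Classical

/-- Bijective labellings of the parts `B i` by `Fin n`; the tuple `(σ i t)ᵢ` is the row `t`. -/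
abbrev Arrangement {r : ℕ} (n : ℕ) (B : Fin r → Type*) := ∀ i, Fin n ≃ B i

/-- The generators of `(ℤ/3)^r`; they form a Sidon set. -/
def shift {r : ℕ} (i : Fin r) : Fin r → ZMod 3 := Pi.single i 1

variable {r n : ℕ} {B : Fin r → Type*}

theorem shift_sidon {i j k l : Fin r} (hij : i ≠ j)
    (h : shift i - shift j = shift k - shift l) : i = k ∧ j = l := by
  have hi := congrFun h i
  have hj := congrFun h j
  simp only [shift, Pi.sub_apply, Pi.single_apply] at hi hj
  have h1 : i = k := by
    by_contra hik
    rw [if_true, if_neg hij, if_neg hik] at hi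
    split_ifs at hi <;> revert hi <;> decide
  refine ⟨h1, ?_⟩
  by_contra hjl
  rw [if_neg (Ne.symm hij), if_true, if_neg (h1 ▸ Ne.symm hij), if_neg hjl] at hj
  revert hj
  decide

theorem shift_ne_zero (i : Fin r) : shift i ≠ 0 := fun h => by
  have := congrFun h i
  simp [shift] at this

theorem shift_injective : Function.Injective (shift (r := r)) := fun i j h => by
  by_contra hij
  have := congrFun h i
  simp [shift, hij] at this

/-- Cyclically move entries between the rows `t a` so that the new row `t a` takes its `i`-th
entry from the old row `t (a + shift i)`. -/
noncomputable def shiftRows (t : (Fin r → ZMod 3) → Fin n) (σ : Arrangement n B) :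
    Arrangement n B := fun i =>
  if h : Function.Injective t then
    ((Equiv.addRight (shift i)).viaEmbedding ⟨t, h⟩).trans (σ i)
  else σ i

theorem shiftRows_apply {t : (Fin r → ZMod 3) → Fin n} (ht : Function.Injective t)
    (σ : Arrangement n B) (i : Fin r) (a : Fin r → ZMod 3) :
    shiftRows t σ i (t a) = σ i (t (a + shift i)) := by
  have := Equiv.Perm.viaEmbedding_apply (Equiv.addRight (shift i)) ⟨t, ht⟩ a
  simp only [Function.Embedding.coeFn_mk] at this
  simp [shiftRows, ht, this]

theorem shiftRows_of_notMem (t : (Fin r → ZMod 3) → Fin n)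
    (σ : Arrangement n B) (i : Fin r) {x : Fin n} (hx : x ∉ Set.range t) :
    shiftRows t σ i x = σ i x := by
  unfold shiftRows
  split_ifs with h
  · have := Equiv.Perm.viaEmbedding_apply_of_notMem (Equiv.addRight (shift i)) ⟨t, h⟩ x hx
    simp [this]
  · rfl

theorem shiftRows_injective (t : (Fin r → ZMod 3) → Fin n) :
    Function.Injective (shiftRows (B := B) t) := fun σ τ h => by
  funext i
  have hi := congrFun h i
  unfold shiftRows at hi
  split_ifs at hi with ht
  · ext x
    have := DFunLike.congr_fun hi
      (((Equiv.addRight (shift i)).viaEmbedding ⟨t, ht⟩ : Equiv.Perm (Fin n)).symm x)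
    simpa using this
  · exact hi

/-- The conditions that shifting imposes on the rows `x`, `y` placed at positions `a`, `b`. -/
def ShiftCompatible (R : ∀ i j, B i → B j → Prop) (σ : Arrangement n B)
    (a b : Fin r → ZMod 3) (x y : Fin n) : Prop :=
  ∀ c i j, i ≠ j → c + shift i = a → c + shift j = b → R i j (σ i x) (σ j y)

theorem shiftCompatible_cases (R : ∀ i j, B i → B j → Prop) (σ : Arrangement n B)
    (a b : Fin r → ZMod 3) :
    (∀ x y, ShiftCompatible R σ a b x y) ∨
      ∃ i j, i ≠ j ∧ ∀ x y, R i j (σ i x) (σ j y) → ShiftCompatible R σ a b x y := by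
  by_cases h : ∃ c i j, i ≠ j ∧ c + shift i = a ∧ c + shift j = b
  · obtain ⟨c, i, j, hij, ha, hb⟩ := h
    refine Or.inr ⟨i, j, hij, fun x y hxy c' i' j' hij' ha' hb' => ?_⟩
    have := shift_sidon hij (k := i') (l := j') (by
      rw [← add_sub_add_left_eq_sub _ _ c, ha, hb, ← ha', ← hb', add_sub_add_left_eq_sub])
    obtain ⟨rfl, rfl⟩ := this
    exact hxy
  · refine Or.inl fun x y c i j hij ha hb => (h ⟨c, i, j, hij, ha, hb⟩).elim

/-- Shifting along `t` turns the row `t₀` into a compatible one, uses no other row of `D`, and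
keeps the rows outside `D` compatible. -/
structure ValidShift (R : ∀ i j, B i → B j → Prop) (σ : Arrangement n B) (D : Finset (Fin n))
    (t₀ : Fin n) (t : (Fin r → ZMod 3) → Fin n) : Prop where
  injective : Function.Injective t
  zero : t 0 = t₀
  notMem : ∀ a ≠ 0, t a ∉ D
  compatible : ∀ a i j, i ≠ j → R i j (σ i (t (a + shift i))) (σ j (t (a + shift j)))

/-- Compatibility relations between the parts `B i` that are symmetric, have minimum degree
`2 * δ * n`, and have relative density at least `2 * δ` between all but `e` vertices and any set
of size at least `e`. -/
structure IsQuasirandom [∀ i, Fintype (B i)] (R : ∀ i j, B i → B j → Prop) (n : ℕ) (δ e : ℝ) :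
    Prop where
  symm : ∀ i j x y, R i j x y → R j i y x
  degree : ∀ i j, i ≠ j → ∀ x, 2 * δ * n ≤ (#{y | R i j x y} : ℝ)
  regular : ∀ i j, i ≠ j → ∀ Y : Finset (B j), e ≤ #Y →
    (#{x | (#{y ∈ Y | R i j x y} : ℝ) < 2 * δ * #Y} : ℝ) ≤ e

variable [∀ i, Fintype (B i)] {R : ∀ i j, B i → B j → Prop} {δ e g : ℝ}

theorem IsQuasirandom.regular_rows (hR : IsQuasirandom R n δ e) (σ : Arrangement n B)
    {i j : Fin r} (hij : i ≠ j) (Y : Finset (Fin n)) (hY : e ≤ #Y) :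
    (#{x | (#{y ∈ Y | R i j (σ i x) (σ j y)} : ℝ) < 2 * δ * #Y} : ℝ) ≤ e := by
  have h := hR.regular i j hij (Y.map (σ j).toEmbedding) (by simpa using hY)
  rw [← map_univ_equiv (σ i)] at h
  simpa only [filter_map, card_map, Function.comp_def, Equiv.coe_toEmbedding] using h

theorem IsQuasirandom.degree_rows (hR : IsQuasirandom R n δ e) (σ : Arrangement n B)
    {i j : Fin r} (hij : i ≠ j) (x : Fin n) :
    2 * δ * n ≤ (#{y | R i j (σ i x) (σ j y)} : ℝ) := by
  have h := hR.degree i j hij (σ i x)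
  rw [← map_univ_equiv (σ j)] at h
  simpa only [filter_map, card_map, Function.comp_def, Equiv.coe_toEmbedding] using h

theorem ShiftCompatible.symm (hR : IsQuasirandom R n δ e) {σ : Arrangement n B}
    {a b : Fin r → ZMod 3} {x y : Fin n} (h : ShiftCompatible R σ a b x y) :
    ShiftCompatible R σ b a y x := fun c i j hij ha hb =>
  hR.symm _ _ _ _ (h c j i hij.symm hb ha)

/-- The conditions for placing distinct rows `x`, `y` at positions `a`, `b`. -/
def ShiftAdmissible (R : ∀ i j, B i → B j → Prop) (σ : Arrangement n B)
    (a b : Fin r → ZMod 3) (x y : Fin n) : Prop :=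
  x ≠ y ∧ ShiftCompatible R σ a b x y

omit [∀ i, Fintype (B i)] in
theorem card_sub_one_le_card_shiftAdmissible (σ : Arrangement n B) (a b : Fin r → ZMod 3)
    (Y : Finset (Fin n)) (x : Fin n) :
    (#{y ∈ Y | ShiftCompatible R σ a b x y} : ℝ) - 1 ≤ #{y ∈ Y | ShiftAdmissible R σ a b x y} := by
  have h : {y ∈ Y | ShiftAdmissible R σ a b x y} =
      ({y ∈ Y | ShiftCompatible R σ a b x y} : Finset (Fin n)).erase x := by
    ext y
    simp only [mem_filter, mem_erase, ne_eq, ShiftAdmissible, eq_comm (a := x)]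
    tauto
  have h2 := pred_card_le_card_erase
    (s := ({y ∈ Y | ShiftCompatible R σ a b x y} : Finset (Fin n))) (a := x)
  rw [h, sub_le_iff_le_add]
  have h3 := Nat.le_add_of_sub_le h2
  exact_mod_cast h3

theorem IsQuasirandom.regular_shiftAdmissible (hR : IsQuasirandom R n δ e) (he : 0 ≤ e)
    (hδ : 0 < δ) (hδ2 : δ ≤ 1 / 2) (hδe : 1 ≤ δ * e) (σ : Arrangement n B) (a b : Fin r → ZMod 3)
    (Y : Finset (Fin n)) (hY : e ≤ #Y) :
    (#{x | (#{y ∈ Y | ShiftAdmissible R σ a b x y} : ℝ) < δ * #Y} : ℝ) ≤ e := by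
  have hY1 : 1 ≤ δ * #Y := hδe.trans (by gcongr)
  rcases shiftCompatible_cases R σ a b with h | ⟨i, j, hij, h⟩
  · rw [filter_eq_empty_iff.2]
    · simpa using he
    · intro x _
      have := card_sub_one_le_card_shiftAdmissible (R := R) σ a b Y x
      rw [filter_true_of_mem (fun y _ => h x y)] at this
      have h2 : δ * #Y ≤ 1 / 2 * #Y := by gcongr
      rw [not_lt]
      linarith
  · refine le_trans ?_ (hR.regular_rows σ hij Y hY)
    refine Nat.cast_le.2 (card_le_card (monotone_filter_right _ fun x _ hx => ?_))
    have h1 := card_sub_one_le_card_shiftAdmissible (R := R) σ a b Y x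
    have h2 : (#{y ∈ Y | R i j (σ i x) (σ j y)} : ℝ) ≤ #{y ∈ Y | ShiftCompatible R σ a b x y} := by
      gcongr with y
      exact h x y
    linarith

theorem validShift_extend (hR : IsQuasirandom R n δ e) {k : ℕ} {σ : Arrangement n B}
    {D : Finset (Fin n)} {t₀ : Fin n} (ht₀ : t₀ ∈ D)
    (f : {a : Fin r → ZMod 3 // a ≠ 0} ≃ Fin k) (t : Fin k → Fin n)
    (h1 : ∀ a, t a ∉ D ∧ ShiftCompatible R σ 0 (f.symm a).1 t₀ (t a))
    (h2 : ∀ a b, a < b →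
      ShiftAdmissible R σ (f.symm a).1 (f.symm b).1 (t a) (t b)) :
    ValidShift R σ D t₀ fun a => if h : a = 0 then t₀ else t (f ⟨a, h⟩) := by
  have hnz : ∀ a (h : a ≠ 0), t (f ⟨a, h⟩) ∉ D ∧ ShiftCompatible R σ 0 a t₀ (t (f ⟨a, h⟩)) :=
    fun a h => by simpa using h1 (f ⟨a, h⟩)
  have hlt : ∀ a b (ha : a ≠ 0) (hb : b ≠ 0), f ⟨a, ha⟩ < f ⟨b, hb⟩ →
      ShiftAdmissible R σ a b (t (f ⟨a, ha⟩)) (t (f ⟨b, hb⟩)) :=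
    fun a b ha hb h => by simpa using h2 _ _ h
  have hpair : ∀ a b (ha : a ≠ 0) (hb : b ≠ 0), a ≠ b →
      ShiftAdmissible R σ a b (t (f ⟨a, ha⟩)) (t (f ⟨b, hb⟩)) := by
    intro a b ha hb hab
    rcases lt_trichotomy (f ⟨a, ha⟩) (f ⟨b, hb⟩) with h | h | h
    · exact hlt a b ha hb h
    · simp [hab] at h
    · have := hlt b a hb ha h
      exact ⟨this.1.symm, this.2.symm hR⟩
  constructor
  · intro a b hab
    by_contra hne
    dsimp only at hab
    split_ifs at hab with ha hb hb
    · exact hne (ha.trans hb.symm)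
    · exact (hnz b hb).1 (hab ▸ ht₀)
    · exact (hnz a ha).1 (hab ▸ ht₀)
    · exact (hpair a b ha hb hne).1 hab
  · simp
  · intro a ha
    simpa [ha] using (hnz a ha).1
  · intro c i j hij
    have hne : c + shift i ≠ c + shift j := fun h =>
      hij (shift_injective (add_left_cancel h))
    by_cases ha : c + shift i = 0
    · have hb : c + shift j ≠ 0 := fun h => hne (ha.trans h.symm)
      simp only [ha, hb, dite_true, dite_false]
      exact (hnz _ hb).2 c i j hij ha rfl
    · by_cases hb : c + shift j = 0
      · simp only [ha, hb, dite_true, dite_false]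
        exact ((hnz _ ha).2.symm hR) c i j hij rfl hb
      · simp only [ha, hb, dite_false]
        exact (hpair _ _ ha hb hne).2 c i j hij rfl rfl

theorem IsQuasirandom.card_validShift (hR : IsQuasirandom R n δ e) (he : 0 ≤ e) (hg : 0 ≤ g)
    (hδ : 0 < δ) (hδ2 : δ ≤ 1 / 2) (hδe : 1 ≤ δ * e) {k : ℕ} (hk : k + 1 = 3 ^ r)
    (hkg : k * e ≤ g / 2) (hgn : g ≤ δ ^ k * (δ * n)) (σ : Arrangement n B)
    (D : Finset (Fin n)) (hD : #D ≤ δ * n) {t₀ : Fin n} (ht₀ : t₀ ∈ D) :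
    (g / 2) ^ k ≤ #{t | ValidShift R σ D t₀ t} := by
  have hcard : Fintype.card {a : Fin r → ZMod 3 // a ≠ 0} = k := by
    have : Fintype.card {a : Fin r → ZMod 3 // a ≠ 0} = 3 ^ r - 1 := by
      rw [Fintype.card_subtype_compl, Fintype.card_subtype_eq]
      simp
    omega
  let f := Fintype.equivFinOfCardEq hcard
  let U : Fin k → Finset (Fin n) := fun a =>
    {x | x ∉ D ∧ ShiftCompatible R σ 0 (f.symm a).1 t₀ x}
  have hU : ∀ a, δ * n ≤ #(U a) := by
    intro a
    have h1 : (#{x | ShiftCompatible R σ 0 (f.symm a).1 t₀ x} : ℝ) ≤ #(U a) + #D := by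
      have : ({x | ShiftCompatible R σ 0 (f.symm a).1 t₀ x} : Finset (Fin n)) ⊆ U a ∪ D := by
        intro x hx
        simp only [U, mem_union, mem_filter, mem_univ, true_and] at hx ⊢
        tauto
      exact_mod_cast (card_le_card this).trans (card_union_le _ _)
    have h2 : 2 * δ * n ≤ (#{x | ShiftCompatible R σ 0 (f.symm a).1 t₀ x} : ℝ) := by
      rcases shiftCompatible_cases R σ 0 (f.symm a).1 with h | ⟨i, j, hij, h⟩
      · rw [filter_true_of_mem (fun x _ => h t₀ x)]
        simp only [card_univ, Fintype.card_fin]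
        nlinarith [(Nat.cast_nonneg n : (0 : ℝ) ≤ n)]
      · refine (hR.degree_rows σ hij t₀).trans ?_
        gcongr with y
        exact h t₀ y
    linarith
  refine (partiteCount hδ (by linarith) he hg k hkg
    (fun a b => ShiftAdmissible R σ (f.symm a).1 (f.symm b).1)
    (fun a b _ Y hY => hR.regular_shiftAdmissible he hδ hδ2 hδe σ _ _ Y hY)
    U (δ * n) (by positivity) hU hgn).trans ?_
  refine Nat.cast_le.2 (card_le_card_of_injOn
    (fun t a => if h : a = 0 then t₀ else t (f ⟨a, h⟩)) ?_ ?_)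
  · intro t ht
    simp only [coe_filter, mem_univ, true_and, Set.mem_ofPred_eq, U, mem_filter] at ht ⊢
    exact validShift_extend hR ht₀ f t ht.1 ht.2
  · intro t _ t' _ h
    funext a
    have := congrFun h (f.symm a).1
    simpa [(f.symm a).2] using this

/-- The arrangements that agree with `σ₀` on the second set of rows and whose rows outside the first
set are compatible. -/
noncomputable def goodArrangements (R : ∀ i j, B i → B j → Prop) (σ₀ : Arrangement n B)
    (D D' : Finset (Fin n)) : Finset (Arrangement n B) :=
  {σ | (∀ t ∉ D, ∀ i j, i ≠ j → R i j (σ i t) (σ j t)) ∧ ∀ t ∈ D', ∀ i, σ i t = σ₀ i t}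

theorem mem_goodArrangements {σ₀ σ : Arrangement n B} {D D' : Finset (Fin n)} :
    σ ∈ goodArrangements R σ₀ D D' ↔
      (∀ t ∉ D, ∀ i j, i ≠ j → R i j (σ i t) (σ j t)) ∧ ∀ t ∈ D', ∀ i, σ i t = σ₀ i t := by
  simp [goodArrangements]

theorem shiftRows_mem_goodArrangements {σ₀ σ : Arrangement n B} {D D' : Finset (Fin n)}
    {t₀ : Fin n} {t : (Fin r → ZMod 3) → Fin n} (hD : D' ⊆ D)
    (hσ : σ ∈ goodArrangements R σ₀ D D') (ht : ValidShift R σ D t₀ t) :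
    shiftRows t σ ∈ goodArrangements R σ₀ (D.erase t₀) (D'.erase t₀) := by
  rw [mem_goodArrangements] at hσ ⊢
  constructor
  · intro x hx i j hij
    by_cases hxt : x ∈ Set.range t
    · obtain ⟨a, rfl⟩ := hxt
      rw [shiftRows_apply ht.injective, shiftRows_apply ht.injective]
      exact ht.compatible a i j hij
    · rw [shiftRows_of_notMem _ _ _ hxt, shiftRows_of_notMem _ _ _ hxt]
      refine hσ.1 x (fun hxD => hx (mem_erase.2 ⟨?_, hxD⟩)) i j hij
      rintro rfl
      exact hxt ⟨0, ht.zero⟩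
  · intro x hx i
    obtain ⟨hx0, hxD⟩ := mem_erase.1 hx
    rw [shiftRows_of_notMem]
    · exact hσ.2 x hxD i
    · rintro ⟨a, rfl⟩
      by_cases ha : a = 0
      · exact hx0 (ha ▸ ht.zero)
      · exact ht.notMem a ha (hD hxD)

omit [∀ i, Fintype (B i)] in
theorem card_mul_le_of_validShift {P : Type*} [Fintype P] {q : P → Fin r → ZMod 3}
    (hq : Function.Injective q) (φ : Arrangement n B → P → Fin n)
    {F F' : Finset (Arrangement n B)} {D : Finset (Fin n)} {t₀ : Fin n} {v : ℝ}
    (hv : ∀ σ ∈ F, v ≤ #{t | ValidShift R σ D t₀ t})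
    (hF : ∀ σ ∈ F, ∀ t, ValidShift R σ D t₀ t →
      shiftRows t σ ∈ F' ∧ ∀ p, t (q p) = φ (shiftRows t σ) p) :
    #F * v * (n : ℝ) ^ Fintype.card P ≤ #F' * (n : ℝ) ^ 3 ^ r := by
  let S : Finset (Σ _ : Arrangement n B, (Fin r → ZMod 3) → Fin n) :=
    F.sigma fun σ => {t | ValidShift R σ D t₀ t}
  have hS : #F * v ≤ #S := by
    calc #F * v = ∑ _σ ∈ F, v := by simp
      _ ≤ ∑ σ ∈ F, (#{t | ValidShift R σ D t₀ t} : ℝ) := sum_le_sum hv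
      _ = #S := by rw [card_sigma]; push_cast; rfl
  have h1 : #S * n ^ Fintype.card P = #(S ×ˢ (univ : Finset (P → Fin n))) := by
    simp [card_product]
  have h2 : #F' * n ^ 3 ^ r = #(F' ×ˢ (univ : Finset ((Fin r → ZMod 3) → Fin n))) := by
    simp [card_product]
  have h3 : #(S ×ˢ (univ : Finset (P → Fin n))) ≤
      #(F' ×ˢ (univ : Finset ((Fin r → ZMod 3) → Fin n))) := by
    refine card_le_card_of_injOn
      (fun x => (shiftRows x.1.2 x.1.1, Function.extend q x.2 x.1.2)) ?_ ?_
    · rintro ⟨⟨σ, t⟩, z⟩ h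
      simp only [S, coe_product, Set.mem_prod, mem_coe, mem_sigma, mem_filter, mem_univ,
        true_and, and_true] at h ⊢
      exact (hF σ h.1 t h.2).1
    · rintro ⟨⟨σ, t⟩, z⟩ h ⟨⟨σ', t'⟩, z'⟩ h' heq
      simp only [S, coe_product, Set.mem_prod, mem_coe, mem_sigma, mem_filter, mem_univ,
        true_and, and_true] at h h'
      simp only [Prod.mk.injEq] at heq
      obtain ⟨hs, he⟩ := heq
      have hz : z = z' := by
        funext p
        have := congrFun he (q p)
        rwa [hq.extend_apply, hq.extend_apply] at this
      have ht : t = t' := by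
        funext a
        by_cases ha : ∃ p, q p = a
        · obtain ⟨p, rfl⟩ := ha
          rw [(hF σ h.1 t h.2).2 p, (hF σ' h'.1 t' h'.2).2 p, hs]
        · have := congrFun he a
          rwa [Function.extend_apply' _ _ _ ha, Function.extend_apply' _ _ _ ha] at this
      subst hz ht
      rw [shiftRows_injective t hs]
  calc #F * v * (n : ℝ) ^ Fintype.card P ≤ #S * (n : ℝ) ^ Fintype.card P := by gcongr
    _ ≤ #F' * (n : ℝ) ^ 3 ^ r := by
      rw [← h1, ← h2] at h3
      exact_mod_cast h3

/-- Exchange the `i`-th entries of the rows `t₀` and `t i`. -/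
def swapRows (t₀ : Fin n) (t : Fin r → Fin n) (σ : Arrangement n B) : Arrangement n B :=
  fun i => (Equiv.swap t₀ (t i)).trans (σ i)

omit [∀ i, Fintype (B i)] in
theorem swapRows_injective (t₀ : Fin n) (t : Fin r → Fin n) :
    Function.Injective (swapRows (B := B) t₀ t) := fun σ τ h => by
  funext i
  ext x
  have := DFunLike.congr_fun (congrFun h i) (Equiv.swap t₀ (t i) x)
  simpa [swapRows] using this

theorem IsQuasirandom.card_swap (hR : IsQuasirandom R n δ e) (he : 0 ≤ e) (hg : 0 ≤ g)
    (hδ : 0 < δ) (hδ2 : δ ≤ 1 / 2) (hkg : r * e ≤ g / 2) (hgn : g ≤ δ ^ r * (δ * n))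
    (σ : Arrangement n B) (D : Finset (Fin n)) (hD : δ * n ≤ #D) :
    (g / 2) ^ r ≤ #{t : Fin r → Fin n |
      (∀ i, t i ∈ D) ∧ ∀ i j, i < j → R i j (σ i (t i)) (σ j (t j))} := by
  have hδ1 : δ ≤ 1 := hδ2.trans (by norm_num)
  refine (partiteCount hδ hδ1 he hg r hkg (fun i j x y => R i j (σ i x) (σ j y))
    (fun i j hij Y hY => ?_) (fun _ => D) (δ * n) (by positivity) (fun _ => hD) hgn).trans
    (Nat.cast_le.2 (card_le_card fun t => by simp))
  refine le_trans ?_ (hR.regular_rows σ hij.ne Y hY)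
  refine Nat.cast_le.2 (card_le_card (monotone_filter_right _ fun x _ hx => hx.trans_le ?_))
  have : 0 ≤ δ * #Y := by positivity
  linarith

theorem IsQuasirandom.card_goodArrangements_swap (hR : IsQuasirandom R n δ e) (he : 0 ≤ e)
    (hg : 0 ≤ g) (hδ : 0 < δ) (hδ2 : δ ≤ 1 / 2) (hkg : r * e ≤ g / 2)
    (hgn : g ≤ δ ^ r * (δ * n)) (σ₀ : Arrangement n B) (D : Finset (Fin n)) (hD : δ * n ≤ #D)
    {t₀ : Fin n} (ht₀ : t₀ ∈ D) :
    #(goodArrangements R σ₀ D ∅) * (g / 2) ^ r ≤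
      #(goodArrangements R σ₀ (D.erase t₀) ∅) * (n : ℝ) ^ r := by
  let T : Arrangement n B → Finset (Fin r → Fin n) := fun σ =>
    {t | (∀ i, t i ∈ D) ∧ ∀ i j, i < j → R i j (σ i (t i)) (σ j (t j))}
  have hS : #(goodArrangements R σ₀ D ∅) * (g / 2) ^ r ≤
      #((goodArrangements R σ₀ D ∅).sigma T) := by
    calc #(goodArrangements R σ₀ D ∅) * (g / 2) ^ r
        = ∑ _σ ∈ goodArrangements R σ₀ D ∅, (g / 2) ^ r := by simp
      _ ≤ ∑ σ ∈ goodArrangements R σ₀ D ∅, (#(T σ) : ℝ) :=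
        sum_le_sum fun σ _ => hR.card_swap he hg hδ hδ2 hkg hgn σ D hD
      _ = _ := by rw [card_sigma]; push_cast; rfl
  have h2 : #(goodArrangements R σ₀ (D.erase t₀) ∅) * n ^ r =
      #(goodArrangements R σ₀ (D.erase t₀) ∅ ×ˢ (univ : Finset (Fin r → Fin n))) := by
    simp [card_product]
  have h3 : #((goodArrangements R σ₀ D ∅).sigma T) ≤
      #(goodArrangements R σ₀ (D.erase t₀) ∅ ×ˢ (univ : Finset (Fin r → Fin n))) := by
    refine card_le_card_of_injOn (fun x => (swapRows t₀ x.2 x.1, x.2)) ?_ ?_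
    · rintro ⟨σ, t⟩ h
      simp only [T, mem_coe, mem_sigma, mem_filter, mem_univ, true_and, mem_goodArrangements,
        mem_product, and_true, notMem_empty, false_imp_iff, implies_true] at h ⊢
      obtain ⟨hσ, htD, ht⟩ := h
      intro x hx i j hij
      by_cases hx0 : x = t₀
      · subst hx0
        simp only [swapRows, Equiv.trans_apply, Equiv.swap_apply_left]
        rcases lt_or_gt_of_ne hij with h | h
        · exact ht i j h
        · exact hR.symm _ _ _ _ (ht j i h)
      · have hxD : x ∉ D := fun h => hx (mem_erase.2 ⟨hx0, h⟩)
        have hne : ∀ i, x ≠ t i := fun i h => hxD (h ▸ htD i)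
        simp only [swapRows, Equiv.trans_apply, Equiv.swap_apply_of_ne_of_ne hx0 (hne _)]
        exact hσ x hxD i j hij
    · rintro ⟨σ, t⟩ _ ⟨σ', t'⟩ _ heq
      simp only [Prod.mk.injEq] at heq
      obtain ⟨hs, rfl⟩ := heq
      rw [swapRows_injective _ _ hs]
  rw [← h2] at h3
  exact hS.trans (by exact_mod_cast h3)

/-- Admissible parameters for the switching arguments. -/
structure SwitchParams (r n : ℕ) (δ ε γ : ℝ) (k : ℕ) : Prop where
  pos : 0 < n
  hr : r ≤ k
  hk : k + 1 = 3 ^ r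
  hδ : 0 < δ
  hδ2 : δ ≤ 1 / 2
  hε : 0 < ε
  hγ : 0 < γ
  hkγ : k * ε ≤ γ / 2
  hγδ : γ ≤ δ ^ k * δ
  hn : 1 ≤ δ * (ε * n)

variable {ε γ : ℝ} {k : ℕ}

theorem SwitchParams.le_one (hp : SwitchParams r n δ ε γ k) : γ ≤ 1 := by
  have h1 : δ ≤ 1 := hp.hδ2.trans (by norm_num)
  exact hp.hγδ.trans (mul_le_one₀ (pow_le_one₀ hp.hδ.le h1) hp.hδ.le h1)

theorem SwitchParams.card_validShift (hp : SwitchParams r n δ ε γ k)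
    (hR : IsQuasirandom R n δ (ε * n)) (σ : Arrangement n B)
    (D : Finset (Fin n)) (hD : #D ≤ δ * n) {t₀ : Fin n} (ht₀ : t₀ ∈ D) :
    (γ / 2) ^ k * (n : ℝ) ^ k ≤ #{t | ValidShift R σ D t₀ t} := by
  have h := hR.card_validShift (g := γ * n) (k := k)
    (mul_nonneg hp.hε.le n.cast_nonneg) (mul_nonneg hp.hγ.le n.cast_nonneg) hp.hδ hp.hδ2 hp.hn
    hp.hk
    (by rw [← mul_assoc, mul_div_right_comm]; exact mul_le_mul_of_nonneg_right hp.hkγ (by simp))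
    (by rw [← mul_assoc]; exact mul_le_mul_of_nonneg_right hp.hγδ (by simp)) σ D hD ht₀
  rwa [mul_div_right_comm, mul_pow] at h

theorem SwitchParams.card_goodArrangements_erase (hp : SwitchParams r n δ ε γ k)
    (hR : IsQuasirandom R n δ (ε * n)) (σ₀ : Arrangement n B)
    (D : Finset (Fin n)) {t₀ : Fin n} (ht₀ : t₀ ∈ D) :
    (γ / 2) ^ k * #(goodArrangements R σ₀ D ∅) ≤ #(goodArrangements R σ₀ (D.erase t₀) ∅) := by
  have hn : (0 : ℝ) < n := Nat.cast_pos.2 hp.pos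
  rcases le_total (#D : ℝ) (δ * n) with hD | hD
  · have h := card_mul_le_of_validShift (P := Unit) (q := fun _ => 0)
      (fun _ _ _ => rfl) (fun _ _ => t₀) (fun σ _ => hp.card_validShift hR σ D hD ht₀)
      (F := goodArrangements R σ₀ D ∅) (F' := goodArrangements R σ₀ (D.erase t₀) ∅)
      (fun σ hσ t ht => ⟨by simpa using shiftRows_mem_goodArrangements (empty_subset D) hσ ht,
        fun _ => ht.zero⟩)
    rw [← hp.hk] at h
    refine le_of_mul_le_mul_right ?_ (pow_pos hn (k + 1))
    refine le_trans (le_of_eq ?_) h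
    simp only [Fintype.card_unit]
    ring
  · have hδ1 : δ ≤ 1 := hp.hδ2.trans (by norm_num)
    have h := hR.card_goodArrangements_swap (g := γ * n)
      (mul_nonneg hp.hε.le n.cast_nonneg) (mul_nonneg hp.hγ.le n.cast_nonneg) hp.hδ hp.hδ2
      (by
        rw [← mul_assoc, mul_div_right_comm]
        refine mul_le_mul_of_nonneg_right (le_trans ?_ hp.hkγ) (by simp)
        exact mul_le_mul_of_nonneg_right (Nat.cast_le.2 hp.hr) hp.hε.le)
      (by
        rw [← mul_assoc]
        refine mul_le_mul_of_nonneg_right (hp.hγδ.trans ?_) (by simp)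
        exact mul_le_mul_of_nonneg_right (pow_le_pow_of_le_one hp.hδ.le hδ1 hp.hr) hp.hδ.le)
      σ₀ D hD ht₀
    rw [mul_div_right_comm, mul_pow, ← mul_assoc] at h
    have h2 := le_of_mul_le_mul_right h (pow_pos hn r)
    refine le_trans ?_ h2
    rw [mul_comm]
    refine mul_le_mul_of_nonneg_left ?_ (by simp)
    exact pow_le_pow_of_le_one (by linarith [hp.hγ]) (by linarith [hp.le_one]) hp.hr

theorem SwitchParams.card_goodArrangements_erase_fixed (hp : SwitchParams r n δ ε γ k)
    (hR : IsQuasirandom R n δ (ε * n)) (σ₀ : Arrangement n B)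
    (D : Finset (Fin n)) (hD : #D ≤ δ * n) {t₀ : Fin n} (ht₀ : t₀ ∈ D) :
    ((γ / 2) ^ k * (n : ℝ) ^ r) * #(goodArrangements R σ₀ D D) ≤
      #(goodArrangements R σ₀ (D.erase t₀) (D.erase t₀)) := by
  have hn : (0 : ℝ) < n := Nat.cast_pos.2 hp.pos
  let q : Option (Fin r) → Fin r → ZMod 3 := fun o => o.elim 0 fun i => -shift i
  have hq : Function.Injective q := by
    rintro (_ | i) (_ | j) h
    · rfl
    · exact (shift_ne_zero j (neg_eq_zero.1 h.symm)).elim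
    · exact (shift_ne_zero i (neg_eq_zero.1 h)).elim
    · rw [shift_injective (neg_injective h)]
  have h := card_mul_le_of_validShift hq
    (fun τ o => o.elim t₀ fun i => (τ i).symm (σ₀ i t₀))
    (fun σ _ => hp.card_validShift hR σ D hD ht₀)
    (F := goodArrangements R σ₀ D D) (F' := goodArrangements R σ₀ (D.erase t₀) (D.erase t₀))
    (fun σ hσ t ht => ⟨shiftRows_mem_goodArrangements Subset.rfl hσ ht, by
      rintro (_ | i)
      · exact ht.zero
      · simp only [q, Option.elim_some]
        rw [Equiv.eq_symm_apply, shiftRows_apply ht.injective, neg_add_cancel, ht.zero]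
        exact (mem_goodArrangements.1 hσ).2 t₀ ht₀ i⟩)
  rw [← hp.hk] at h
  refine le_of_mul_le_mul_right ?_ (pow_pos hn (k + 1))
  refine le_trans (le_of_eq ?_) h
  simp only [Fintype.card_option, Fintype.card_fin]
  ring

theorem SwitchParams.le_card_goodArrangements_empty (hp : SwitchParams r n δ ε γ k)
    (hR : IsQuasirandom R n δ (ε * n)) (σ₀ : Arrangement n B) :
    ((γ / 2) ^ k) ^ n * (n.factorial : ℝ) ^ r ≤ #(goodArrangements R σ₀ ∅ ∅) := by
  have hc : 0 ≤ (γ / 2) ^ k := pow_nonneg (by linarith [hp.hγ]) k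
  have key : ∀ D : Finset (Fin n), ((γ / 2) ^ k) ^ #D * #(goodArrangements R σ₀ D ∅) ≤
      #(goodArrangements R σ₀ ∅ ∅) := by
    intro D
    induction D using Finset.induction_on with
    | empty => simp
    | insert a D ha ih =>
      have h := hp.card_goodArrangements_erase hR σ₀ (insert a D) (mem_insert_self a D)
      rw [erase_insert ha] at h
      rw [card_insert_of_notMem ha, pow_succ, mul_assoc]
      exact (mul_le_mul_of_nonneg_left h (pow_nonneg hc _)).trans ih
  have h := key univ
  have hu : goodArrangements R σ₀ univ ∅ = univ := by
    ext σ
    simp [mem_goodArrangements]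
  rw [hu, card_univ, card_univ, Fintype.card_pi] at h
  simpa [Fintype.card_equiv (σ₀ _)] using h

theorem SwitchParams.card_goodArrangements_fixed_small (hp : SwitchParams r n δ ε γ k)
    (hR : IsQuasirandom R n δ (ε * n)) (σ₀ : Arrangement n B)
    (D : Finset (Fin n)) (hD : #D ≤ δ * n) :
    ((γ / 2) ^ k * (n : ℝ) ^ r) ^ #D * #(goodArrangements R σ₀ D D) ≤
      #(goodArrangements R σ₀ ∅ ∅) := by
  have hc : 0 ≤ (γ / 2) ^ k := pow_nonneg (by linarith [hp.hγ]) k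
  induction D using Finset.induction_on with
  | empty => simp
  | insert a D ha ih =>
    have h := hp.card_goodArrangements_erase_fixed hR σ₀ (insert a D) hD (mem_insert_self a D)
    rw [erase_insert ha] at h
    rw [card_insert_of_notMem ha, pow_succ, mul_assoc]
    refine (mul_le_mul_of_nonneg_left h (by positivity)).trans (ih (le_trans ?_ hD))
    exact Nat.cast_le.2 (card_le_card (subset_insert a D))

theorem card_goodArrangements_fixed_le (σ₀ : Arrangement n B) (D D' : Finset (Fin n)) :
    #(goodArrangements R σ₀ D D') ≤ (n ^ (n - #D')) ^ r := by
  have hcard : Fintype.card ({t : Fin n // t ∉ D'} → Fin r → Fin n) = (n ^ (n - #D')) ^ r := by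
    rw [Fintype.card_fun, Fintype.card_fun, Fintype.card_subtype_compl, Fintype.card_coe]
    simp only [Fintype.card_fin]
    rw [← pow_mul, ← pow_mul, mul_comm]
  rw [← hcard, ← card_univ]
  refine card_le_card_of_injOn (fun σ t i => (σ₀ i).symm (σ i t)) (fun _ _ => by simp) ?_
  intro σ hσ τ hτ h
  rw [mem_coe, mem_goodArrangements] at hσ hτ
  funext i
  ext t
  by_cases ht : t ∈ D'
  · rw [hσ.2 t ht, hτ.2 t ht]
  · have := congrFun (congrFun h ⟨t, ht⟩) i
    simpa using this

theorem pow_le_exp_mul_factorial (n : ℕ) :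
    (n : ℝ) ^ n ≤ Real.exp 1 ^ n * n.factorial := by
  have h := Real.pow_div_factorial_le_exp (n : ℝ) n.cast_nonneg n
  rw [div_le_iff₀ (by positivity)] at h
  rwa [← Real.exp_nat_mul, mul_one]

theorem SwitchParams.card_goodArrangements_fixed (hp : SwitchParams r n δ ε γ k)
    (hR : IsQuasirandom R n δ (ε * n)) (σ₀ : Arrangement n B) (D : Finset (Fin n)) {N : ℕ}
    (hN : 1 ≤ N * δ) :
    (#(goodArrangements R σ₀ D D) : ℝ) ≤
      ((Real.exp 1 ^ r / (γ / 2) ^ k) ^ N / (n : ℝ) ^ r) ^ #D * #(goodArrangements R σ₀ ∅ ∅) := by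
  have hn : (0 : ℝ) < n := Nat.cast_pos.2 hp.pos
  have hγ := hp.hγ
  have hδ := hp.hδ
  set c : ℝ := (γ / 2) ^ k with hc
  have hc0 : 0 < c := by positivity
  have hc1 : c ≤ 1 := pow_le_one₀ (by positivity) (by linarith [hp.le_one])
  have he1 : 1 ≤ Real.exp 1 ^ r := one_le_pow₀ (Real.one_le_exp (by norm_num))
  set K : ℝ := Real.exp 1 ^ r / c with hK
  have hcK : 1 / c ≤ K := div_le_div_of_nonneg_right he1 hc0.le
  have hK1 : 1 ≤ K := (one_le_one_div hc0 hc1).trans hcK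
  have hN0 : N ≠ 0 := by
    rintro rfl
    norm_num at hN
  rcases le_total (#D : ℝ) (δ * n) with hD | hD
  · have h := hp.card_goodArrangements_fixed_small hR σ₀ D hD
    have hpos : 0 < (c * (n : ℝ) ^ r) ^ #D := by positivity
    rw [mul_comm, ← le_div_iff₀ hpos] at h
    refine h.trans ?_
    rw [div_eq_mul_inv, mul_comm]
    refine mul_le_mul_of_nonneg_right ?_ (by positivity)
    rw [← inv_pow, mul_inv]
    have : c⁻¹ ≤ K ^ N := by
      rw [← one_div]
      exact hcK.trans (le_self_pow₀ hK1 hN0)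
    rw [div_eq_mul_inv]
    gcongr
  · have hDn : #D ≤ n := by simpa using card_le_univ D
    have h1 : (#(goodArrangements R σ₀ D D) : ℝ) ≤ ((n : ℝ) ^ (n - #D)) ^ r := by
      exact_mod_cast card_goodArrangements_fixed_le (R := R) σ₀ D D
    have h2 := hp.le_card_goodArrangements_empty hR σ₀
    have h3 : n ≤ N * #D := by
      have : (n : ℝ) ≤ N * #D := by
        calc (n : ℝ) ≤ (N * δ) * n := le_mul_of_one_le_left hn.le hN
          _ = N * (δ * n) := by ring
          _ ≤ N * #D := by gcongr
      exact_mod_cast this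
    have h4 : ((n : ℝ) ^ n) ^ r ≤ K ^ n * #(goodArrangements R σ₀ ∅ ∅) := by
      calc ((n : ℝ) ^ n) ^ r ≤ (Real.exp 1 ^ n * n.factorial) ^ r := by
            gcongr
            exact pow_le_exp_mul_factorial n
        _ = K ^ n * (c ^ n * (n.factorial : ℝ) ^ r) := by
            rw [hK, div_pow, ← mul_assoc, div_mul_cancel₀ _ (by positivity), mul_pow, ← pow_mul,
              ← pow_mul, mul_comm n r]
        _ ≤ _ := by gcongr
    calc (#(goodArrangements R σ₀ D D) : ℝ) ≤ ((n : ℝ) ^ (n - #D)) ^ r := h1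
      _ = ((n : ℝ) ^ n) ^ r / ((n : ℝ) ^ r) ^ #D := by
          rw [eq_div_iff (by positivity), ← pow_mul, ← pow_mul, ← pow_mul, ← pow_add]
          congr 1
          rw [mul_comm r, ← add_mul, Nat.sub_add_cancel hDn]
      _ ≤ K ^ (N * #D) * #(goodArrangements R σ₀ ∅ ∅) / ((n : ℝ) ^ r) ^ #D := by
          gcongr
          refine h4.trans ?_
          gcongr
      _ = _ := by
          rw [pow_mul, div_pow]
          ring

end Switching

section Transfer

open Classical

theorem isSpreadDist_pushforward {Ω α : Type*} [Fintype α] [DecidableEq α] {q : ℝ}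
    {Fam : Finset α → Prop} (F : Finset Ω) (hF : F.Nonempty) (m : Ω → Finset α)
    (hFam : ∀ ω ∈ F, Fam (m ω))
    (hq : ∀ S : Finset α, (#{ω ∈ F | S ⊆ m ω} : ℝ) ≤ q ^ #S * #F) :
    IsSpreadDist q Fam fun M => (#{ω ∈ F | m ω = M} : ℝ) / #F := by
  have hF0 : (0 : ℝ) < #F := Nat.cast_pos.2 hF.card_pos
  refine ⟨fun M => by positivity, ?_, fun M hM => ?_, fun S => ?_⟩
  · rw [← sum_div, div_eq_one_iff_eq hF0.ne']
    exact_mod_cast (card_eq_sum_card_fiberwise (f := m) (t := univ) (fun _ _ => by simp)).symm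
  · have hne : #{ω ∈ F | m ω = M} ≠ 0 := fun h => hM (by simp [h])
    obtain ⟨ω, hω⟩ := card_ne_zero.1 hne
    obtain ⟨hωF, rfl⟩ := mem_filter.1 hω
    exact hFam ω hωF
  · rw [← sum_div, div_le_iff₀ hF0]
    refine le_trans (le_of_eq ?_) (hq S)
    have h := card_eq_sum_card_fiberwise (s := {ω ∈ F | S ⊆ m ω}) (f := m)
      (t := univ.filter (fun A : Finset α => S ⊆ A)) (fun ω hω => by
        simpa using (mem_filter.1 (mem_coe.1 hω)).2)
    rw [h]
    push_cast
    refine sum_congr rfl fun M hM => ?_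
    rw [filter_filter]
    congr 2
    refine filter_congr fun ω _ => ?_
    constructor
    · rintro rfl
      exact ⟨(mem_filter.1 hM).2, rfl⟩
    · exact fun h => h.2

variable {r n : ℕ} {A : Fin r → Finset V} {G : SimpleGraph V}

omit [Fintype V] [DecidableEq V] in
theorem nbrCount_map_subtype [DecidableRel G.Adj] (v : V) {B : Finset V}
    (Y : Finset {y // y ∈ B}) :
    nbrCount G v (Y.map (Function.Embedding.subtype _)) =
      #(@filter _ (fun y => G.Adj v y.1) (fun _ => propDecidable _) Y) := by
  rw [nbrCount, filter_map, card_map]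
  congr!

omit [Fintype V] [DecidableEq V] in
theorem isQuasirandom_of_isSuperRegular [DecidableRel G.Adj] {d δ ε ε₀ : ℝ}
    (hA : ∀ i, #(A i) = n) (hδ : 0 < δ) (hd : 4 * δ ≤ d) (hε : ε ≤ ε₀) (hε₀ : ε₀ ≤ δ)
    (hG : ∀ i j, i ≠ j → ∃ dij : ℝ, d ≤ dij ∧ IsSuperRegular G (A i) (A j) dij ε) :
    IsQuasirandom (B := fun i => {x // x ∈ A i}) (fun _ _ x y => G.Adj x.1 y.1) n δ (ε₀ * n) where
  symm _ _ _ _ h := h.symm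
  degree i j hij x := by
    obtain ⟨dij, hdij, -, h, -⟩ := hG i j hij
    have hx := h x.1 x.2
    have hmap : (univ : Finset {y // y ∈ A j}).map (Function.Embedding.subtype _) = A j :=
      attach_map_val
    have hcard := nbrCount_map_subtype (G := G) x.1 (univ : Finset {y // y ∈ A j})
    rw [hmap] at hcard
    rw [hA, hcard] at hx
    exact (mul_le_mul_of_nonneg_right (by linarith) n.cast_nonneg).trans hx
  regular i j hij Y hY := by
    obtain ⟨dij, hdij, ⟨-, hreg⟩, -⟩ := hG i j hij
    suffices h : ∀ X : Finset {x // x ∈ A i},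
        (∀ x ∈ X, (nbrCount G x.1 (Y.map (Function.Embedding.subtype _)) : ℝ) ≤ 2 * δ * #Y) →
          (#X : ℝ) ≤ ε₀ * n by
      refine h _ fun x hx => ?_
      rw [nbrCount_map_subtype]
      exact (mem_filter.1 hx).2.le
    intro X hX
    by_contra! hlt
    have hn : ε * n ≤ ε₀ * n := mul_le_mul_of_nonneg_right hε n.cast_nonneg
    have h := hreg (X.map (Function.Embedding.subtype _))
      (fun v hv => by
        obtain ⟨x, -, rfl⟩ := mem_map.1 hv
        exact x.2)
      (Y.map (Function.Embedding.subtype _))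
      (fun v hv => by
        obtain ⟨x, -, rfl⟩ := mem_map.1 hv
        exact x.2)
      (by rw [hA, card_map]; linarith) (by rw [hA, card_map]; linarith)
    have hle : pairDensity G (X.map (Function.Embedding.subtype _))
        (Y.map (Function.Embedding.subtype _)) ≤ 2 * δ := by
      unfold pairDensity
      refine div_le_of_le_mul₀ (by positivity) (by positivity) ?_
      rw [sum_map, card_map, card_map]
      calc ∑ x ∈ X, (nbrCount G x.1 (Y.map (Function.Embedding.subtype _)) : ℝ)
          ≤ ∑ _x ∈ X, 2 * δ * #Y := sum_le_sum hX
        _ = 2 * δ * (#X * #Y) := by rw [sum_const, nsmul_eq_mul]; ring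
    have := (abs_le.1 h).1
    linarith

/-- The vertex set of the row `t`. -/
def rowSet (σ : Arrangement n fun i => {x // x ∈ A i}) (t : Fin n) : Finset V :=
  univ.image fun i => (σ i t).1

omit [Fintype V] in
theorem mem_rowSet {σ : Arrangement n fun i => {x // x ∈ A i}} {t : Fin n} {v : V} :
    v ∈ rowSet σ t ↔ ∃ i, (σ i t).1 = v := by
  simp [rowSet]

omit [Fintype V] [DecidableEq V] in
theorem eq_of_mem_parts (hdisj : Pairwise fun i j => Disjoint (A i) (A j)) {i j : Fin r} {v : V}
    (hi : v ∈ A i) (hj : v ∈ A j) : i = j := by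
  by_contra h
  exact disjoint_left.1 (hdisj h) hi hj

omit [Fintype V] [DecidableEq V] in
theorem arrangement_eq_iff (hdisj : Pairwise fun i j => Disjoint (A i) (A j))
    {σ τ : Arrangement n fun i => {x // x ∈ A i}} {i j : Fin r} {t u : Fin n}
    (h : (σ i t).1 = (τ j u).1) : i = j ∧ σ i t = τ i u := by
  obtain rfl : i = j := eq_of_mem_parts hdisj (σ i t).2 (h ▸ (τ j u).2)
  exact ⟨rfl, Subtype.ext h⟩

omit [Fintype V] in
theorem eq_of_rowSet_eq (hdisj : Pairwise fun i j => Disjoint (A i) (A j))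
    {σ τ : Arrangement n fun i => {x // x ∈ A i}} {t u : Fin n}
    (h : rowSet σ t = rowSet τ u) (i : Fin r) : σ i t = τ i u := by
  obtain ⟨j, hj⟩ := mem_rowSet.1 (h ▸ mem_rowSet.2 ⟨i, rfl⟩ : (σ i t).1 ∈ rowSet τ u)
  exact (arrangement_eq_iff hdisj hj.symm).2

theorem image_rowSet_isPerfectMatching
    (hcover : (Finset.univ : Finset V) = Finset.univ.biUnion A)
    (hdisj : Pairwise fun i j => Disjoint (A i) (A j))
    {σ : Arrangement n fun i => {x // x ∈ A i}}
    (hσ : ∀ t i j, i ≠ j → G.Adj (σ i t).1 (σ j t).1) :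
    univ.image (rowSet σ) ⊆ transvCliques G A ∧
      ((univ.image (rowSet σ) : Finset (Finset V)) : Set (Finset V)).PairwiseDisjoint id ∧
        (univ.image (rowSet σ)).biUnion id = univ := by
  refine ⟨fun K hK => ?_, ?_, ?_⟩
  · obtain ⟨t, -, rfl⟩ := mem_image.1 hK
    simp only [transvCliques, mem_filter, mem_univ, true_and]
    constructor
    · intro u hu v hv huv
      obtain ⟨i, rfl⟩ := mem_rowSet.1 (mem_coe.1 hu)
      obtain ⟨j, rfl⟩ := mem_rowSet.1 (mem_coe.1 hv)
      refine hσ t i j ?_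
      rintro rfl
      exact huv rfl
    · intro i
      rw [card_eq_one]
      refine ⟨(σ i t).1, ?_⟩
      ext v
      rw [mem_inter, mem_singleton, mem_rowSet]
      constructor
      · rintro ⟨⟨j, rfl⟩, hv⟩
        obtain rfl := eq_of_mem_parts hdisj (σ j t).2 hv
        rfl
      · rintro rfl
        exact ⟨⟨i, rfl⟩, (σ i t).2⟩
  · intro K hK L hL hKL
    obtain ⟨t, -, rfl⟩ := mem_image.1 (mem_coe.1 hK)
    obtain ⟨u, -, rfl⟩ := mem_image.1 (mem_coe.1 hL)
    rw [Function.onFun, id, id, disjoint_left]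
    intro v hv hv'
    obtain ⟨i, rfl⟩ := mem_rowSet.1 hv
    obtain ⟨j, hj⟩ := mem_rowSet.1 hv'
    have := (arrangement_eq_iff hdisj hj.symm).2
    exact hKL (by rw [(σ i).injective this])
  · refine eq_univ_iff_forall.2 fun v => ?_
    have hv : v ∈ univ.biUnion A := hcover ▸ mem_univ v
    obtain ⟨i, -, hi⟩ := mem_biUnion.1 hv
    refine mem_biUnion.2 ⟨rowSet σ ((σ i).symm ⟨v, hi⟩), mem_image_of_mem _ (mem_univ _), ?_⟩
    exact mem_rowSet.2 ⟨i, by simp⟩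

omit [Fintype V] in
theorem card_filter_subset_image_rowSet_le
    (hdisj : Pairwise fun i j => Disjoint (A i) (A j))
    {R : ∀ i j, {x // x ∈ A i} → {x // x ∈ A j} → Prop} {q : ℝ} (hq : 0 ≤ q)
    (σ₀ : Arrangement n fun i => {x // x ∈ A i})
    (h : ∀ (σ₁ : Arrangement n fun i => {x // x ∈ A i}) (D : Finset (Fin n)),
      (#(goodArrangements R σ₁ D D) : ℝ) ≤ q ^ #D * #(goodArrangements R σ₁ ∅ ∅))
    (S : Finset (Finset V)) :
    (#{σ ∈ goodArrangements R σ₀ ∅ ∅ | S ⊆ univ.image (rowSet σ)} : ℝ) ≤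
      (q * n) ^ #S * #(goodArrangements R σ₀ ∅ ∅) := by
  set F := goodArrangements R σ₀ ∅ ∅ with hF
  let T : ({K // K ∈ S} → Fin n) → Finset (Arrangement n fun i => {x // x ∈ A i}) := fun l =>
    {σ ∈ F | ∀ K, rowSet σ (l K) = K.1}
  have hsub : {σ ∈ F | S ⊆ univ.image (rowSet σ)} ⊆ univ.biUnion T := by
    intro σ hσ
    obtain ⟨hσF, hS⟩ := mem_filter.1 hσ
    have hex : ∀ K : {K // K ∈ S}, ∃ t, rowSet σ t = K.1 := fun K => by
      obtain ⟨t, -, ht⟩ := mem_image.1 (hS K.2)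
      exact ⟨t, ht⟩
    choose l hl using hex
    exact mem_biUnion.2 ⟨l, mem_univ _, mem_filter.2 ⟨hσF, hl⟩⟩
  have hT : ∀ l, (#(T l) : ℝ) ≤ q ^ #S * #F := by
    intro l
    rcases (T l).eq_empty_or_nonempty with he | ⟨σ₁, hσ₁⟩
    · rw [he, card_empty, Nat.cast_zero]
      positivity
    · have hl := (mem_filter.1 hσ₁).2
      have hinj : Function.Injective l := fun K L hKL =>
        Subtype.ext ((hl K).symm.trans (hKL ▸ hl L))
      have hcard : #(univ.image l) = #S := by
        rw [card_image_of_injective _ hinj, card_univ, Fintype.card_coe]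
      have hFeq : goodArrangements R σ₁ ∅ ∅ = F := by
        ext σ
        simp [hF, mem_goodArrangements]
      have := h σ₁ (univ.image l)
      rw [hcard, hFeq] at this
      refine le_trans (Nat.cast_le.2 (card_le_card fun σ hσ => ?_)) this
      obtain ⟨hσF, hσl⟩ := mem_filter.1 hσ
      rw [hF, mem_goodArrangements] at hσF
      refine mem_goodArrangements.2 ⟨fun t _ => hσF.1 t (notMem_empty t), fun t ht i => ?_⟩
      obtain ⟨K, -, rfl⟩ := mem_image.1 ht
      exact eq_of_rowSet_eq hdisj ((hσl K).trans (hl K).symm) i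
  calc (#{σ ∈ F | S ⊆ univ.image (rowSet σ)} : ℝ) ≤ #(univ.biUnion T) :=
        Nat.cast_le.2 (card_le_card hsub)
    _ ≤ ∑ l, (#(T l) : ℝ) := by exact_mod_cast card_biUnion_le
    _ ≤ ∑ _l : {K // K ∈ S} → Fin n, q ^ #S * #F := sum_le_sum fun l _ => hT l
    _ = (q * n) ^ #S * #F := by
      rw [sum_const, card_univ, Fintype.card_fun, Fintype.card_coe, Fintype.card_fin, nsmul_eq_mul,
        mul_pow]
      push_cast
      ring

end Transfer

/-- Spread perfect matchings in `r`-partite super-regular systems: for `r ≥ 2` and `d > 0`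
there is `ε₀ > 0` and, for each `0 < ε ≤ ε₀`, constants `C` and `n₀` such that whenever `G`
is `r`-partite with parts of size `n ≥ n₀` which are pairwise `(d_{i,j},ε)`-super-regular with
`d_{i,j} ≥ d`, the hypergraph of `r`-partite cliques of `G` carries a `(C/n^{r-1})`-spread
distribution on its perfect matchings. -/
theorem statement4 :
    ∀ r : ℕ, 2 ≤ r → ∀ d : ℝ, 0 < d →
    ∃ ε₀ : ℝ, 0 < ε₀ ∧ ∀ ε : ℝ, 0 < ε → ε ≤ ε₀ →
    ∃ C : ℝ, 0 < C ∧ ∃ n₀ : ℕ, ∀ n : ℕ, n₀ ≤ n →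
    ∀ (V : Type) (_ : Fintype V) (_ : DecidableEq V)
      (G : SimpleGraph V) (_ : DecidableRel G.Adj) (A : Fin r → Finset V),
    (∀ i, (A i).card = n) →
    (Finset.univ : Finset V) = Finset.univ.biUnion A →
    (Pairwise fun i j => Disjoint (A i) (A j)) →
    (∀ i, ∀ u ∈ A i, ∀ v ∈ A i, ¬ G.Adj u v) →
    (∀ i j, i ≠ j → ∃ dij : ℝ, d ≤ dij ∧ IsSuperRegular G (A i) (A j) dij ε) →
    ∃ μ : Finset (Finset V) → ℝ,
      IsSpreadDist (C / (n : ℝ) ^ (r - 1))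
        (fun M => M ⊆ transvCliques G A ∧ (M : Set (Finset V)).PairwiseDisjoint id ∧
          M.biUnion id = Finset.univ) μ := by
  intro r hr d hd
  set δ : ℝ := min d 1 / 4 with hδdef
  have hδ : 0 < δ := by positivity
  have hδd : 4 * δ ≤ d := by linarith [min_le_left d 1]
  have hδ4 : δ ≤ 1 / 4 := by linarith [min_le_right d 1]
  obtain ⟨k, hk⟩ : ∃ k, k + 1 = 3 ^ r := ⟨3 ^ r - 1, Nat.sub_add_cancel (Nat.one_le_pow _ _ (by norm_num))⟩
  have hrk : r ≤ k := by
    have h := Nat.lt_pow_self (n := r) (a := 3) (by norm_num)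
    omega
  set γ : ℝ := δ ^ k * δ with hγdef
  have hγ : 0 < γ := by positivity
  set ε₀ : ℝ := γ / (2 * (k + 1)) with hε₀def
  have hε₀ : 0 < ε₀ := by positivity
  have hkε : (k + 1) * ε₀ = γ / 2 := by
    rw [hε₀def]
    field_simp
  have hkγ : k * ε₀ ≤ γ / 2 := by linarith
  have hγδ : γ ≤ δ := mul_le_of_le_one_left hδ.le (pow_le_one₀ hδ.le (by linarith))
  have hε₀δ : ε₀ ≤ δ := by
    have : 0 ≤ k * ε₀ := by positivity
    linarith
  obtain ⟨N, hN⟩ := exists_nat_ge (1 / δ)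
  obtain ⟨n₀, hn₀⟩ := exists_nat_ge (1 / (δ * ε₀))
  refine ⟨ε₀, hε₀, fun ε _ hεε₀ =>
    ⟨(Real.exp 1 ^ r / (γ / 2) ^ k) ^ N, by positivity, n₀ + 1, ?_⟩⟩
  intro n hn V _ _ G _ A hA hcover hdisj _ hG
  have hR := isQuasirandom_of_isSuperRegular hA hδ hδd hεε₀ hε₀δ hG
  have hn0 : (0 : ℝ) < n := Nat.cast_pos.2 (by omega)
  have hp : SwitchParams r n δ ε₀ γ k :=
    { pos := by omega
      hr := hrk
      hk := hk
      hδ := hδ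
      hδ2 := by linarith
      hε := hε₀
      hγ := hγ
      hkγ := hkγ
      hγδ := le_rfl
      hn := by
        rw [← mul_assoc, mul_comm, ← div_le_iff₀ (by positivity)]
        exact hn₀.trans (Nat.cast_le.2 (by omega)) }
  have σ₀ : Arrangement n fun i => {x // x ∈ A i} := fun i =>
    (Fintype.equivFinOfCardEq (by simp [hA])).symm
  have hne : (goodArrangements (fun _ _ x y => G.Adj x.1 y.1) σ₀ ∅ ∅).Nonempty := by
    have h := hp.le_card_goodArrangements_empty hR σ₀
    have hpos : 0 < ((γ / 2) ^ k) ^ n * (n.factorial : ℝ) ^ r := by positivity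
    exact card_pos.1 (Nat.cast_pos.1 (hpos.trans_le h))
  refine ⟨_, isSpreadDist_pushforward _ hne (fun σ => univ.image (rowSet σ)) (fun σ hσ => ?_)
    fun S => ?_⟩
  · exact image_rowSet_isPerfectMatching hcover hdisj fun t =>
      (mem_goodArrangements.1 hσ).1 t (notMem_empty t)
  · have h := card_filter_subset_image_rowSet_le hdisj (by positivity) σ₀
      (fun σ₁ D => hp.card_goodArrangements_fixed hR σ₁ D
        (by rwa [div_le_iff₀ hδ] at hN)) S
    refine h.trans (le_of_eq ?_)
    congr 2
    obtain ⟨m, rfl⟩ : ∃ m, r = m + 1 := ⟨r - 1, by omega⟩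
    rw [Nat.add_sub_cancel, pow_succ (n : ℝ)]
    field_simp
end
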